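/- Let d ≥ 2 and let k be a nonzero integer. For every ε > 0 there exists a constant C (depending on d, k and ε) such that for all positive integers N, R_d(k, N) ≤ C · N^{1 + 2/√d + ε}, where R_d(k, N) denotes the number of quadruples (n₁, n₂, n₃, n₄) of integers with 1 ≤ n₁, n₂, n₃, n₄ ≤ N and n₁^d + n₂^d − n₃^d − n₄^d = k. -/

import Mathlib

section

open Polynomial

theorem resultant_ne_zero_of_not_dvd {R : Type*} [CommRing R] [IsDomain R]
    [UniqueFactorizationMonoid R] {p q : R[X]} (hp : Irreducible p) (hdeg : p.natDegree ≠ 0)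
    (hpq : ¬ p ∣ q) : resultant p q ≠ 0 := by
  classical
  let := UniqueFactorizationMonoid.strongNormalizationMonoid (α := R)
  let := UniqueFactorizationMonoid.toNormalizedGCDMonoid R
  have hprim : p.IsPrimitive := hp.isPrimitive hdeg
  let K := FractionRing R
  have hinj : Function.Injective (algebraMap R K) := IsFractionRing.injective R K
  have hirr : Irreducible (p.map (algebraMap R K)) :=
    (hprim.irreducible_iff_irreducible_map_fraction_map (K := K)).1 hp
  intro h0
  have h1 : resultant (p.map (algebraMap R K)) (q.map (algebraMap R K)) = 0 := by
    rw [natDegree_map_eq_of_injective hinj, natDegree_map_eq_of_injective hinj,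
      resultant_map_map, h0, map_zero]
  rw [resultant_eq_zero_iff] at h1
  have h2 := h1.2
  rw [hirr.coprime_iff_not_dvd, not_not] at h2
  exact hpq (hprim.dvd_of_fraction_map_dvd_fraction_map (K := K) h2)

theorem natDegree_det_le_of_forall_le {R ι : Type*} [CommRing R] [Fintype ι] [DecidableEq ι]
    (M : Matrix ι ι R[X]) (n : ℕ) (h : ∀ i j, (M i j).natDegree ≤ n) :
    M.det.natDegree ≤ Fintype.card ι * n := by
  rw [Matrix.det_apply]
  apply natDegree_sum_le_of_forall_le
  intro σ _
  refine (natDegree_smul_le _ _).trans ((natDegree_prod_le _ _).trans ?_)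
  refine (Finset.sum_le_card_nsmul _ _ n fun i _ => h _ _).trans ?_
  simp

theorem natDegree_resultant_le {R : Type*} [CommRing R] (f g : R[X][X]) (n a b : ℕ)
    (hf : ∀ i, (f.coeff i).natDegree ≤ n) (hg : ∀ i, (g.coeff i).natDegree ≤ n) :
    (resultant f g a b).natDegree ≤ (a + b) * n := by
  unfold resultant
  refine (natDegree_det_le_of_forall_le _ n ?_).trans (by simp)
  intro i j
  simp only [sylvester, Matrix.of_apply]
  refine Fin.addCases (fun j => ?_) (fun j => ?_) j
  · simp only [Fin.addCases_left]; split_ifs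
    · exact hg _
    · simp
  · simp only [Fin.addCases_right]; split_ifs
    · exact hf _
    · simp

/-- The degree in each of the two variables is at most `n`. -/
def BidegLE (n : ℕ) (h : ℤ[X][X]) : Prop :=
  h.natDegree ≤ n ∧ ∀ i, (h.coeff i).natDegree ≤ n

/-- Specialization of the inner variable. -/
noncomputable def spec (u : ℤ) (h : ℤ[X][X]) : ℤ[X] := h.map (evalRingHom u)

theorem spec_natDegree_le (u : ℤ) (h : ℤ[X][X]) : (spec u h).natDegree ≤ h.natDegree :=
  natDegree_map_le

theorem C_X_sub_C_dvd_of_spec_eq_zero {u : ℤ} {h : ℤ[X][X]} (h0 : spec u h = 0) :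
    C (X - C u) ∣ h := by
  rw [C_dvd_iff_dvd_coeff]
  intro i
  rw [dvd_iff_isRoot]
  have := congrArg (fun p => coeff p i) h0
  simpa [spec] using this

theorem spec_ne_zero {h : ℤ[X][X]} (hirr : Irreducible h) (hdeg : h.natDegree ≠ 0) (u : ℤ) :
    spec u h ≠ 0 := by
  intro h0
  obtain ⟨g, hg⟩ := C_X_sub_C_dvd_of_spec_eq_zero h0
  rcases hirr.isUnit_or_isUnit hg with h1 | h1
  · rw [isUnit_C] at h1
    exact not_isUnit_X_sub_C u h1
  · apply hdeg
    rw [hg]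
    obtain ⟨r, hr, rfl⟩ := isUnit_iff.1 h1
    rw [← C_mul, natDegree_C]

theorem exists_finset_common_zeros {n : ℕ} {h g : ℤ[X][X]} (hirr : Irreducible h)
    (hdeg : h.natDegree ≠ 0) (hndvd : ¬ h ∣ g) (hh : BidegLE n h) (hg : BidegLE n g) :
    ∃ Z : Finset (ℤ × ℤ), Z.card ≤ 2 * n * n * n ∧
      ∀ u y : ℤ, (spec u h).eval y = 0 → (spec u g).eval y = 0 → (u, y) ∈ Z := by
  classical
  have hR : resultant h g ≠ 0 := resultant_ne_zero_of_not_dvd hirr hdeg hndvd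
  have hRdeg : (resultant h g).natDegree ≤ 2 * n * n := by
    refine (natDegree_resultant_le h g n _ _ hh.2 hg.2).trans ?_
    have h1 := hh.1
    have h2 := hg.1
    gcongr
    omega
  refine ⟨(resultant h g).roots.toFinset.biUnion
    fun u => ((spec u h).roots.toFinset.image fun y => (u, y)), ?_, ?_⟩
  · refine (Finset.card_biUnion_le_card_mul _ _ n ?_).trans ?_
    · intro u _
      refine Finset.card_image_le.trans ((Multiset.toFinset_card_le _).trans ?_)
      exact (card_roots' _).trans ((spec_natDegree_le _ _).trans hh.1)
    · gcongr
      exact (Multiset.toFinset_card_le _).trans ((card_roots' _).trans hRdeg)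
  · intro u y h1 h2
    simp only [Finset.mem_biUnion, Multiset.mem_toFinset, Finset.mem_image, Prod.mk.injEq]
    refine ⟨u, ?_, y, ?_, rfl, rfl⟩
    · rw [mem_roots hR, IsRoot.def]
      obtain ⟨p, q, -, -, hpq⟩ :=
        exists_mul_add_mul_eq_C_resultant h g le_rfl le_rfl (Or.inl hdeg)
      have h3 := congrArg (fun p => (spec u p).eval y) hpq
      simp only [spec, Polynomial.map_add, Polynomial.map_mul, eval_add, eval_mul, map_C,
        eval_C, coe_evalRingHom] at h3
      rw [← h3]
      simp only [spec] at h1 h2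
      rw [h1, h2]; ring
    · rw [mem_roots (spec_ne_zero hirr hdeg u), IsRoot.def, h1]

/-- A submultiplicative seminorm with natural number values. -/
structure IsHeight {A : Type*} [CommRing A] (ν : A → ℕ) : Prop where
  zero : ν 0 = 0
  one : ν 1 ≤ 1
  neg : ∀ a, ν (-a) = ν a
  add : ∀ a b, ν (a + b) ≤ ν a + ν b
  mul : ∀ a b, ν (a * b) ≤ ν a * ν b

namespace IsHeight

variable {A : Type*} [CommRing A] {ν : A → ℕ}

theorem sum (h : IsHeight ν) {ι : Type*} (s : Finset ι) (f : ι → A) :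
    ν (∑ i ∈ s, f i) ≤ ∑ i ∈ s, ν (f i) := by
  classical
  induction s using Finset.induction_on with
  | empty => simp [h.zero]
  | insert a s ha ih =>
    rw [Finset.sum_insert ha, Finset.sum_insert ha]
    exact (h.add _ _).trans (by gcongr)

theorem prod (h : IsHeight ν) {ι : Type*} (s : Finset ι) (f : ι → A) :
    ν (∏ i ∈ s, f i) ≤ ∏ i ∈ s, ν (f i) := by
  classical
  induction s using Finset.induction_on with
  | empty => simpa using h.one
  | insert a s ha ih =>
    rw [Finset.prod_insert ha, Finset.prod_insert ha]
    exact (h.mul _ _).trans (by gcongr)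

theorem pow (h : IsHeight ν) (a : A) (n : ℕ) : ν (a ^ n) ≤ ν a ^ n := by
  simpa using h.prod (Finset.range n) fun _ => a

theorem sub (h : IsHeight ν) (a b : A) : ν (a - b) ≤ ν a + ν b := by
  rw [sub_eq_add_neg, ← h.neg b]
  exact h.add _ _

theorem det (h : IsHeight ν) {ι : Type*} [Fintype ι] [DecidableEq ι] (M : Matrix ι ι A) (B : ℕ)
    (hM : ∀ i j, ν (M i j) ≤ B) :
    ν M.det ≤ (Fintype.card ι).factorial * B ^ Fintype.card ι := by
  rw [Matrix.det_apply]
  refine (h.sum _ _).trans ((Finset.sum_le_card_nsmul _ _ (B ^ Fintype.card ι) ?_).trans ?_)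
  · intro σ _
    have h1 : ν (Equiv.Perm.sign σ • ∏ i, M (σ i) i) = ν (∏ i, M (σ i) i) := by
      rcases Int.units_eq_one_or (Equiv.Perm.sign σ) with h2 | h2 <;> simp [h2, h.neg]
    rw [h1]
    refine (h.prod _ _).trans ((Finset.prod_le_prod' fun i _ => hM _ _).trans ?_)
    simp
  · simp [Finset.card_univ, Fintype.card_perm]

theorem resultant (h : IsHeight ν) (f g : A[X]) (a b B : ℕ) (hf : ∀ i, ν (f.coeff i) ≤ B)
    (hg : ∀ i, ν (g.coeff i) ≤ B) :
    ν (resultant f g a b) ≤ (a + b).factorial * B ^ (a + b) := by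
  unfold Polynomial.resultant
  refine (h.det _ B ?_).trans (by simp)
  intro i j
  simp only [sylvester, Matrix.of_apply]
  refine Fin.addCases (fun j => ?_) (fun j => ?_) j
  · simp only [Fin.addCases_left]; split_ifs
    · exact hg _
    · simp [h.zero]
  · simp only [Fin.addCases_right]; split_ifs
    · exact hf _
    · simp [h.zero]

end IsHeight

/-- The sum of the heights of the coefficients. -/
noncomputable def polyHeight {A : Type*} [CommRing A] (ν : A → ℕ) (p : A[X]) : ℕ :=
  p.sum fun _ a => ν a

section

variable {A : Type*} [CommRing A] {ν : A → ℕ}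

theorem polyHeight_monomial (h : IsHeight ν) (n : ℕ) (a : A) :
    polyHeight ν (monomial n a) = ν a := sum_monomial_index _ _ h.zero

theorem polyHeight_C (h : IsHeight ν) (a : A) : polyHeight ν (C a) = ν a :=
  polyHeight_monomial h 0 a

theorem polyHeight_X_le (h : IsHeight ν) : polyHeight ν (X : A[X]) ≤ 1 :=
  (polyHeight_monomial h 1 1).trans_le h.one

theorem coeff_le_polyHeight (h : IsHeight ν) (p : A[X]) (i : ℕ) :
    ν (p.coeff i) ≤ polyHeight ν p := by
  by_cases hi : i ∈ p.support
  · exact Finset.single_le_sum (f := fun i => ν (p.coeff i)) (fun _ _ => Nat.zero_le _) hi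
  · rw [notMem_support_iff.1 hi, h.zero]; exact Nat.zero_le _

theorem polyHeight_eq_sum (h : IsHeight ν) (p : A[X]) (s : Finset ℕ) (hs : p.support ⊆ s) :
    polyHeight ν p = ∑ i ∈ s, ν (p.coeff i) :=
  sum_eq_of_subset _ (fun _ => h.zero) hs

theorem polyHeight_add_le (h : IsHeight ν) (p q : A[X]) :
    polyHeight ν (p + q) ≤ polyHeight ν p + polyHeight ν q := by
  classical
  rw [polyHeight_eq_sum h (p + q) (p.support ∪ q.support) support_add,
    polyHeight_eq_sum h p _ Finset.subset_union_left,
    polyHeight_eq_sum h q _ Finset.subset_union_right, ← Finset.sum_add_distrib]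
  exact Finset.sum_le_sum fun i _ => by rw [coeff_add]; exact h.add _ _

theorem polyHeight_sum_le (h : IsHeight ν) {ι : Type*} (s : Finset ι) (f : ι → A[X]) :
    polyHeight ν (∑ i ∈ s, f i) ≤ ∑ i ∈ s, polyHeight ν (f i) := by
  classical
  induction s using Finset.induction_on with
  | empty => simp [polyHeight]
  | insert a s ha ih =>
    rw [Finset.sum_insert ha, Finset.sum_insert ha]
    exact (polyHeight_add_le h _ _).trans (by gcongr)

theorem isHeight_polyHeight (h : IsHeight ν) : IsHeight (polyHeight ν) where
  zero := by simp [polyHeight]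
  one := by rw [← C_1, polyHeight_C h]; exact h.one
  neg p := by
    unfold polyHeight
    rw [sum_def, sum_def, support_neg]
    exact Finset.sum_congr rfl fun i _ => by rw [coeff_neg, h.neg]
  add := polyHeight_add_le h
  mul p q := by
    have h1 : p * q = ∑ i ∈ p.support, ∑ j ∈ q.support,
        monomial (i + j) (p.coeff i * q.coeff j) := by
      rw [mul_eq_sum_sum]; rfl
    rw [h1]
    refine (polyHeight_sum_le h _ _).trans ?_
    unfold polyHeight
    rw [sum_def p, sum_def q, Finset.sum_mul_sum]
    refine Finset.sum_le_sum fun i _ => (polyHeight_sum_le h _ _).trans ?_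
    refine Finset.sum_le_sum fun j _ => ?_
    rw [polyHeight_monomial h]
    exact h.mul _ _

end

theorem isHeight_natAbs : IsHeight Int.natAbs where
  zero := rfl
  one := le_rfl
  neg := Int.natAbs_neg
  add := Int.natAbs_add_le
  mul a b := (Int.natAbs_mul a b).le

/-- The sum of the absolute values of the coefficients. -/
noncomputable def ht₁ (p : ℤ[X]) : ℕ := polyHeight Int.natAbs p

/-- The sum of the absolute values of the coefficients, in two variables. -/
noncomputable def ht₂ (p : ℤ[X][X]) : ℕ := polyHeight ht₁ p

/-- The sum of the absolute values of the coefficients, in three variables. -/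
noncomputable def ht₃ (p : ℤ[X][X][X]) : ℕ := polyHeight ht₂ p

theorem isHeight_ht₁ : IsHeight ht₁ := isHeight_polyHeight isHeight_natAbs
theorem isHeight_ht₂ : IsHeight ht₂ := isHeight_polyHeight isHeight_ht₁
theorem isHeight_ht₃ : IsHeight ht₃ := isHeight_polyHeight isHeight_ht₂

theorem natAbs_eval_le (p : ℤ[X]) {n : ℕ} (hn : p.natDegree ≤ n) {a : ℤ} {B : ℕ} (hB : 1 ≤ B)
    (ha : a.natAbs ≤ B) : (p.eval a).natAbs ≤ ht₁ p * B ^ n := by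
  rw [eval_eq_sum, sum_def, ht₁, polyHeight, sum_def, Finset.sum_mul]
  refine (isHeight_natAbs.sum _ _).trans (Finset.sum_le_sum fun i hi => ?_)
  rw [Int.natAbs_mul, Int.natAbs_pow]
  have : i ≤ n := (le_natDegree_of_mem_supp i hi).trans hn
  refine Nat.mul_le_mul_left _ ?_
  calc a.natAbs ^ i ≤ B ^ i := by gcongr
    _ ≤ B ^ n := Nat.pow_le_pow_right hB this

theorem ht₁_spec_le (h : ℤ[X][X]) {n : ℕ} (hn : ∀ i, (h.coeff i).natDegree ≤ n) {a : ℤ} {B : ℕ}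
    (hB : 1 ≤ B) (ha : a.natAbs ≤ B) : ht₁ (spec a h) ≤ ht₂ h * B ^ n := by
  have h1 : (spec a h).support ⊆ h.support := support_map_subset _ _
  rw [ht₁, polyHeight_eq_sum isHeight_natAbs _ _ h1, ht₂, polyHeight, sum_def, Finset.sum_mul]
  refine Finset.sum_le_sum fun i _ => ?_
  rw [spec, coeff_map, coe_evalRingHom]
  exact natAbs_eval_le _ (hn i) hB ha

theorem ht₁_derivative_le (p : ℤ[X]) {n : ℕ} (hn : p.natDegree ≤ n) :
    ht₁ (derivative p) ≤ n * ht₁ p := by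
  rw [derivative_apply, sum_def]
  refine (polyHeight_sum_le isHeight_natAbs _ _).trans ?_
  rw [ht₁, polyHeight, sum_def, Finset.mul_sum]
  refine Finset.sum_le_sum fun i hi => ?_
  rw [C_mul_X_pow_eq_monomial, polyHeight_monomial isHeight_natAbs, Int.natAbs_mul, mul_comm]
  have : i ≤ n := (le_natDegree_of_mem_supp i hi).trans hn
  gcongr
  simpa using this

theorem ht₁_le_of_dvd {f g : ℤ[X]} (hf : f ≠ 0) (hgf : g ∣ f) {n : ℕ} (hn : f.natDegree ≤ n) :
    ht₁ g ≤ (n + 1) * 2 ^ n * ht₁ f := by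
  obtain ⟨h, rfl⟩ := hgf
  have hg0 : g ≠ 0 := left_ne_zero_of_mul hf
  have hh0 : h ≠ 0 := right_ne_zero_of_mul hf
  have hgn : g.natDegree ≤ n := by
    rw [natDegree_mul hg0 hh0] at hn; omega
  have key : ∀ i, (g.coeff i).natAbs ≤ 2 ^ n * ht₁ (g * h) := by
    intro i
    have h1 := norm_coeff_le_choose_mul_mahlerMeasure_of_one_le_mahlerMeasure i
      (g.map (Int.castRingHom ℂ)) (h.map (Int.castRingHom ℂ))
      (one_le_mahlerMeasure_of_ne_zero hh0)
    rw [← Polynomial.map_mul] at h1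
    have h2 := mahlerMeasure_le_sum_norm_coeff ((g * h).map (Int.castRingHom ℂ))
    have h3 : ((g * h).map (Int.castRingHom ℂ)).sum (fun _ a => ‖a‖) = (ht₁ (g * h) : ℝ) := by
      rw [ht₁, polyHeight, sum_def, sum_def,
        support_map_of_injective _ (Int.cast_injective), Nat.cast_sum]
      refine Finset.sum_congr rfl fun i _ => ?_
      rw [coeff_map]
      simp [Nat.cast_natAbs]
    rw [h3] at h2
    have h4 : ((g.map (Int.castRingHom ℂ)).natDegree.choose i : ℝ) ≤ 2 ^ n := by
      have : (g.map (Int.castRingHom ℂ)).natDegree.choose i ≤ 2 ^ n :=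
        (Nat.choose_le_two_pow _ _).trans
          (Nat.pow_le_pow_right two_pos (natDegree_map_le.trans hgn))
      exact_mod_cast this
    have h5 : ((g.coeff i).natAbs : ℝ) ≤ 2 ^ n * (ht₁ (g * h) : ℝ) := by
      have h6 : ((g.coeff i).natAbs : ℝ) = ‖(g.map (Int.castRingHom ℂ)).coeff i‖ := by
        simp [Nat.cast_natAbs]
      rw [h6]
      refine h1.trans ?_
      gcongr
      exact mahlerMeasure_nonneg _
    exact_mod_cast h5
  rw [ht₁, polyHeight_eq_sum isHeight_natAbs g (Finset.range (n + 1))]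
  · refine (Finset.sum_le_card_nsmul _ _ _ fun i _ => key i).trans ?_
    simp [mul_assoc]
  · exact (supp_subset_range (Nat.lt_succ_of_le hgn))

theorem exists_common_relation {α ι κ : Type*} [DecidableEq ι] [DecidableEq κ]
    (S : Set α) (I : Finset ι) (Q : Finset κ) (v : ι → α → ℤ) (e : ι → ℕ) (N q r : ℕ)
    (hq : 0 < q) (hN : 0 < N)
    (hv : ∀ m ∈ I, ∀ P ∈ S, (v m P).natAbs ≤ N ^ e m)
    (t : κ → ℕ) (ht : ∀ k ∈ Q, t k ≤ r) (E : ι → κ → ℤ) (w : κ → α → ℤ)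
    (hw : ∀ P ∈ S, ∀ k ∈ Q, (q : ℤ) ^ t k ∣ w k P)
    (hcong : ∀ m ∈ I, ∀ P ∈ S, (q : ℤ) ^ r ∣ v m P - ∑ k ∈ Q, E m k * w k P)
    (hbig : q ^ (∑ k ∈ Q, (r - t k)) * (I.card ^ I.card * N ^ (∑ m ∈ I, e m)) < q ^ (r * I.card)) :
    ∃ g : ι → ℤ, (∃ m ∈ I, g m ≠ 0) ∧ (∀ m ∈ I, (g m).natAbs ≤ q ^ r) ∧
      ∀ P ∈ S, ∑ m ∈ I, g m * v m P = 0 := by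
  classical
  set s := I.card with hs
  have hspos : 0 < s := by
    rcases Nat.eq_zero_or_pos s with h | h
    · exfalso
      rw [h] at hbig
      have : I = ∅ := Finset.card_eq_zero.1 (hs ▸ h)
      subst this
      simp at hbig
      omega
    · exact h
  set B : ι → ℕ := fun m => (q ^ r - 1) / (s * N ^ e m) with hB
  have hqr : 0 < q ^ r := pow_pos hq r
  have hB1 : ∀ m, s * N ^ e m * B m ≤ q ^ r - 1 := fun m => Nat.mul_div_le _ _
  have hB2 : ∀ m, q ^ r ≤ s * N ^ e m * (B m + 1) := by
    intro m
    have := Nat.lt_mul_div_succ (q ^ r - 1) (b := s * N ^ e m) (by positivity)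
    have h2 : q ^ r - 1 < s * N ^ e m * (B m + 1) := this
    omega
  have hcount : q ^ (∑ k ∈ Q, (r - t k)) < ∏ m ∈ I, (B m + 1) := by
    have h1 : q ^ (r * s) ≤ (s ^ s * N ^ (∑ m ∈ I, e m)) * ∏ m ∈ I, (B m + 1) := by
      have : ∏ m ∈ I, q ^ r ≤ ∏ m ∈ I, (s * N ^ e m * (B m + 1)) :=
        Finset.prod_le_prod' fun m _ => hB2 m
      rw [Finset.prod_const, ← pow_mul, Finset.prod_mul_distrib, Finset.prod_mul_distrib,
        Finset.prod_const, Finset.prod_pow_eq_pow_sum] at this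
      exact this
    have h2 := hbig.trans_le h1
    rw [mul_comm] at h2
    exact lt_of_mul_lt_mul_left h2 (Nat.zero_le _)
  let D : Finset (∀ m ∈ I, ℕ) := I.pi fun m => Finset.range (B m + 1)
  let T : Finset (∀ k ∈ Q, ℤ) := Q.pi fun k => Finset.Ico (0 : ℤ) ((q : ℤ) ^ (r - t k))
  let f : (∀ m ∈ I, ℕ) → (∀ k ∈ Q, ℤ) := fun g k _ =>
    (∑ m ∈ I.attach, (g m m.2 : ℤ) * E m k) % (q : ℤ) ^ (r - t k)
  have hDT : T.card < D.card := by
    simp only [D, T, Finset.card_pi, Finset.card_range, Int.card_Ico, sub_zero]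
    refine lt_of_eq_of_lt ?_ hcount
    rw [← Finset.prod_pow_eq_pow_sum]
    refine Finset.prod_congr rfl fun k _ => ?_
    have : ((q : ℤ) ^ (r - t k)) = ((q ^ (r - t k) : ℕ) : ℤ) := by push_cast; rfl
    rw [this, Int.toNat_natCast]
  have hmap : ∀ g ∈ D, f g ∈ T := by
    intro g _
    simp only [T, Finset.mem_pi, Finset.mem_Ico, f]
    intro k _
    have hpos : (0 : ℤ) < (q : ℤ) ^ (r - t k) := by positivity
    exact ⟨Int.emod_nonneg _ hpos.ne', Int.emod_lt_of_pos _ hpos⟩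
  obtain ⟨g₁, hg₁, g₂, hg₂, hne, hf⟩ := Finset.exists_ne_map_eq_of_card_lt_of_maps_to hDT hmap
  let G : ι → ℤ := fun m => if hm : m ∈ I then (g₁ m hm : ℤ) - g₂ m hm else 0
  have hGB : ∀ m ∈ I, (G m).natAbs ≤ B m := by
    intro m hm
    have h1 := Finset.mem_range.1 (Finset.mem_pi.1 hg₁ m hm)
    have h2 := Finset.mem_range.1 (Finset.mem_pi.1 hg₂ m hm)
    simp only [G, hm, dif_pos]
    omega
  refine ⟨G, ?_, ?_, ?_⟩
  · by_contra hcon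
    push Not at hcon
    apply hne
    funext m hm
    have := hcon m hm
    simp only [G, hm, dif_pos] at this
    omega
  · intro m hm
    have h1 := hB1 m
    have h2 : 1 * 1 ≤ s * N ^ e m := Nat.mul_le_mul hspos (Nat.one_le_pow _ _ hN)
    have h3 : B m ≤ s * N ^ e m * B m := Nat.le_mul_of_pos_left _ (by omega)
    have := hGB m hm
    omega
  · intro P hP
    have hdvdE : ∀ k ∈ Q, (q : ℤ) ^ (r - t k) ∣ ∑ m ∈ I, G m * E m k := by
      intro k hk
      have h1 := congrFun (congrFun hf k) hk
      simp only [f] at h1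
      have h2 := Int.ModEq.dvd (n := (q : ℤ) ^ (r - t k)) h1.symm
      rw [← Finset.sum_attach I, ]
      convert h2 using 1
      rw [← Finset.sum_sub_distrib]
      refine Finset.sum_congr rfl fun m _ => ?_
      simp only [G, m.2, dif_pos]
      ring
    have h1 : (q : ℤ) ^ r ∣ ∑ m ∈ I, G m * v m P := by
      have h2 : ∑ m ∈ I, G m * v m P =
          ∑ m ∈ I, G m * (v m P - ∑ k ∈ Q, E m k * w k P) +
            ∑ k ∈ Q, (∑ m ∈ I, G m * E m k) * w k P := by
        simp only [mul_sub, Finset.sum_sub_distrib, Finset.mul_sum, Finset.sum_mul]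
        rw [Finset.sum_comm (s := Q)]
        simp only [mul_assoc, sub_add_cancel]
      rw [h2]
      refine dvd_add (Finset.dvd_sum fun m hm => Dvd.dvd.mul_left (hcong m hm P hP) _)
        (Finset.dvd_sum fun k hk => ?_)
      have h3 := mul_dvd_mul (hdvdE k hk) (hw P hP k hk)
      rwa [← pow_add, Nat.sub_add_cancel (ht k hk)] at h3
    apply Int.eq_zero_of_abs_lt_dvd h1
    have h4 : (∑ m ∈ I, G m * v m P).natAbs < q ^ r := by
      have h5 : (∑ m ∈ I, G m * v m P).natAbs * s ≤ s * (q ^ r - 1) := by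
        calc (∑ m ∈ I, G m * v m P).natAbs * s
            ≤ (∑ m ∈ I, B m * N ^ e m) * s := by
              gcongr
              refine (isHeight_natAbs.sum _ _).trans (Finset.sum_le_sum fun m hm => ?_)
              rw [Int.natAbs_mul]
              exact Nat.mul_le_mul (hGB m hm) (hv m hm P hP)
          _ = ∑ m ∈ I, s * N ^ e m * B m := by
              rw [Finset.sum_mul]; exact Finset.sum_congr rfl fun m _ => by ring
          _ ≤ ∑ m ∈ I, (q ^ r - 1) := Finset.sum_le_sum fun m _ => hB1 m
          _ = s * (q ^ r - 1) := by simp [hs]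
      rw [mul_comm] at h5
      have := le_of_mul_le_mul_left h5 hspos
      omega
    rw [Int.abs_eq_natAbs]
    exact_mod_cast h4

theorem exists_hensel_lift {α A : Type*} [CommRing A] (S : Set α) (ev : α → A →+* ℤ)
    (Φ : A[X]) (q : ℤ) (y : α → ℤ) (y₀ l : ℤ)
    (hroot : ∀ P ∈ S, (Φ.map (ev P)).eval (y P) = 0)
    (hy : ∀ P ∈ S, q ∣ y₀ - y P)
    (hl : ∀ P ∈ S, q ∣ 1 - l * (derivative (Φ.map (ev P))).eval (y P)) (k : ℕ) :
    ∃ φ : A, ∀ P ∈ S, q ^ (k + 1) ∣ ev P φ - y P := by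
  induction k with
  | zero => exact ⟨(y₀ : A), fun P hP => by simpa using hy P hP⟩
  | succ k ih =>
    obtain ⟨φ, hφ⟩ := ih
    refine ⟨φ - (l : A) * Φ.eval φ, fun P hP => ?_⟩
    set x := ev P φ with hx
    have h1 : ev P (Φ.eval φ) = (Φ.map (ev P)).eval x := by
      rw [hx, eval_map, eval₂_hom]
    obtain ⟨c, hc⟩ := (Φ.map (ev P)).binomExpansion (y P) (x - y P)
    rw [add_sub_cancel, hroot P hP] at hc
    rw [map_sub, map_mul, map_intCast, h1, hc, ← hx]
    obtain ⟨a, ha⟩ := hφ P hP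
    obtain ⟨b, hb⟩ := hl P hP
    have h2 : (l : ℤ) * (derivative (Φ.map (ev P))).eval (y P) = 1 - q * b := by
      rw [← hb]; ring
    refine ⟨a * b - l * c * a ^ 2 * q ^ k, ?_⟩
    have h3 : x - (l : ℤ) * (0 + (derivative (Φ.map (ev P))).eval (y P) * (x - y P) +
        c * (x - y P) ^ 2) - y P
        = (x - y P) * (1 - l * (derivative (Φ.map (ev P))).eval (y P)) -
          l * c * (x - y P) ^ 2 := by ring
    simp only [Int.cast_id]
    rw [h3, hb, ha]
    ring

/-- Pairs of natural numbers with sum less than `n`. -/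
def tri (n : ℕ) : Finset ((_ : ℕ) × ℕ) := (Finset.range n).sigma fun b => Finset.range (n - b)

theorem pow_dvd_eval_sub_sum {q a : ℤ} (ha : q ∣ a) (p : ℤ[X]) (r : ℕ) :
    q ^ r ∣ p.eval a - ∑ i ∈ Finset.range r, p.coeff i * a ^ i := by
  set n := max r (p.natDegree + 1)
  rw [eval_eq_sum_range' (n := n) (by omega),
    ← Finset.sum_range_add_sum_Ico _ (le_max_left r (p.natDegree + 1)), add_sub_cancel_left]
  refine Finset.dvd_sum fun i hi => Dvd.dvd.mul_left ?_ _
  exact (pow_dvd_pow q (Finset.mem_Ico.1 hi).1).trans (pow_dvd_pow_of_dvd ha i)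

theorem pow_dvd_evalEval_sub_sum {q a b : ℤ} (ha : q ∣ a) (hb : q ∣ b) (p : ℤ[X][X]) (r : ℕ) :
    q ^ r ∣ p.evalEval a b -
      ∑ k ∈ tri r, (p.coeff k.1).coeff k.2 * (a ^ k.2 * b ^ k.1) := by
  have h1 : p.evalEval a b = (p.map (evalRingHom a)).eval b := by
    rw [← map_evalRingHom_eval]
  rw [h1, tri, Finset.sum_sigma]
  have h2 := pow_dvd_eval_sub_sum hb (p.map (evalRingHom a)) r
  have h3 : q ^ r ∣ ∑ i ∈ Finset.range r, (p.map (evalRingHom a)).coeff i * b ^ i -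
      ∑ i ∈ Finset.range r, ∑ j ∈ Finset.range (r - i),
        (p.coeff i).coeff j * (a ^ j * b ^ i) := by
    rw [← Finset.sum_sub_distrib]
    refine Finset.dvd_sum fun i hi => ?_
    have h4 : (p.map (evalRingHom a)).coeff i * b ^ i -
        ∑ j ∈ Finset.range (r - i), (p.coeff i).coeff j * (a ^ j * b ^ i) =
        ((p.coeff i).eval a - ∑ j ∈ Finset.range (r - i), (p.coeff i).coeff j * a ^ j) * b ^ i := by
      rw [coeff_map, coe_evalRingHom, sub_mul, Finset.sum_mul]
      congr 1
      exact Finset.sum_congr rfl fun j _ => by ring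
    rw [h4]
    have h5 := mul_dvd_mul (pow_dvd_eval_sub_sum ha (p.coeff i) (r - i)) (pow_dvd_pow_of_dvd hb i)
    rwa [← pow_add, Nat.sub_add_cancel (Finset.mem_range.1 hi).le] at h5
  have := dvd_add h2 h3
  rwa [sub_add_sub_cancel] at this

theorem pow_mul_lt_of_rpow_le {N q s r E e : ℕ} {θ : ℝ} (hN : s ^ s < N)
    (hq : (N : ℝ) ^ θ ≤ q) (hE : E ≤ r * s) (h : (e : ℝ) + 1 ≤ θ * (r * s - E)) :
    q ^ E * (s ^ s * N ^ e) < q ^ (r * s) := by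
  have hN1 : (1 : ℝ) ≤ N := by exact_mod_cast (Nat.zero_lt_of_lt hN)
  have hN0 : (0 : ℝ) < N := by linarith
  have hq0 : (0 : ℝ) < q := (Real.rpow_pos_of_pos hN0 θ).trans_le hq
  obtain ⟨m, hm⟩ := Nat.exists_eq_add_of_le hE
  have h1 : s ^ s * N ^ e < q ^ m := by
    have h2 : (N : ℝ) ^ (e + 1) ≤ (q : ℝ) ^ m := by
      calc (N : ℝ) ^ (e + 1) = (N : ℝ) ^ ((e : ℝ) + 1) := by
            rw [← Real.rpow_natCast]; push_cast; rfl
        _ ≤ (N : ℝ) ^ (θ * m) := by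
            apply Real.rpow_le_rpow_of_exponent_le hN1
            have : (r : ℝ) * s = E + m := by exact_mod_cast hm
            rw [this] at h
            linarith
        _ = ((N : ℝ) ^ θ) ^ m := by rw [Real.rpow_mul hN0.le, Real.rpow_natCast]
        _ ≤ (q : ℝ) ^ m := by gcongr
    have h3 : N ^ (e + 1) ≤ q ^ m := by exact_mod_cast h2
    calc s ^ s * N ^ e < N * N ^ e := by
          apply Nat.mul_lt_mul_of_pos_right hN
          exact pow_pos (by exact_mod_cast hN0) _
      _ = N ^ (e + 1) := by ring
      _ ≤ q ^ m := h3
  rw [hm, pow_add]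
  exact Nat.mul_lt_mul_of_pos_left h1 (pow_pos (by exact_mod_cast hq0) _)

/-- The polynomial in two variables with given coefficients. -/
noncomputable def polyOf (M d : ℕ) (g : ℕ → ℕ → ℤ) : ℤ[X][X] :=
  ∑ j ∈ Finset.range d, monomial j (∑ i ∈ Finset.range M, monomial i (g i j))

theorem coeff_coeff_polyOf {M d : ℕ} (g : ℕ → ℕ → ℤ) {i j : ℕ} (hi : i < M) (hj : j < d) :
    ((polyOf M d g).coeff j).coeff i = g i j := by
  simp [polyOf, coeff_monomial, hi, hj]

theorem natDegree_polyOf_lt {M d : ℕ} (hd : 0 < d) (g : ℕ → ℕ → ℤ) :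
    (polyOf M d g).natDegree < d := by
  have : (polyOf M d g).natDegree ≤ d - 1 := by
    apply natDegree_sum_le_of_forall_le
    intro j hj
    have := Finset.mem_range.1 hj
    exact (natDegree_monomial_le _).trans (by omega)
  omega

theorem natDegree_coeff_polyOf_le {M d : ℕ} (g : ℕ → ℕ → ℤ) (j : ℕ) :
    ((polyOf M d g).coeff j).natDegree ≤ M := by
  simp only [polyOf, finsetSum_coeff, coeff_monomial, Finset.sum_ite_eq']
  split_ifs
  · apply natDegree_sum_le_of_forall_le
    intro i hi
    exact (natDegree_monomial_le _).trans (Finset.mem_range.1 hi).le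
  · simp

theorem eval_spec_polyOf (M d : ℕ) (g : ℕ → ℕ → ℤ) (x y : ℤ) :
    (spec x (polyOf M d g)).eval y =
      ∑ m ∈ Finset.range M ×ˢ Finset.range d, g m.1 m.2 * (x ^ m.1 * y ^ m.2) := by
  rw [Finset.sum_product_right, spec, polyOf, Polynomial.map_sum, eval_finsetSum]
  refine Finset.sum_congr rfl fun j _ => ?_
  rw [map_monomial, eval_monomial, coe_evalRingHom, eval_finsetSum, Finset.sum_mul]
  refine Finset.sum_congr rfl fun i _ => ?_
  rw [eval_monomial]; ring

theorem dvd_pow_mul_pow_sub {q : ℤ} {a a' b b' : ℤ} (ha : q ∣ a - a') (hb : q ∣ b - b')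
    (i j : ℕ) : q ∣ a ^ i * b ^ j - a' ^ i * b' ^ j := by
  have h1 : a ^ i * b ^ j ≡ a' ^ i * b' ^ j [ZMOD q] :=
    (((Int.modEq_iff_dvd.2 ha).symm).pow i).mul (((Int.modEq_iff_dvd.2 hb).symm).pow j)
  exact h1.symm.dvd

theorem exists_inverse_of_congr {α : Type*} (S : Set α) (f : α → ℤ) (q : ℤ)
    (hcong : ∀ P ∈ S, ∀ Q ∈ S, q ∣ f P - f Q) (hcop : ∀ P ∈ S, IsCoprime (f P) q) :
    ∃ l : ℤ, ∀ P ∈ S, q ∣ 1 - l * f P := by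
  rcases S.eq_empty_or_nonempty with rfl | ⟨P₀, hP₀⟩
  · exact ⟨0, by simp⟩
  · obtain ⟨a, b, hab⟩ := hcop P₀ hP₀
    refine ⟨a, fun P hP => ?_⟩
    have : 1 - a * f P = q * b - a * (f P - f P₀) := by rw [← hab]; ring
    rw [this]
    exact dvd_sub (dvd_mul_right _ _) (Dvd.dvd.mul_left (hcong P hP P₀ hP₀) _)

theorem dvd_eval_sub_eval_of_dvd {q : ℤ} (g : ℤ[X][X]) {a a' b b' : ℤ} (ha : q ∣ a - a')
    (hb : q ∣ b - b') : q ∣ (spec a g).eval b - (spec a' g).eval b' := by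
  have h1 : q ∣ (spec a g).eval b - (spec a g).eval b' :=
    hb.trans (sub_dvd_eval_sub _ _ _)
  have h2 : q ∣ (spec a g).eval b' - (spec a' g).eval b' := by
    have h3 : ∀ x : ℤ, (spec x g).eval b' = (g.eval (C b')).eval x := by
      intro x
      exact map_evalRingHom_eval x b' g
    rw [h3, h3]
    exact ha.trans (sub_dvd_eval_sub _ _ _)
  have := dvd_add h1 h2
  rwa [sub_add_sub_cancel] at this

theorem exists_polyOf_vanishing {d M : ℕ} (hd : 0 < d) (hM : 0 < M) {θ : ℝ}
    (hθ : θ + d ≤ (θ * d - 1) * M) {N q : ℕ}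
    (hN : (d * M) ^ (d * M) < N) (hq : (N : ℝ) ^ θ ≤ q) (h : ℤ[X][X]) (S : Set (ℤ × ℤ))
    (hS : ∀ P ∈ S, P.1.natAbs ≤ N ∧ P.2.natAbs ≤ N)
    (hcong : ∀ P ∈ S, ∀ Q ∈ S, (q : ℤ) ∣ P.1 - Q.1 ∧ (q : ℤ) ∣ P.2 - Q.2)
    (hroot : ∀ P ∈ S, (spec P.1 h).eval P.2 = 0)
    (hcop : ∀ P ∈ S, IsCoprime ((derivative (spec P.1 h)).eval P.2) (q : ℤ)) :
    ∃ g : ℕ → ℕ → ℤ, polyOf M d g ≠ 0 ∧ ∀ P ∈ S, (spec P.1 (polyOf M d g)).eval P.2 = 0 := by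
  classical
  rcases S.eq_empty_or_nonempty with rfl | ⟨P₀, hP₀⟩
  · refine ⟨fun _ _ => 1, fun h0 => ?_, by simp⟩
    have := coeff_coeff_polyOf (M := M) (d := d) (fun _ _ => 1) hM hd
    rw [h0] at this
    simp at this
  set r := d * M with hr
  have hderiv : ∀ x, derivative (spec x h) = spec x (derivative h) := fun x => derivative_map _ _
  obtain ⟨l, hl⟩ := exists_inverse_of_congr S (fun P => (derivative (spec P.1 h)).eval P.2) q
    (fun P hP Q hQ => by
      simp only [hderiv]
      exact dvd_eval_sub_eval_of_dvd _ (hcong P hP Q hQ).1 (hcong P hP Q hQ).2) hcop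
  have hmap : ∀ P : ℤ × ℤ, (h.map (compRingHom (X + C P₀.1))).map (evalRingHom (P.1 - P₀.1)) =
      spec P.1 h := by
    intro P
    rw [Polynomial.map_map, spec]
    congr 1
    ext <;> simp
  obtain ⟨φ, hφ⟩ := exists_hensel_lift S (fun P => evalRingHom (P.1 - P₀.1))
    (h.map (compRingHom (X + C P₀.1))) q (fun P => P.2) P₀.2 l
    (fun P hP => by rw [hmap]; exact hroot P hP) (fun P hP => (hcong P₀ hP₀ P hP).2)
    (fun P hP => by rw [hmap]; exact hl P hP) (r - 1)
  have hrpos : 0 < r := Nat.mul_pos hd hM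
  rw [Nat.sub_add_cancel hrpos] at hφ
  have hN1 : 0 < N := Nat.zero_lt_of_lt hN
  have hq0 : 0 < q := by
    have : (0 : ℝ) < q := (Real.rpow_pos_of_pos (by exact_mod_cast hN1) θ).trans_le hq
    exact_mod_cast this
  have hcard : (Finset.range M ×ˢ Finset.range d).card = r := by
    rw [Finset.card_product, Finset.card_range, Finset.card_range, hr, mul_comm]
  let p : ℕ × ℕ → ℤ[X] := fun m => (X + C P₀.1) ^ m.1 * φ ^ m.2
  obtain ⟨g, ⟨m₀, hm₀, hgm₀⟩, -, hg⟩ := exists_common_relation S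
    (Finset.range M ×ˢ Finset.range d) (Finset.range r) (fun m P => P.1 ^ m.1 * P.2 ^ m.2)
    (fun m => m.1 + m.2) N q r hq0 hN1
    (fun m _ P hP => by
      rw [Int.natAbs_mul, Int.natAbs_pow, Int.natAbs_pow, pow_add]
      have := hS P hP
      exact Nat.mul_le_mul (Nat.pow_le_pow_left this.1 _) (Nat.pow_le_pow_left this.2 _))
    (fun k => k) (fun k hk => (Finset.mem_range.1 hk).le) (fun m k => (p m).coeff k)
    (fun k P => (P.1 - P₀.1) ^ k)
    (fun P hP k _ => pow_dvd_pow_of_dvd (hcong P hP P₀ hP₀).1 _)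
    (fun m _ P hP => by
      have h1 := pow_dvd_eval_sub_sum (hcong P hP P₀ hP₀).1 (p m) r
      have h2 : (q : ℤ) ^ r ∣ P.1 ^ m.1 * P.2 ^ m.2 - (p m).eval (P.1 - P₀.1) := by
        have h3 : (p m).eval (P.1 - P₀.1) = P.1 ^ m.1 * (φ.eval (P.1 - P₀.1)) ^ m.2 := by
          simp [p]
        rw [h3]
        exact dvd_pow_mul_pow_sub (by simp) (dvd_sub_comm.1 (hφ P hP)) _ _
      have := dvd_add h2 h1
      rwa [sub_add_sub_cancel] at this)
    (by
      rw [hcard]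
      refine pow_mul_lt_of_rpow_le hN hq ?_ ?_
      · refine (Finset.sum_le_card_nsmul _ _ r fun k _ => Nat.sub_le _ _).trans ?_
        simp
      · have h1 : ((∑ k ∈ Finset.range r, (r - k) : ℕ) : ℝ) = r * (r + 1) / 2 := by
          have : ∀ n : ℕ, ((∑ k ∈ Finset.range n, (n - k) : ℕ) : ℝ) = n * (n + 1) / 2 := by
            intro n
            induction n with
            | zero => simp
            | succ n ih =>
              rw [Finset.sum_range_succ']
              simp only [Nat.add_sub_add_right, Nat.sub_zero]
              push_cast at ih ⊢
              rw [ih]; ring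
          exact this r
        have h2 : ∀ n : ℕ, ((∑ k ∈ Finset.range n, k : ℕ) : ℝ) = n * (n - 1) / 2 := by
          intro n
          induction n with
          | zero => simp
          | succ n ih => rw [Finset.sum_range_succ, Nat.cast_add, ih]; push_cast; ring
        have h3 : ((∑ m ∈ Finset.range M ×ˢ Finset.range d, (m.1 + m.2) : ℕ) : ℝ) =
            d * (M * (M - 1) / 2) + M * (d * (d - 1) / 2) := by
          rw [Finset.sum_product]
          have h6 : ∀ x ∈ Finset.range M, ∑ y ∈ Finset.range d, (x + y) =
              d * x + ∑ y ∈ Finset.range d, y := fun x _ => by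
            rw [Finset.sum_add_distrib, Finset.sum_const, Finset.card_range, smul_eq_mul]
          rw [Finset.sum_congr rfl h6, Finset.sum_add_distrib, ← Finset.mul_sum, Finset.sum_const,
            Finset.card_range, smul_eq_mul, Nat.cast_add, Nat.cast_mul, Nat.cast_mul, h2, h2]
        rw [h1, h3]
        have hrr : (r : ℝ) = d * M := by rw [hr]; push_cast; rfl
        have hr1 : (1 : ℝ) ≤ r := by exact_mod_cast hrpos
        have h4 : θ * ((r : ℝ) * r - r * (r + 1) / 2) -
            (d * (M * (M - 1) / 2) + M * (d * (d - 1) / 2)) =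
            r / 2 * ((θ * d - 1) * M - θ - d + 2) := by rw [hrr]; ring
        have h5 : r / 2 * 2 ≤ r / 2 * ((θ * d - 1) * M - θ - d + 2) := by
          gcongr; linarith
        linarith)
  have hm := Finset.mem_product.1 hm₀
  refine ⟨fun i j => g (i, j), fun h0 => hgm₀ ?_, fun P hP => ?_⟩
  · have := coeff_coeff_polyOf (fun i j => g (i, j)) (Finset.mem_range.1 hm.1)
      (Finset.mem_range.1 hm.2)
    rw [h0] at this
    simpa using this.symm
  · rw [eval_spec_polyOf]
    exact hg P hP

theorem exists_card_curve_le {d : ℕ} (hd : 0 < d) (n : ℕ) {θ : ℝ} (hθ : 1 < θ * d) :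
    ∃ B N₀ : ℕ, ∀ N q : ℕ, N₀ ≤ N → (N : ℝ) ^ θ ≤ q → ∀ h : ℤ[X][X], Irreducible h →
      BidegLE n h → d ≤ h.natDegree → ∀ S : Set (ℤ × ℤ),
      (∀ P ∈ S, P.1.natAbs ≤ N ∧ P.2.natAbs ≤ N) →
      (∀ P ∈ S, ∀ Q ∈ S, (q : ℤ) ∣ P.1 - Q.1 ∧ (q : ℤ) ∣ P.2 - Q.2) →
      (∀ P ∈ S, (spec P.1 h).eval P.2 = 0) →
      (∀ P ∈ S, IsCoprime ((derivative (spec P.1 h)).eval P.2) (q : ℤ)) →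
      ∃ Z : Finset (ℤ × ℤ), Z.card ≤ B ∧ ∀ P ∈ S, P ∈ Z := by
  have hd0 : (0 : ℝ) < d := by exact_mod_cast hd
  have hθ0 : 0 < θ := by
    by_contra hcon
    push Not at hcon
    have := mul_nonpos_of_nonpos_of_nonneg hcon hd0.le
    linarith
  obtain ⟨M, hM⟩ := exists_nat_gt ((θ + d) / (θ * d - 1))
  have hδ : 0 < θ * d - 1 := by linarith
  have hM' : θ + d ≤ (θ * d - 1) * M := by
    rw [div_lt_iff₀ hδ] at hM
    linarith
  have hM0 : 0 < M := by
    rcases Nat.eq_zero_or_pos M with h | h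
    · subst h; simp at hM'; linarith
    · exact h
  set m := max n (max d M) with hm
  refine ⟨2 * m * m * m, (d * M) ^ (d * M) + 1, ?_⟩
  intro N q hN hq h hirr hbi hdeg S h1 h2 h3 h4
  obtain ⟨g, hg0, hg⟩ := exists_polyOf_vanishing hd hM0 hM' (by omega) hq h S h1 h2 h3 h4
  have hlt := natDegree_polyOf_lt (M := M) hd g
  obtain ⟨Z, hZ, hZ'⟩ := exists_finset_common_zeros (n := m) hirr (by omega)
    (fun hdvd => by
      have := natDegree_le_of_dvd hdvd hg0
      omega)
    ⟨hbi.1.trans (le_max_left _ _), fun i => (hbi.2 i).trans (le_max_left _ _)⟩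
    (g := polyOf M d g)
    ⟨by omega, fun i => (natDegree_coeff_polyOf_le g i).trans (by omega)⟩
  exact ⟨Z, hZ, fun P hP => hZ' P.1 P.2 (h3 P hP) (hg P hP)⟩

theorem sum_tri_succ (f : ℕ → ℕ → ℝ) (n : ℕ) :
    ∑ k ∈ tri (n + 1), f k.1 k.2 =
      ∑ k ∈ tri n, f (k.1 + 1) k.2 + ∑ a ∈ Finset.range (n + 1), f 0 a := by
  rw [tri, tri, Finset.sum_sigma, Finset.sum_sigma, Finset.sum_range_succ']
  simp

theorem card_tri (n : ℕ) : ((tri n).card : ℝ) = n * (n + 1) / 2 := by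
  induction n with
  | zero => simp [tri]
  | succ n ih =>
    have h := sum_tri_succ (fun _ _ => 1) n
    simp only [Finset.sum_const, nsmul_eq_mul, mul_one, Finset.card_range] at h
    rw [h, ih]; push_cast; ring

theorem sum_tri (n : ℕ) :
    ∑ k ∈ tri n, ((k.1 : ℝ) + k.2) = ((n : ℝ) - 1) * n * (n + 1) / 3 := by
  induction n with
  | zero => simp [tri, Finset.sum_sigma]
  | succ n ih =>
    have h := sum_tri_succ (fun a b => (a : ℝ) + b) n
    have h1 : ∀ n : ℕ, ∑ a ∈ Finset.range (n + 1), (a : ℝ) = n * (n + 1) / 2 := by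
      intro n
      induction n with
      | zero => simp
      | succ n ih => rw [Finset.sum_range_succ, ih]; push_cast; ring
    have h2 : ∑ k ∈ tri n, (((k.1 + 1 : ℕ) : ℝ) + k.2) =
        ∑ k ∈ tri n, ((k.1 : ℝ) + k.2) + (tri n).card := by
      rw [← nsmul_one, ← Finset.sum_const, ← Finset.sum_add_distrib]
      refine Finset.sum_congr rfl fun k _ => ?_
      push_cast; ring
    rw [h, h2, ih, card_tri]
    simp only [Nat.cast_zero, zero_add]
    rw [h1]
    push_cast; ring

theorem add_lt_of_mem_tri {n : ℕ} {k : (_ : ℕ) × ℕ} (hk : k ∈ tri n) : k.1 + k.2 < n := by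
  rw [tri, Finset.mem_sigma, Finset.mem_range, Finset.mem_range] at hk
  omega

theorem sum_tri_sub (n : ℕ) :
    ((∑ k ∈ tri n, (n - (k.1 + k.2)) : ℕ) : ℝ) = (n : ℝ) * (n + 1) * (n + 2) / 6 := by
  have h1 : ((∑ k ∈ tri n, (n - (k.1 + k.2)) : ℕ) : ℝ) =
      ∑ k ∈ tri n, ((n : ℝ) - ((k.1 : ℝ) + k.2)) := by
    rw [Nat.cast_sum]
    refine Finset.sum_congr rfl fun k hk => ?_
    rw [Nat.cast_sub (add_lt_of_mem_tri hk).le]; push_cast; rfl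
  rw [h1, Finset.sum_sub_distrib, sum_tri, Finset.sum_const, nsmul_eq_mul, card_tri]
  ring

theorem exists_surface_parameters {d : ℕ} (hd : 0 < d) {θ : ℝ} (hθ0 : 0 < θ)
    (hθ : 1 < θ * Real.sqrt d) :
    ∃ D r : ℕ, 0 < D ∧ 0 < r ∧
      (r : ℝ) * (r + 1) * (r + 2) / 6 ≤ r * (d * (D * (D + 1) / 2)) ∧
      (d : ℝ) * (((D : ℝ) - 1) * D * (D + 1) / 3) + D * (D + 1) / 2 * (d * (d - 1) / 2) + 1 ≤
        θ * (r * (d * (D * (D + 1) / 2)) - (r : ℝ) * (r + 1) * (r + 2) / 6) := by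
  set l := Real.sqrt d with hl
  have hll : l * l = d := Real.mul_self_sqrt (Nat.cast_nonneg d)
  have hd1 : (1 : ℝ) ≤ d := by exact_mod_cast hd
  have hl1 : 1 ≤ l := Real.one_le_sqrt.2 hd1
  have hld : l ≤ d := hll ▸ le_mul_of_one_le_left (by linarith) hl1
  set δ := (θ * l - 1) * d with hδ
  have hδ0 : 0 < δ := mul_pos (by linarith) (by linarith)
  obtain ⟨D, hD⟩ := exists_nat_gt (max 6 (3 * (θ * (d + l) + d ^ 2 / 2 + 1) / δ))
  have hD6 : (6 : ℝ) < D := (le_max_left _ _).trans_lt hD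
  have hDδ : 3 * (θ * (d + l) + d ^ 2 / 2 + 1) ≤ D * δ := by
    have := (le_max_right _ _).trans_lt hD
    rw [div_lt_iff₀ hδ0] at this
    exact this.le
  set r := ⌈l * D⌉₊ with hr
  have hr1 : l * D ≤ r := Nat.le_ceil _
  have hr2 : (r : ℝ) < l * D + 1 := Nat.ceil_lt_add_one (by positivity)
  have hr0 : (0 : ℝ) < r := lt_of_lt_of_le (by positivity) hr1
  have hb : (d : ℝ) * D ^ 2 / 3 - l * D - 1 ≤ d * (D * (D + 1) / 2) - (r + 1) * (r + 2) / 6 := by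
    have h1 : ((r : ℝ) + 1) * (r + 2) ≤ (l * D + 2) * (l * D + 3) := by
      exact mul_le_mul (by linarith) (by linarith) (by positivity) (by positivity)
    have h2 : (l * D + 2) * (l * D + 3) = d * D ^ 2 + 5 * (l * D) + 6 := by rw [← hll]; ring
    have h3 : 0 ≤ l * D := by positivity
    have h4 : l * D ≤ d * D := by gcongr
    linarith
  have hb0 : 0 ≤ (d : ℝ) * D ^ 2 / 3 - l * D - 1 := by
    have h4 : l * D ≤ d * D := by gcongr
    have h5 : (1 : ℝ) ≤ d * D := one_le_mul_of_one_le_of_one_le hd1 (by linarith)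
    have h6 : (d * D : ℝ) * 6 ≤ d * D * D := by gcongr
    linarith
  refine ⟨D, r, by exact_mod_cast (by linarith : (0 : ℝ) < D), by exact_mod_cast hr0, ?_, ?_⟩
  · have := mul_nonneg hr0.le (hb0.trans hb)
    linarith
  · have h1 : l * D * ((d : ℝ) * D ^ 2 / 3 - l * D - 1) ≤
        r * (d * (D * (D + 1) / 2) - (r + 1) * (r + 2) / 6) := by gcongr
    have h2 : l * D * ((d : ℝ) * D ^ 2 / 3 - l * D - 1) = l * d * D ^ 3 / 3 - d * D ^ 2 - l * D := by
      rw [← hll]; ring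
    have h3 := mul_le_mul_of_nonneg_left h1 hθ0.le
    rw [h2] at h3
    have h4 : (D : ℝ) ^ 2 * (3 * (θ * (d + l) + d ^ 2 / 2 + 1)) ≤ D ^ 2 * (D * δ) := by gcongr
    have h5 : (D : ℝ) ≤ D ^ 2 := le_self_pow₀ (by linarith) two_ne_zero
    have h6 : θ * (l * D) ≤ θ * (l * D ^ 2) := by gcongr
    have h7 : (1 : ℝ) ≤ D ^ 2 := one_le_pow₀ (by linarith)
    have h8 : (D : ℝ) * (D + 1) / 2 * (d * (d - 1) / 2) ≤ D ^ 2 * (d ^ 2 / 2) := by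
      have : (D : ℝ) * (D + 1) / 2 ≤ D ^ 2 := by linarith
      have h9 : (d : ℝ) * (d - 1) / 2 ≤ d ^ 2 / 2 := by linarith
      have : 0 ≤ (d : ℝ) * (d - 1) / 2 := by
        have : 0 ≤ (d : ℝ) - 1 := by linarith
        positivity
      gcongr
    have h9 : 0 ≤ (d : ℝ) * D / 3 := by positivity
    rw [hδ] at h4
    linarith

/-- Evaluation of a polynomial in three variables. -/
noncomputable def ev₃ (u y z : ℤ) : ℤ[X][X][X] →+* ℤ :=
  eval₂RingHom ((evalRingHom y).comp (mapRingHom (evalRingHom u))) z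

theorem ev₃_C (u y z : ℤ) (h : ℤ[X][X]) : ev₃ u y z (C h) = (spec u h).eval y := by
  simp [ev₃, spec]

/-- The polynomial in three variables with given coefficients. -/
noncomputable def polyOf₃ (D d : ℕ) (g : ((_ : ℕ) × ℕ) × ℕ → ℤ) : ℤ[X][X][X] :=
  ∑ m ∈ tri D ×ˢ Finset.range d, monomial m.1.1 (monomial m.2 (monomial m.1.2 (g m)))

theorem coeff_polyOf₃ {D d : ℕ} (g : ((_ : ℕ) × ℕ) × ℕ → ℤ) {m : ((_ : ℕ) × ℕ) × ℕ}
    (hm : m ∈ tri D ×ˢ Finset.range d) :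
    (((polyOf₃ D d g).coeff m.1.1).coeff m.2).coeff m.1.2 = g m := by
  simp only [polyOf₃, finsetSum_coeff]
  rw [Finset.sum_eq_single m _ (fun h => absurd hm h)]
  · simp
  · rintro ⟨⟨b, a⟩, l⟩ _ hne
    obtain ⟨⟨b', a'⟩, l'⟩ := m
    simp only [coeff_monomial]
    split_ifs with h1
    · rw [coeff_monomial]
      split_ifs with h2
      · rw [coeff_monomial]
        split_ifs with h3
        · subst h1 h2 h3; exact absurd rfl hne
        · rfl
      · simp
    · simp

theorem natDegree_polyOf₃_le (D d : ℕ) (g : ((_ : ℕ) × ℕ) × ℕ → ℤ) :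
    (polyOf₃ D d g).natDegree ≤ D := by
  apply natDegree_sum_le_of_forall_le
  intro m hm
  have := add_lt_of_mem_tri (Finset.mem_product.1 hm).1
  exact (natDegree_monomial_le _).trans (by omega)

theorem natDegree_coeff_polyOf₃_lt (D : ℕ) {d : ℕ} (hd : 0 < d) (g : ((_ : ℕ) × ℕ) × ℕ → ℤ)
    (j : ℕ) : ((polyOf₃ D d g).coeff j).natDegree < d := by
  have : ((polyOf₃ D d g).coeff j).natDegree ≤ d - 1 := by
    rw [polyOf₃, finsetSum_coeff]
    apply natDegree_sum_le_of_forall_le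
    intro m hm
    have := Finset.mem_range.1 (Finset.mem_product.1 hm).2
    rw [coeff_monomial]
    split_ifs
    · exact (natDegree_monomial_le _).trans (by omega)
    · simp
  omega

theorem natDegree_coeff_coeff_polyOf₃_le (D d : ℕ) (g : ((_ : ℕ) × ℕ) × ℕ → ℤ) (j l : ℕ) :
    (((polyOf₃ D d g).coeff j).coeff l).natDegree ≤ D := by
  rw [polyOf₃, finsetSum_coeff, finsetSum_coeff]
  apply natDegree_sum_le_of_forall_le
  intro m hm
  have := add_lt_of_mem_tri (Finset.mem_product.1 hm).1
  rw [coeff_monomial]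
  split_ifs
  · rw [coeff_monomial]
    split_ifs
    · exact (natDegree_monomial_le _).trans (by omega)
    · simp
  · simp

theorem ht₃_polyOf₃_le (D d B : ℕ) (g : ((_ : ℕ) × ℕ) × ℕ → ℤ)
    (hg : ∀ m ∈ tri D ×ˢ Finset.range d, (g m).natAbs ≤ B) :
    ht₃ (polyOf₃ D d g) ≤ (tri D ×ˢ Finset.range d).card * B := by
  rw [polyOf₃]
  refine (isHeight_ht₃.sum _ _).trans (Finset.sum_le_card_nsmul _ _ _ fun m hm => ?_)
  rw [ht₃, polyHeight_monomial isHeight_ht₂, ht₂, polyHeight_monomial isHeight_ht₁, ht₁,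
    polyHeight_monomial isHeight_natAbs]
  exact hg m hm

theorem ev₃_polyOf₃ (D d : ℕ) (g : ((_ : ℕ) × ℕ) × ℕ → ℤ) (u y z : ℤ) :
    ev₃ u y z (polyOf₃ D d g) =
      ∑ m ∈ tri D ×ˢ Finset.range d, g m * (u ^ m.1.2 * z ^ m.1.1 * y ^ m.2) := by
  rw [polyOf₃, map_sum]
  refine Finset.sum_congr rfl fun m _ => ?_
  simp only [ev₃, coe_eval₂RingHom, eval₂_monomial, RingHom.comp_apply, coe_mapRingHom,
    map_monomial, coe_evalRingHom, eval_monomial]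
  ring

/-- The conditions defining a congruence class of points `(u, y, z)` on the surface
`(z + u) ^ d - z ^ d + y ^ d = c`. -/
structure SurfaceClass (d N q : ℕ) (c : ℤ) (S : Set (ℤ × ℤ × ℤ)) : Prop where
  bound : ∀ P ∈ S, P.1.natAbs ≤ N ∧ P.2.1.natAbs ≤ N ∧ P.2.2.natAbs ≤ N
  congr : ∀ P ∈ S, ∀ Q ∈ S,
    (q : ℤ) ∣ P.1 - Q.1 ∧ (q : ℤ) ∣ P.2.1 - Q.2.1 ∧ (q : ℤ) ∣ P.2.2 - Q.2.2
  eqn : ∀ P ∈ S, (P.2.2 + P.1) ^ d - P.2.2 ^ d + P.2.1 ^ d = c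
  coprime : ∀ P ∈ S, IsCoprime ((d : ℤ) * P.2.1 ^ (d - 1)) (q : ℤ)

theorem exists_surface_poly {d : ℕ} (hd : 0 < d) {θ : ℝ} (hθ0 : 0 < θ)
    (hθ : 1 < θ * Real.sqrt d) :
    ∃ D r N₀ : ℕ, 0 < D ∧ ∀ N q : ℕ, N₀ ≤ N → (N : ℝ) ^ θ ≤ q → ∀ (c : ℤ) (S : Set (ℤ × ℤ × ℤ)),
      SurfaceClass d N q c S → ∃ g : ((_ : ℕ) × ℕ) × ℕ → ℤ,
        (∀ m ∈ tri D ×ˢ Finset.range d, (g m).natAbs ≤ q ^ r) ∧ polyOf₃ D d g ≠ 0 ∧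
        ∀ P ∈ S, ev₃ P.1 P.2.1 P.2.2 (polyOf₃ D d g) = 0 := by
  classical
  obtain ⟨D, r, hD, hr, hE, hbig⟩ := exists_surface_parameters hd hθ0 hθ
  set I := tri D ×ˢ Finset.range d with hI
  have hIcard : (I.card : ℝ) = d * (D * (D + 1) / 2) := by
    rw [hI, Finset.card_product, Nat.cast_mul, card_tri, Finset.card_range]; ring
  refine ⟨D, r, I.card ^ I.card + 1, hD, ?_⟩
  intro N q hN hq c S hS
  have hN1 : 0 < N := by omega
  have hq0 : 0 < q := by
    have : (0 : ℝ) < q := (Real.rpow_pos_of_pos (by exact_mod_cast hN1) θ).trans_le hq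
    exact_mod_cast this
  rcases S.eq_empty_or_nonempty with rfl | ⟨P₀, hP₀⟩
  · have hm : ((⟨0, 0⟩, 0) : ((_ : ℕ) × ℕ) × ℕ) ∈ I := by
      simp [hI, tri, hD, hd]
    refine ⟨fun _ => 1, fun _ _ => ?_, fun h0 => ?_, by simp⟩
    · exact Nat.one_le_pow _ _ hq0
    · have := coeff_polyOf₃ (fun _ => 1) hm
      rw [h0] at this
      simp at this
  obtain ⟨l, hl⟩ := exists_inverse_of_congr S (fun P => (d : ℤ) * P.2.1 ^ (d - 1)) q
    (fun P hP Q hQ => by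
      rw [← mul_sub]
      exact ((hS.congr P hP Q hQ).2.1.trans (sub_dvd_pow_sub_pow _ _ _)).mul_left _) hS.coprime
  let ev : ℤ × ℤ × ℤ → ℤ[X][X] →+* ℤ := fun P => evalEvalRingHom (P.1 - P₀.1) (P.2.2 - P₀.2.2)
  let U : ℤ[X][X] := C (X + C P₀.1)
  let Z : ℤ[X][X] := X + C (C P₀.2.2)
  have hU : ∀ P, ev P U = P.1 := fun P => by simp [ev, U]
  have hZ : ∀ P, ev P Z = P.2.2 := fun P => by simp [ev, Z]
  let Φ : ℤ[X][X][X] := X ^ d + C ((Z + U) ^ d - Z ^ d - (c : ℤ[X][X]))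
  have hmap : ∀ P, Φ.map (ev P) = X ^ d + C ((P.2.2 + P.1) ^ d - P.2.2 ^ d - c) := fun P => by
    have h1 : ev P ((Z + U) ^ d - Z ^ d - (c : ℤ[X][X])) = (P.2.2 + P.1) ^ d - P.2.2 ^ d - c := by
      rw [map_sub, map_sub, map_pow, map_pow, map_add, hU, hZ, map_intCast, Int.cast_id]
    rw [Polynomial.map_add, Polynomial.map_pow, map_X, Polynomial.map_C, h1]
  obtain ⟨φ, hφ⟩ := exists_hensel_lift S ev Φ q (fun P => P.2.1) P₀.2.1 l
    (fun P hP => by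
      rw [hmap]
      simp only [eval_add, eval_pow, eval_X, eval_C]
      linarith [hS.eqn P hP])
    (fun P hP => (hS.congr P₀ hP₀ P hP).2.1)
    (fun P hP => by
      rw [hmap, derivative_add, derivative_C, derivative_X_pow, add_zero]
      simpa using hl P hP) (r - 1)
  rw [Nat.sub_add_cancel hr] at hφ
  let p : ((_ : ℕ) × ℕ) × ℕ → ℤ[X][X] := fun m => U ^ m.1.2 * Z ^ m.1.1 * φ ^ m.2
  obtain ⟨g, ⟨m₀, hm₀, hgm₀⟩, hgB, hg⟩ := exists_common_relation S I (tri r)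
    (fun m P => P.1 ^ m.1.2 * P.2.2 ^ m.1.1 * P.2.1 ^ m.2)
    (fun m => m.1.1 + m.1.2 + m.2) N q r hq0 hN1
    (fun m _ P hP => by
      have := hS.bound P hP
      rw [Int.natAbs_mul, Int.natAbs_mul, Int.natAbs_pow, Int.natAbs_pow, Int.natAbs_pow, pow_add,
        add_comm, pow_add]
      exact Nat.mul_le_mul (Nat.mul_le_mul (Nat.pow_le_pow_left this.1 _)
        (Nat.pow_le_pow_left this.2.2 _)) (Nat.pow_le_pow_left this.2.1 _))
    (fun k => k.1 + k.2) (fun k hk => (add_lt_of_mem_tri hk).le)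
    (fun m k => ((p m).coeff k.1).coeff k.2)
    (fun k P => (P.1 - P₀.1) ^ k.2 * (P.2.2 - P₀.2.2) ^ k.1)
    (fun P hP k _ => by
      have := hS.congr P hP P₀ hP₀
      rw [add_comm, pow_add]
      exact mul_dvd_mul (pow_dvd_pow_of_dvd this.1 _) (pow_dvd_pow_of_dvd this.2.2 _))
    (fun m _ P hP => by
      have := hS.congr P hP P₀ hP₀
      have h1 := pow_dvd_evalEval_sub_sum this.1 this.2.2 (p m) r
      have h2 : (q : ℤ) ^ r ∣ P.1 ^ m.1.2 * P.2.2 ^ m.1.1 * P.2.1 ^ m.2 -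
          (p m).evalEval (P.1 - P₀.1) (P.2.2 - P₀.2.2) := by
        have h3 : (p m).evalEval (P.1 - P₀.1) (P.2.2 - P₀.2.2) =
            P.1 ^ m.1.2 * P.2.2 ^ m.1.1 * (ev P φ) ^ m.2 := by
          change ev P (p m) = _
          simp only [p, map_mul, map_pow, hU, hZ]
        rw [h3, ← mul_sub]
        exact ((dvd_sub_comm.1 (hφ P hP)).trans (sub_dvd_pow_sub_pow _ _ _)).mul_left _
      have := dvd_add h2 h1
      rwa [sub_add_sub_cancel] at this)
    (by
      have h1 := sum_tri_sub r
      have h3 : ((∑ m ∈ I, (m.1.1 + m.1.2 + m.2) : ℕ) : ℝ) =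
          (d : ℝ) * (((D : ℝ) - 1) * D * (D + 1) / 3) + D * (D + 1) / 2 * (d * (d - 1) / 2) := by
        have h4 : ∀ n : ℕ, ∑ k ∈ Finset.range n, (k : ℝ) = n * (n - 1) / 2 := by
          intro n
          induction n with
          | zero => simp
          | succ n ih => rw [Finset.sum_range_succ, ih]; push_cast; ring
        rw [Nat.cast_sum, hI, Finset.sum_product]
        have h5 : ∀ x ∈ tri D, ∑ y ∈ Finset.range d, ((x.1 + x.2 + y : ℕ) : ℝ) =
            d * ((x.1 : ℝ) + x.2) + d * (d - 1) / 2 := fun x _ => by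
          push_cast
          rw [Finset.sum_add_distrib, Finset.sum_const, Finset.card_range, nsmul_eq_mul, h4]
        rw [Finset.sum_congr rfl h5, Finset.sum_add_distrib, ← Finset.mul_sum, sum_tri,
          Finset.sum_const, nsmul_eq_mul, card_tri]
      refine pow_mul_lt_of_rpow_le (by omega) hq ?_ ?_
      · have : ((∑ k ∈ tri r, (r - (k.1 + k.2)) : ℕ) : ℝ) ≤ ((r * I.card : ℕ) : ℝ) := by
          rw [h1, Nat.cast_mul, hIcard]; exact hE
        exact_mod_cast this
      · rw [h1, h3, hIcard]; exact hbig)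
  refine ⟨g, hgB, fun h0 => hgm₀ ?_, fun P hP => ?_⟩
  · have := coeff_polyOf₃ g hm₀
    rw [h0] at this
    simpa using this.symm
  · rw [ev₃_polyOf₃]
    exact hg P hP

theorem exists_coeff_zero_pow_eq {R : Type*} [CommRing R] [IsDomain R] {d : ℕ} {T : R} {p : R[X]}
    (hp : p.Monic) (hdvd : p ∣ X ^ d - C T) :
    ∃ e : ℕ, p.coeff 0 ^ d = (-1) ^ e * T ^ p.natDegree := by
  let K := AlgebraicClosure (FractionRing R)
  let i : R →+* K := (algebraMap (FractionRing R) K).comp (algebraMap R (FractionRing R))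
  have hi : Function.Injective i :=
    (algebraMap (FractionRing R) K).injective.comp (IsFractionRing.injective R (FractionRing R))
  have hs : (p.map i).Splits := IsAlgClosed.splits _
  have hm : (p.map i).Monic := hp.map i
  have h1 := hs.coeff_zero_eq_prod_roots_of_monic hm
  have h2 : (p.map i).roots.map (fun x => x ^ d) =
      Multiset.replicate (p.map i).roots.card (i T) := by
    rw [Multiset.eq_replicate]
    refine ⟨Multiset.card_map _ _, fun b hb => ?_⟩
    obtain ⟨x, hx, rfl⟩ := Multiset.mem_map.1 hb
    have hx' : (p.map i).eval x = 0 := (mem_roots hm.ne_zero).1 hx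
    have h3 : (p.map i) ∣ X ^ d - C (i T) := by
      have := Polynomial.map_dvd i hdvd
      simpa using this
    obtain ⟨g, hg⟩ := h3
    have h4 := congrArg (eval x) hg
    rw [eval_mul, hx', zero_mul] at h4
    simp only [eval_sub, eval_pow, eval_X, eval_C] at h4
    exact sub_eq_zero.1 h4
  refine ⟨p.natDegree * d, hi ?_⟩
  have h5 : (p.map i).roots.prod ^ d = i T ^ p.natDegree := by
    have h6 := congrArg Multiset.prod h2
    rw [Multiset.prod_map_pow, Multiset.map_id', Multiset.prod_replicate] at h6
    rw [h6, ← hs.natDegree_eq_card_roots, natDegree_map_eq_of_injective hi]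
  rw [coeff_map, natDegree_map_eq_of_injective hi] at h1
  rw [map_pow, h1, mul_pow, h5, map_mul, map_pow, map_pow, map_neg, map_one, ← pow_mul]

theorem irreducible_X_pow_sub_C_of_forall {R : Type*} [CommRing R] [IsDomain R] {d : ℕ}
    (hd : 0 < d) {T : R}
    (h : ∀ (n e : ℕ) (a : R), 0 < n → n < d → a ^ d ≠ (-1) ^ e * T ^ n) :
    Irreducible (X ^ d - C T : R[X]) := by
  have hmon : (X ^ d - C T : R[X]).Monic := monic_X_pow_sub_C T hd.ne'
  have hdeg : (X ^ d - C T : R[X]).natDegree = d := natDegree_X_pow_sub_C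
  rw [hmon.irreducible_iff_natDegree]
  refine ⟨fun h1 => ?_, fun f g hf hg hfg => ?_⟩
  · rw [h1, natDegree_one] at hdeg; omega
  · by_contra hcon
    push Not at hcon
    obtain ⟨e, he⟩ := exists_coeff_zero_pow_eq hf (hfg ▸ dvd_mul_right f g)
    have h2 := hf.natDegree_mul hg
    rw [hfg, hdeg] at h2
    exact h f.natDegree e (f.coeff 0) (by omega) (by omega) he

theorem pow_add_le_pow {x y t : ℕ} (hxy : y < x) (ht : 2 ≤ t) : y ^ t + x ≤ x ^ t := by
  obtain ⟨s, rfl⟩ : ∃ s, t = s + 1 := ⟨t - 1, by omega⟩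
  have h1 : y ^ s ≤ x ^ s := Nat.pow_le_pow_left hxy.le s
  have h2 : x ≤ x ^ s := Nat.le_self_pow (by omega) x
  calc y ^ (s + 1) + x = y ^ s * y + x := by rw [pow_succ]
    _ ≤ x ^ s * y + x ^ s := by gcongr
    _ = x ^ s * (y + 1) := by ring
    _ ≤ x ^ s * x := by gcongr; exact hxy
    _ = x ^ (s + 1) := by rw [pow_succ]

theorem exists_eq_pow_of_pow_eq_pow {x c d n : ℕ} (hn : 0 < n) (hnd : n < d) (hc : 0 < c)
    (h : x ^ d = c ^ n) : ∃ g t b : ℕ, d = g * t ∧ 2 ≤ t ∧ 0 < g ∧ b ^ t = c := by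
  have hg : Nat.gcd n d < d := (Nat.gcd_le_left d hn).trans_lt hnd
  have hg0 : 0 < Nat.gcd n d := Nat.gcd_pos_of_pos_left _ hn
  obtain ⟨m, -, hm⟩ := Nat.exists_mul_mod_eq_gcd hg
  obtain ⟨t, ht⟩ := Nat.gcd_dvd_right n d
  set g := Nat.gcd n d with hgdef
  have h1 := Nat.div_add_mod (n * m) d
  rw [hm] at h1
  set k := n * m / d
  have h2 : (x ^ m) ^ d = (c ^ k) ^ d * c ^ g := by
    rw [← pow_mul, mul_comm m d, pow_mul, h, ← pow_mul, ← h1, pow_add, ← pow_mul, mul_comm k d]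
  have hd0 : d ≠ 0 := by omega
  obtain ⟨b, hb⟩ := (Nat.pow_dvd_pow_iff hd0).1 (Dvd.intro _ h2.symm)
  rw [hb, mul_pow] at h2
  have h3 : b ^ d = c ^ g := Nat.eq_of_mul_eq_mul_left (by positivity) h2
  refine ⟨g, t, b, ht, ?_, hg0, ?_⟩
  · by_contra hcon
    have : t ≤ 1 := by omega
    have : g * t ≤ g * 1 := Nat.mul_le_mul_left g this
    omega
  · rw [ht, mul_comm g t, pow_mul] at h3
    exact Nat.pow_left_injective hg0.ne' h3

theorem irreducible_X_pow_sub_C_add_pow {d : ℕ} (hd : 0 < d) {k : ℤ} (hk : k ≠ 0) {w : ℕ}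
    (hw : k.natAbs < w) : Irreducible (X ^ d - C (k + (w : ℤ) ^ d) : ℤ[X]) := by
  have hle : (w : ℤ) ≤ (w : ℤ) ^ d := by
    exact_mod_cast Nat.le_self_pow hd.ne' w
  have hpos : 0 < k + (w : ℤ) ^ d := by omega
  obtain ⟨c, hc⟩ := Int.eq_ofNat_of_zero_le hpos.le
  have hc0 : 0 < c := by omega
  apply irreducible_X_pow_sub_C_of_forall hd
  intro n e a hn hnd ha
  rw [hc] at ha
  have h1 : a.natAbs ^ d = c ^ n := by
    have := congrArg Int.natAbs ha
    simpa [Int.natAbs_mul, Int.natAbs_pow] using this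
  obtain ⟨g, t, b, hdgt, ht, hg, hb⟩ := exists_eq_pow_of_pow_eq_pow hn hnd hc0 h1
  have h2 : (b : ℤ) ^ t = k + ((w ^ g : ℕ) : ℤ) ^ t := by
    rw [Nat.cast_pow, ← pow_mul, ← hdgt, hc, ← hb]; push_cast; rfl
  have hm : w ≤ w ^ g := Nat.le_self_pow hg.ne' w
  rcases lt_trichotomy b (w ^ g) with h3 | h3 | h3
  · have h4 := pow_add_le_pow h3 ht
    have h5 : (b : ℤ) ^ t + ((w ^ g : ℕ) : ℤ) ≤ ((w ^ g : ℕ) : ℤ) ^ t := by exact_mod_cast h4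
    omega
  · rw [h3] at h2
    omega
  · have h4 := pow_add_le_pow h3 ht
    have h5 : ((w ^ g : ℕ) : ℤ) ^ t + (b : ℤ) ≤ (b : ℤ) ^ t := by exact_mod_cast h4
    omega

/-- The curve `(z + a) ^ d - z ^ d + y ^ d = c`, with inner variable `z` and outer variable `y`. -/
noncomputable def verticalCurve (d : ℕ) (c a : ℤ) : ℤ[X][X] :=
  X ^ d - C (C c - ((X + C a) ^ d - X ^ d))

theorem natDegree_C_sub_X_add_C_pow_sub {d : ℕ} (hd : 2 ≤ d) {a : ℤ} (ha : a ≠ 0) (c : ℤ) :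
    (C c - ((X + C a) ^ d - X ^ d) : ℤ[X]).natDegree = d - 1 := by
  apply natDegree_eq_of_le_of_coeff_ne_zero
  · rw [natDegree_le_iff_coeff_eq_zero]
    intro k hk
    rw [coeff_sub, coeff_sub, coeff_C, if_neg (by omega), coeff_X_add_C_pow, coeff_X_pow]
    rcases eq_or_ne k d with h | h
    · simp [h]
    · rw [if_neg h, Nat.choose_eq_zero_of_lt (by omega)]; simp
  · rw [coeff_sub, coeff_sub, coeff_C, if_neg (by omega), coeff_X_add_C_pow, coeff_X_pow,
      if_neg (by omega), Nat.choose_symm_of_eq_add (show d = (d - 1) + 1 by omega),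
      Nat.choose_one_right, show d - (d - 1) = 1 by omega]
    simp only [pow_one, sub_zero, zero_sub, ne_eq, neg_eq_zero, mul_eq_zero, not_or]
    exact ⟨ha, by exact_mod_cast (by omega : d ≠ 0)⟩

theorem irreducible_verticalCurve {d : ℕ} (hd : 2 ≤ d) (c : ℤ) {a : ℤ} (ha : a ≠ 0) :
    Irreducible (verticalCurve d c a) := by
  apply irreducible_X_pow_sub_C_of_forall (by omega)
  intro n e p hn hnd h
  have h1 := congrArg natDegree h
  rw [natDegree_pow] at h1
  have h2 : ((-1) ^ e * (C c - ((X + C a) ^ d - X ^ d)) ^ n : ℤ[X]).natDegree =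
      n * (d - 1) := by
    rw [← natDegree_C_sub_X_add_C_pow_sub hd ha c, ← natDegree_pow]
    rcases neg_one_pow_eq_or ℤ[X] e with he | he <;> rw [he]
    · rw [one_mul]
    · rw [neg_one_mul, natDegree_neg]
  rw [h2] at h1
  have h3 : d ∣ n * (d - 1) := ⟨_, h1.symm⟩
  have h4 : Nat.Coprime d (d - 1) := by
    have := Nat.coprime_self_add_right (m := d - 1) (n := 1)
    rw [show d - 1 + 1 = d by omega] at this
    exact (this.2 (Nat.coprime_one_right _)).symm
  have h5 := Nat.le_of_dvd hn (h4.dvd_of_dvd_mul_right h3)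
  omega

theorem natDegree_verticalCurve {d : ℕ} (c a : ℤ) : (verticalCurve d c a).natDegree = d :=
  natDegree_X_pow_sub_C

theorem bidegLE_verticalCurve {d : ℕ} (hd : 2 ≤ d) (c : ℤ) {a : ℤ} (ha : a ≠ 0) :
    BidegLE d (verticalCurve d c a) := by
  refine ⟨(natDegree_verticalCurve c a).le, fun i => ?_⟩
  have h1 : (C c - ((X + C a) ^ d - X ^ d) : ℤ[X]).natDegree ≤ d := by
    rw [natDegree_C_sub_X_add_C_pow_sub hd ha c]; omega
  rw [verticalCurve, coeff_sub, coeff_X_pow, coeff_C]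
  refine (natDegree_sub_le _ _).trans (max_le ?_ ?_)
  · split_ifs <;> simp
  · split_ifs
    · exact h1
    · simp

theorem spec_verticalCurve (d : ℕ) (c a z : ℤ) :
    spec z (verticalCurve d c a) = X ^ d - C (c - ((z + a) ^ d - z ^ d)) := by
  simp [spec, verticalCurve]

/-- The equation `(z + u) ^ d - z ^ d + y ^ d = c`, with variables `u`, `y`, `z` from the innermost
to the outermost. -/
noncomputable def surface (d : ℕ) (c : ℤ) : ℤ[X][X][X] :=
  (X + C (C X)) ^ d - X ^ d + C (X ^ d - C (C c))

theorem ev₃_surface (d : ℕ) (c u y z : ℤ) :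
    ev₃ u y z (surface d c) = (z + u) ^ d - z ^ d + y ^ d - c := by
  simp only [surface, ev₃, coe_eval₂RingHom, eval₂_add, eval₂_sub, eval₂_pow, eval₂_X, eval₂_C]
  simp
  ring

/-- The exchange of the two outer variables. -/
noncomputable def outerSwap : ℤ[X][X][X] ≃+* ℤ[X][X][X] :=
  (Bivariate.swap (R := ℤ[X])).toRingEquiv

theorem outerSwap_monomial_monomial (n m : ℕ) (r : ℤ[X]) :
    outerSwap (monomial n (monomial m r)) = monomial m (monomial n r) :=
  Bivariate.swap_monomial_monomial n m r

theorem outerSwap_surface (d : ℕ) (c : ℤ) :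
    outerSwap (surface d c) = X ^ d - C (C (C c) - ((X + C X) ^ d - X ^ d)) := by
  have h1 : outerSwap X = C X := Bivariate.swap_Y
  have h2 : ∀ f : ℤ[X], outerSwap (C (C f)) = C (C f) := Bivariate.swap_C_C
  have h3 : outerSwap (C X) = X := Bivariate.swap_X
  have h4 : outerSwap ((X + C (C X)) ^ d - X ^ d) = (C X + C (C X)) ^ d - (C X) ^ d := by
    rw [map_sub outerSwap, map_pow outerSwap, map_pow outerSwap, map_add outerSwap, h1, h2]
  have h5 : outerSwap (C (X ^ d - C (C c))) = X ^ d - C (C (C c)) := by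
    have : (C (X ^ d - C (C c)) : ℤ[X][X][X]) = (C X) ^ d - C (C (C c)) := by
      rw [C_sub, C_pow]
    rw [this, map_sub outerSwap, map_pow outerSwap, h3, h2]
  rw [surface, map_add outerSwap, h4, h5]
  simp only [C_sub, C_pow, C_add]
  ring

theorem irreducible_surface {d : ℕ} (hd : 0 < d) {c : ℤ}
    (hc : Irreducible (X ^ d - C c : ℤ[X])) : Irreducible (surface d c) := by
  rw [← MulEquiv.irreducible_iff outerSwap, outerSwap_surface]
  refine Monic.irreducible_of_irreducible_map ((evalRingHom 0).comp (mapRingHom (evalRingHom 0)))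
    _ (monic_X_pow_sub_C _ hd.ne') ?_
  convert hc using 1
  simp [hd.ne']

theorem natDegree_outerSwap_polyOf₃_le (D d : ℕ) (g : ((_ : ℕ) × ℕ) × ℕ → ℤ) :
    (outerSwap (polyOf₃ D d g)).natDegree ≤ d - 1 := by
  have h4 : outerSwap (polyOf₃ D d g) = ∑ m ∈ tri D ×ˢ Finset.range d,
      monomial m.2 (monomial m.1.1 (monomial m.1.2 (g m))) := by
    rw [polyOf₃, map_sum outerSwap]
    exact Finset.sum_congr rfl fun m _ => outerSwap_monomial_monomial _ _ _
  rw [h4]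
  apply natDegree_sum_le_of_forall_le
  intro m hm
  have := Finset.mem_range.1 (Finset.mem_product.1 hm).2
  exact (natDegree_monomial_le _).trans (Nat.le_sub_one_of_lt this)

theorem not_surface_dvd_polyOf₃ {d D : ℕ} (hd : 0 < d) (c : ℤ) {g : ((_ : ℕ) × ℕ) × ℕ → ℤ}
    (hg : polyOf₃ D d g ≠ 0) : ¬ surface d c ∣ polyOf₃ D d g := by
  intro h
  have h1 : outerSwap (surface d c) ∣ outerSwap (polyOf₃ D d g) := by
    obtain ⟨e, he⟩ := h
    exact ⟨outerSwap e, by rw [he, map_mul outerSwap]⟩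
  have h2 : outerSwap (polyOf₃ D d g) ≠ 0 := by
    intro h
    exact hg (outerSwap.injective (h.trans (map_zero outerSwap).symm))
  have h3 := (natDegree_le_of_dvd h1 h2).trans (natDegree_outerSwap_polyOf₃_le D d g)
  rw [outerSwap_surface, natDegree_X_pow_sub_C] at h3
  exact absurd h3 (Nat.not_le.2 (Nat.sub_lt hd one_pos))

theorem natDegree_coeff_mul_le {R : Type*} [CommRing R] {f g : R[X][X]} {k l : ℕ}
    (hf : ∀ i, (f.coeff i).natDegree ≤ k) (hg : ∀ i, (g.coeff i).natDegree ≤ l) (i : ℕ) :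
    ((f * g).coeff i).natDegree ≤ k + l := by
  rw [coeff_mul]
  exact natDegree_sum_le_of_forall_le _ _ fun m _ =>
    natDegree_mul_le.trans (add_le_add (hf _) (hg _))

theorem natDegree_coeff_prod_le {R ι : Type*} [CommRing R] (s : Finset ι) (f : ι → R[X][X])
    {k : ℕ} (hf : ∀ j ∈ s, ∀ i, ((f j).coeff i).natDegree ≤ k) :
    ∀ i, ((∏ j ∈ s, f j).coeff i).natDegree ≤ s.card * k := by
  classical
  induction s using Finset.induction_on with
  | empty =>
    intro i
    rw [Finset.prod_empty, coeff_one]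
    split_ifs <;> simp
  | insert a s ha ih =>
    intro i
    rw [Finset.prod_insert ha, Finset.card_insert_of_notMem ha, add_mul, one_mul, add_comm]
    exact natDegree_coeff_mul_le (hf a (Finset.mem_insert_self _ _))
      (ih fun j hj => hf j (Finset.mem_insert_of_mem hj)) i

theorem natDegree_coeff_det_le {R ι : Type*} [CommRing R] [Fintype ι] [DecidableEq ι]
    (M : Matrix ι ι R[X][X]) (n : ℕ) (h : ∀ i j l, ((M i j).coeff l).natDegree ≤ n) (l : ℕ) :
    (M.det.coeff l).natDegree ≤ Fintype.card ι * n := by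
  rw [Matrix.det_apply, finsetSum_coeff]
  apply natDegree_sum_le_of_forall_le
  intro σ _
  rw [coeff_smul]
  refine (natDegree_smul_le _ _).trans ?_
  exact natDegree_coeff_prod_le Finset.univ _ (fun j _ i => h _ _ _) l

theorem natDegree_coeff_resultant_le {R : Type*} [CommRing R] (f g : R[X][X][X]) (n a b : ℕ)
    (hf : ∀ i l, ((f.coeff i).coeff l).natDegree ≤ n)
    (hg : ∀ i l, ((g.coeff i).coeff l).natDegree ≤ n) (l : ℕ) :
    ((resultant f g a b).coeff l).natDegree ≤ (a + b) * n := by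
  unfold resultant
  refine (natDegree_coeff_det_le _ n ?_ l).trans (by simp)
  intro i j l
  simp only [sylvester, Matrix.of_apply]
  refine Fin.addCases (fun j => ?_) (fun j => ?_) j
  · simp only [Fin.addCases_left]; split_ifs
    · exact hg _ _
    · simp
  · simp only [Fin.addCases_right]; split_ifs
    · exact hf _ _
    · simp

theorem polyHeight_le_of_natDegree_le {A : Type*} [CommRing A] {ν : A → ℕ} (h : IsHeight ν)
    {p : A[X]} {n B : ℕ} (hn : p.natDegree ≤ n) (hB : ∀ i, ν (p.coeff i) ≤ B) :
    polyHeight ν p ≤ (n + 1) * B := by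
  rw [polyHeight_eq_sum h p (Finset.range (n + 1)) (supp_subset_range (Nat.lt_succ_of_le hn))]
  exact (Finset.sum_le_card_nsmul _ _ _ fun i _ => hB i).trans (by simp)

/-- Powers of the inner variable can be removed. -/
theorem exists_eq_C_X_pow_mul {n : ℕ} {H : ℤ[X][X]} (hH : H ≠ 0) (hn : BidegLE n H) :
    ∃ (m : ℕ) (H' : ℤ[X][X]), H = C X ^ m * H' ∧ spec 0 H' ≠ 0 ∧ BidegLE n H' ∧
      ht₂ H' ≤ (n + 1) * ((n + 1) * ht₂ H) := by
  have hprime : Prime (C X : ℤ[X][X]) := prime_C_iff.2 prime_X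
  obtain ⟨m, H', hH', rfl⟩ : ∃ (m : ℕ) (H' : ℤ[X][X]), ¬ C X ∣ H' ∧ H = C X ^ m * H' :=
    WfDvdMonoid.max_power_factor hH hprime.irreducible |>.imp fun _ ⟨c, h1, h2⟩ => ⟨c, h1, h2⟩
  have hcoeff : ∀ i, (C X ^ m * H').coeff i = X ^ m * H'.coeff i := by
    intro i; rw [← C_pow, coeff_C_mul]
  have hdeg : ∀ i, (H'.coeff i).natDegree ≤ n := by
    intro i
    have h1 := hn.2 i
    rw [hcoeff] at h1
    by_cases h0 : H'.coeff i = 0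
    · simp [h0]
    · rw [natDegree_mul (by simp) h0] at h1
      omega
  have hdeg' : H'.natDegree ≤ n := by
    have h1 := hn.1
    rw [← C_pow, natDegree_C_mul (by simp)] at h1
    exact h1
  refine ⟨m, H', rfl, ?_, ⟨hdeg', hdeg⟩, ?_⟩
  · intro h0
    have := C_X_sub_C_dvd_of_spec_eq_zero h0
    rw [C_0, sub_zero] at this
    exact hH' this
  · refine polyHeight_le_of_natDegree_le isHeight_ht₁ hdeg' fun i => ?_
    refine polyHeight_le_of_natDegree_le isHeight_natAbs (hdeg i) fun l => ?_
    have h1 : (H'.coeff i).coeff l = ((C X ^ m * H').coeff i).coeff (l + m) := by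
      rw [hcoeff, coeff_X_pow_mul]
    rw [h1]
    exact (coeff_le_polyHeight isHeight_natAbs _ _).trans (coeff_le_polyHeight isHeight_ht₁ _ _)

theorem natDegree_surface_ne_zero {d : ℕ} (hd : 2 ≤ d) (c : ℤ) : (surface d c).natDegree ≠ 0 := by
  have h1 : (surface d c).coeff (d - 1) ≠ 0 := by
    rw [surface, coeff_add, coeff_sub, coeff_C, if_neg (by omega), coeff_X_add_C_pow, coeff_X_pow,
      if_neg (by omega), Nat.choose_symm_of_eq_add (show d = (d - 1) + 1 by omega),
      Nat.choose_one_right, show d - (d - 1) = 1 by omega]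
    simp only [pow_one, sub_zero, add_zero, ne_eq, mul_eq_zero, not_or]
    exact ⟨by simp, by exact_mod_cast (by omega : d ≠ 0)⟩
  have := le_natDegree_of_ne_zero h1
  omega

theorem natDegree_surface_le (d : ℕ) (c : ℤ) : (surface d c).natDegree ≤ d := by
  rw [surface]
  refine (natDegree_add_le _ _).trans (max_le ((natDegree_sub_le _ _).trans (max_le ?_ ?_)) ?_)
  · refine natDegree_pow_le.trans ?_
    rw [natDegree_X_add_C, mul_one]
  · simp
  · rw [natDegree_C]; exact Nat.zero_le _

theorem natDegree_coeff_surface_le (d : ℕ) (c : ℤ) (i : ℕ) :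
    ((surface d c).coeff i).natDegree ≤ d := by
  rw [surface, coeff_add, coeff_sub, coeff_C, coeff_X_add_C_pow, coeff_X_pow]
  refine (natDegree_add_le _ _).trans (max_le ((natDegree_sub_le _ _).trans (max_le ?_ ?_)) ?_)
  · rw [← C_pow, ← C_eq_natCast, ← C_mul, natDegree_C]; exact Nat.zero_le _
  · split_ifs <;> simp
  · split_ifs
    · rw [natDegree_X_pow_sub_C]
    · simp

theorem natDegree_coeff_coeff_surface_le (d : ℕ) (c : ℤ) (i l : ℕ) :
    (((surface d c).coeff i).coeff l).natDegree ≤ d := by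
  rw [surface, coeff_add, coeff_sub, coeff_C, coeff_X_add_C_pow, coeff_X_pow, coeff_add, coeff_sub]
  refine (natDegree_add_le _ _).trans (max_le ((natDegree_sub_le _ _).trans (max_le ?_ ?_)) ?_)
  · rw [← C_pow, ← C_eq_natCast, ← C_mul, coeff_C]
    split_ifs
    · rw [← C_eq_natCast]
      refine (natDegree_mul_C_le _ _).trans ?_
      rw [natDegree_X_pow]; omega
    · simp
  · split_ifs
    · rw [coeff_one]; split_ifs <;> simp
    · simp
  · split_ifs
    · rw [coeff_sub, coeff_X_pow, coeff_C]
      refine (natDegree_sub_le _ _).trans (max_le ?_ ?_)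
      · split_ifs <;> simp
      · split_ifs <;> simp
    · simp

theorem ht₃_surface_le (d : ℕ) (c : ℤ) : ht₃ (surface d c) ≤ 2 ^ d + 2 + c.natAbs := by
  have h1 : ht₃ (X + C (C X)) ≤ 2 := by
    refine (isHeight_ht₃.add _ _).trans ?_
    have h2 : ht₃ X ≤ 1 := polyHeight_X_le isHeight_ht₂
    have h3 : ht₃ (C (C X)) ≤ 1 := by
      rw [ht₃, polyHeight_C isHeight_ht₂, ht₂, polyHeight_C isHeight_ht₁]
      exact polyHeight_X_le isHeight_natAbs
    omega
  have h2 : ht₃ ((X + C (C X)) ^ d) ≤ 2 ^ d :=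
    (isHeight_ht₃.pow _ _).trans (Nat.pow_le_pow_left h1 d)
  have h3 : ht₃ (X ^ d) ≤ 1 :=
    (isHeight_ht₃.pow _ _).trans ((Nat.pow_le_pow_left (polyHeight_X_le isHeight_ht₂) d).trans (one_pow d).le)
  have h4 : ht₃ (C (X ^ d - C (C c))) ≤ 1 + c.natAbs := by
    rw [ht₃, polyHeight_C isHeight_ht₂]
    refine (isHeight_ht₂.sub _ _).trans (add_le_add ?_ ?_)
    · exact (isHeight_ht₂.pow _ _).trans
        ((Nat.pow_le_pow_left (polyHeight_X_le isHeight_ht₁) d).trans (one_pow d).le)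
    · rw [ht₂, polyHeight_C isHeight_ht₁, ht₁, polyHeight_C isHeight_natAbs]
  have h5 := isHeight_ht₃.sub ((X + C (C X)) ^ d) (X ^ d)
  have h6 := isHeight_ht₃.add ((X + C (C X)) ^ d - X ^ d) (C (X ^ d - C (C c)))
  rw [surface]
  omega

/-- The projection to the `(u, y)` plane of a congruence class lies on a plane curve. -/
theorem exists_plane_curve {d : ℕ} (hd : 2 ≤ d) {θ : ℝ} (hθ0 : 0 < θ)
    (hθ : 1 < θ * Real.sqrt d) (κ : ℕ) :
    ∃ n A N₀ : ℕ, ∀ N q : ℕ, N₀ ≤ N → (N : ℝ) ^ θ ≤ q → q ≤ N ^ κ → ∀ c : ℤ,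
      c.natAbs ≤ N ^ κ → Irreducible (X ^ d - C c : ℤ[X]) → ∀ S : Set (ℤ × ℤ × ℤ),
      SurfaceClass d N q c S → (∀ P ∈ S, P.1 ≠ 0) →
      ∃ H : ℤ[X][X], BidegLE n H ∧ ht₂ H ≤ N ^ A ∧ spec 0 H ≠ 0 ∧
        ∀ P ∈ S, (spec P.1 H).eval P.2.1 = 0 := by
  obtain ⟨D, r, N₀, hD, hmain⟩ := exists_surface_poly (d := d) (by omega) hθ0 hθ
  let T := (tri D ×ˢ Finset.range d).card
  let n := (d + D) * (d + D)
  refine ⟨n, κ * (r + 1) * (d + D) + 1 , N₀ + 1 +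
    (n + 1) * ((n + 1) * ((d + D).factorial * (2 ^ d + 3 + T) ^ (d + D))), ?_⟩
  intro N q hN hq hqN c hc hirr S hS hS0
  have hN1 : 1 ≤ N := by omega
  obtain ⟨g, hg1, hg2, hg3⟩ := hmain N q (by omega) hq c S hS
  have hd0 : 0 < d := by omega
  set F := surface d c with hF
  set G := polyOf₃ D d g with hG
  set H₀ := resultant F G with hH₀
  have hdF := natDegree_surface_ne_zero hd c
  have hFd : F.natDegree ≤ d := natDegree_surface_le d c
  have hGD : G.natDegree ≤ D := natDegree_polyOf₃_le D d g
  have h0 : H₀ ≠ 0 := resultant_ne_zero_of_not_dvd (irreducible_surface hd0 hirr) hdF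
    (not_surface_dvd_polyOf₃ hd0 c hg2)
  have hb : BidegLE n H₀ := by
    constructor
    · refine (natDegree_resultant_le F G (d + D) _ _ (fun i => ?_) (fun i => ?_)).trans ?_
      · exact (natDegree_coeff_surface_le d c i).trans (by omega)
      · exact (natDegree_coeff_polyOf₃_lt D hd0 g i).le.trans (by omega)
      · exact Nat.mul_le_mul_right _ (by omega)
    · intro l
      refine (natDegree_coeff_resultant_le F G (d + D) _ _ (fun i j => ?_) (fun i j => ?_) l).trans
        ?_
      · exact (natDegree_coeff_coeff_surface_le d c i j).trans (by omega)
      · exact (natDegree_coeff_coeff_polyOf₃_le D d g i j).trans (by omega)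
      · exact Nat.mul_le_mul_right _ (by omega)
  have hNκ : 1 ≤ N ^ (κ * (r + 1)) := Nat.one_le_pow _ _ hN1
  have hB1 : 1 ≤ (2 ^ d + 3 + T) * N ^ (κ * (r + 1)) := Nat.mul_pos (by positivity) hNκ
  have hht : ht₂ H₀ ≤ (d + D).factorial * (2 ^ d + 3 + T) ^ (d + D) *
      N ^ (κ * (r + 1) * (d + D)) := by
    refine (isHeight_ht₂.resultant F G _ _ ((2 ^ d + 3 + T) * N ^ (κ * (r + 1)))
      (fun i => ?_) (fun i => ?_)).trans ?_
    · refine (coeff_le_polyHeight isHeight_ht₂ F i).trans ((ht₃_surface_le d c).trans ?_)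
      have : c.natAbs ≤ N ^ (κ * (r + 1)) :=
        hc.trans (Nat.pow_le_pow_right hN1 (by nlinarith))
      nlinarith [Nat.zero_le T, Nat.one_le_two_pow (n := d)]
    · refine (coeff_le_polyHeight isHeight_ht₂ G i).trans
        ((ht₃_polyOf₃_le D d _ g hg1).trans ?_)
      have : q ^ r ≤ N ^ (κ * (r + 1)) := by
        refine (Nat.pow_le_pow_left hqN r).trans ?_
        rw [← pow_mul]
        exact Nat.pow_le_pow_right hN1 (by nlinarith)
      exact Nat.mul_le_mul (Nat.le_add_left _ _) this
    · have h1 : F.natDegree + G.natDegree ≤ d + D := by omega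
      calc _ ≤ (d + D).factorial * ((2 ^ d + 3 + T) * N ^ (κ * (r + 1))) ^ (d + D) :=
            Nat.mul_le_mul (Nat.factorial_le h1) (Nat.pow_le_pow_right hB1 h1)
        _ = _ := by rw [mul_pow, ← pow_mul, ← mul_assoc]
  obtain ⟨m, H, hH1, hH2, hH3, hH4⟩ := exists_eq_C_X_pow_mul h0 hb
  refine ⟨H, hH3, ?_, hH2, ?_⟩
  · refine hH4.trans ?_
    rw [pow_succ, mul_comm (N ^ _) N]
    calc (n + 1) * ((n + 1) * ht₂ H₀) ≤ (n + 1) * ((n + 1) *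
          ((d + D).factorial * (2 ^ d + 3 + T) ^ (d + D) * N ^ (κ * (r + 1) * (d + D)))) := by
          gcongr
      _ = ((n + 1) * ((n + 1) * ((d + D).factorial * (2 ^ d + 3 + T) ^ (d + D)))) *
          N ^ (κ * (r + 1) * (d + D)) := by ring
      _ ≤ _ := Nat.mul_le_mul_right _ (by omega)
  · intro P hP
    obtain ⟨p, s, -, -, hps⟩ :=
      exists_mul_add_mul_eq_C_resultant F G le_rfl le_rfl (Or.inl hdF)
    have h1 := congrArg (ev₃ P.1 P.2.1 P.2.2) hps
    have h2 : ev₃ P.1 P.2.1 P.2.2 F = 0 := by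
      rw [hF, ev₃_surface, hS.eqn P hP, sub_self]
    rw [ev₃_C, map_add, map_mul, map_mul, hg3 P hP, h2, zero_mul, zero_mul, add_zero,
      ← hH₀, hH1] at h1
    have h3 : (spec P.1 (C X ^ m * H)).eval P.2.1 = P.1 ^ m * (spec P.1 H).eval P.2.1 := by
      simp [spec]
    rw [h3] at h1
    exact (mul_eq_zero.1 h1.symm).resolve_left (pow_ne_zero _ (hS0 P hP))

theorem exists_card_divisors_le {ε : ℝ} (hε : 0 < ε) :
    ∃ C : ℝ, 1 ≤ C ∧ ∀ n : ℕ, n ≠ 0 → (n.divisors.card : ℝ) ≤ C * (n : ℝ) ^ ε := by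
  have hl2 : 0 < Real.log 2 := Real.log_pos one_lt_two
  obtain ⟨M, hM⟩ := exists_nat_ge ((2 : ℝ) ^ (1 / ε))
  set A : ℝ := max 1 (1 / (ε * Real.log 2)) with hA
  have hA1 : 1 ≤ A := le_max_left _ _
  refine ⟨A ^ M, one_le_pow₀ hA1, fun n hn => ?_⟩
  have hpos : ∀ p ∈ n.primeFactors, 1 < (p : ℝ) := fun p hp => by
    exact_mod_cast (Nat.prime_of_mem_primeFactors hp).one_lt
  have key : ∀ p ∈ n.primeFactors, ((n.factorization p + 1 : ℕ) : ℝ) ≤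
      (if p < M then A else 1) * ((p : ℝ) ^ n.factorization p) ^ ε := by
    intro p hp
    have hp1 := hpos p hp
    set e := n.factorization p with he
    have h2 : (2 : ℝ) ≤ p := by exact_mod_cast (Nat.prime_of_mem_primeFactors hp).two_le
    rw [← Real.rpow_natCast, ← Real.rpow_mul (by linarith)]
    split_ifs with h
    · have h3 : 1 + ε * e * Real.log 2 ≤ (p : ℝ) ^ ((e : ℝ) * ε) := by
        calc 1 + ε * e * Real.log 2 ≤ Real.exp (ε * e * Real.log 2) := by
              linarith [Real.add_one_le_exp (ε * e * Real.log 2)]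
          _ = (2 : ℝ) ^ ((e : ℝ) * ε) := by
              rw [Real.rpow_def_of_pos two_pos]; ring_nf
          _ ≤ _ := Real.rpow_le_rpow two_pos.le h2 (by positivity)
      have h4 : 1 ≤ A * (ε * Real.log 2) := by
        have := le_max_right 1 (1 / (ε * Real.log 2))
        rw [← hA, div_le_iff₀ (by positivity)] at this
        exact this
      calc ((e + 1 : ℕ) : ℝ) = 1 + e * 1 := by push_cast; ring
        _ ≤ A + e * (A * (ε * Real.log 2)) := by gcongr
        _ = A * (1 + ε * e * Real.log 2) := by ring
        _ ≤ _ := by gcongr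
    · rw [one_mul]
      have h3 : (2 : ℝ) ≤ (p : ℝ) ^ ε := by
        have h4 : (2 : ℝ) ^ (1 / ε) ≤ p := hM.trans (by exact_mod_cast not_lt.1 h)
        calc (2 : ℝ) = ((2 : ℝ) ^ (1 / ε)) ^ ε := by
              rw [← Real.rpow_mul two_pos.le, one_div_mul_cancel hε.ne', Real.rpow_one]
          _ ≤ _ := Real.rpow_le_rpow (by positivity) h4 hε.le
      calc ((e + 1 : ℕ) : ℝ) ≤ (2 : ℝ) ^ e := by exact_mod_cast Nat.lt_two_pow_self
        _ ≤ ((p : ℝ) ^ ε) ^ e := by gcongr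
        _ = _ := by rw [← Real.rpow_natCast, ← Real.rpow_mul (by linarith), mul_comm]
  rw [Nat.card_divisors hn, Nat.cast_prod]
  refine (Finset.prod_le_prod (fun _ _ => by positivity) key).trans ?_
  rw [Finset.prod_mul_distrib, Real.finsetProd_rpow _ _ (fun p _ => by positivity)]
  have h5 : ∏ p ∈ n.primeFactors, (p : ℝ) ^ n.factorization p = n := by
    have := Nat.prod_factorization_pow_eq_self hn
    rw [Finsupp.prod, Nat.support_factorization] at this
    exact_mod_cast congrArg (Nat.cast : ℕ → ℝ) this
  rw [h5]
  gcongr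
  rw [Finset.prod_ite, Finset.prod_const_one, mul_one, Finset.prod_const]
  apply pow_le_pow_right₀ hA1
  calc _ ≤ (Finset.range M).card := Finset.card_le_card fun p hp => by
        simpa using (Finset.mem_filter.1 hp).2
    _ = M := Finset.card_range M

theorem coeff_coeff_swap {R : Type*} [CommRing R] (p : R[X][X]) (i j : ℕ) :
    ((Bivariate.swap p).coeff i).coeff j = (p.coeff j).coeff i := by
  induction p using Polynomial.induction_on' with
  | add p q hp hq => simp only [map_add, coeff_add, hp, hq]
  | monomial n a =>
    induction a using Polynomial.induction_on' with
    | add p q hp hq => simp only [map_add, coeff_add, hp, hq]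
    | monomial m r =>
      rw [Bivariate.swap_monomial_monomial]
      simp only [coeff_monomial]
      by_cases h1 : m = i <;> by_cases h2 : n = j <;> simp [h1, h2, coeff_monomial]

theorem natDegree_swap_le_iff {R : Type*} [CommRing R] (p : R[X][X]) (n : ℕ) :
    (Bivariate.swap p).natDegree ≤ n ↔ ∀ i, (p.coeff i).natDegree ≤ n := by
  simp only [natDegree_le_iff_coeff_eq_zero]
  constructor
  · intro h i N hN
    rw [← coeff_coeff_swap, h N hN, coeff_zero]
  · intro h N hN
    ext j
    rw [coeff_coeff_swap, h j N hN, coeff_zero]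

theorem BidegLE.of_dvd {n : ℕ} {h H : ℤ[X][X]} (hH : BidegLE n H) (h0 : H ≠ 0) (hd : h ∣ H) :
    BidegLE n h := by
  refine ⟨(natDegree_le_of_dvd hd h0).trans hH.1, ?_⟩
  rw [← natDegree_swap_le_iff]
  have h1 := (natDegree_swap_le_iff H n).2 hH.2
  refine (natDegree_le_of_dvd (map_dvd Bivariate.swap hd) ?_).trans h1
  exact (map_ne_zero_iff _ Bivariate.swap.injective).2 h0

theorem BidegLE.derivative {n : ℕ} {h : ℤ[X][X]} (hh : BidegLE n h) :
    BidegLE n (derivative h) := by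
  refine ⟨(natDegree_derivative_le h).trans ((Nat.sub_le _ _).trans hh.1), fun i => ?_⟩
  rw [coeff_derivative, show ((i : ℤ[X]) + 1) = C ((i : ℤ) + 1) by simp]
  exact (natDegree_mul_C_le _ _).trans (hh.2 _)

theorem spec_derivative (u : ℤ) (h : ℤ[X][X]) :
    spec u (derivative h) = derivative (spec u h) := (derivative_map h _).symm

theorem spec_dvd {h H : ℤ[X][X]} (u : ℤ) (hd : h ∣ H) : spec u h ∣ spec u H :=
  Polynomial.map_dvd _ hd

theorem sub_dvd_eval_spec_sub (u v y : ℤ) (h : ℤ[X][X]) :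
    u - v ∣ (spec u h).eval y - (spec v h).eval y := by
  rw [spec, spec, eval_map, eval_map, eval₂_eq_sum, eval₂_eq_sum, sum_def, sum_def,
    ← Finset.sum_sub_distrib]
  refine Finset.dvd_sum fun i _ => ?_
  rw [← sub_mul]
  exact Dvd.dvd.mul_right (sub_dvd_eval_sub _ _ _) _

theorem not_dvd_derivative {h : ℤ[X][X]} (hdeg : h.natDegree ≠ 0) : ¬ h ∣ derivative h := by
  intro hd
  have h1 : derivative h ≠ 0 := by
    intro h0
    exact hdeg (derivative_eq_zero.1 h0)
  have h2 := natDegree_le_of_dvd hd h1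
  have h3 := natDegree_derivative_lt hdeg
  omega

/-- The polynomial whose roots are the third coordinates of the points of the surface
`(z + u) ^ d - z ^ d + y ^ d = c` above `(u, y)`. -/
noncomputable def fibrePoly (d : ℕ) (c u y : ℤ) : ℤ[X] := C (c - y ^ d) - ((X + C u) ^ d - X ^ d)

/-- The points of the surface `(z + u) ^ d - z ^ d + y ^ d = c` above a finite set. -/
noncomputable def fibre (d : ℕ) (c : ℤ) (W : Finset (ℤ × ℤ)) : Finset (ℤ × ℤ × ℤ) :=
  W.biUnion fun w => (fibrePoly d c w.1 w.2).roots.toFinset.image fun z => (w.1, w.2, z)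

theorem card_fibre_le {d : ℕ} (hd : 2 ≤ d) (c : ℤ) (W : Finset (ℤ × ℤ)) :
    (fibre d c W).card ≤ W.card * d := by
  refine Finset.card_biUnion_le_card_mul _ _ _ fun w _ => ?_
  refine Finset.card_image_le.trans ((Multiset.toFinset_card_le _).trans ?_)
  refine (card_roots' _).trans ?_
  by_cases h : w.1 = 0
  · rw [fibrePoly, h, C_0, add_zero, sub_self, sub_zero, natDegree_C]; exact Nat.zero_le _
  · rw [fibrePoly, natDegree_C_sub_X_add_C_pow_sub hd h]; exact Nat.sub_le _ _

theorem mem_fibre {d : ℕ} (hd : 2 ≤ d) {c u y z : ℤ} (hu : u ≠ 0)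
    (h : (z + u) ^ d - z ^ d + y ^ d = c) {W : Finset (ℤ × ℤ)} (hW : (u, y) ∈ W) :
    (u, y, z) ∈ fibre d c W := by
  refine Finset.mem_biUnion.2 ⟨_, hW, Finset.mem_image.2 ⟨z, ?_, rfl⟩⟩
  rw [Multiset.mem_toFinset, mem_roots, IsRoot.def]
  · simp [fibrePoly]
    linarith
  · intro h0
    have h1 := natDegree_C_sub_X_add_C_pow_sub hd hu (c - y ^ d)
    rw [fibrePoly] at h0
    rw [h0, natDegree_zero] at h1
    omega

/-- The integers dividing a nonzero integer. -/
def intDivisors (m : ℤ) : Finset ℤ :=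
  m.natAbs.divisors.image (fun a : ℕ => (a : ℤ)) ∪ m.natAbs.divisors.image (fun a : ℕ => -(a : ℤ))

theorem card_intDivisors_le (m : ℤ) : (intDivisors m).card ≤ 2 * m.natAbs.divisors.card := by
  refine (Finset.card_union_le _ _).trans ?_
  rw [two_mul]
  exact add_le_add Finset.card_image_le Finset.card_image_le

theorem mem_intDivisors {m u : ℤ} (hm : m ≠ 0) (h : u ∣ m) : u ∈ intDivisors m := by
  have h1 : u.natAbs ∈ m.natAbs.divisors :=
    Nat.mem_divisors.2 ⟨Int.natAbs_dvd_natAbs.2 h, Int.natAbs_ne_zero.2 hm⟩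
  rw [intDivisors, Finset.mem_union, Finset.mem_image, Finset.mem_image]
  rcases Int.natAbs_eq u with h2 | h2
  · exact Or.inl ⟨_, h1, h2.symm⟩
  · exact Or.inr ⟨_, h1, h2.symm⟩

/-- Few points of the surface lie above a curve whose intersection with the line `u = 0` does not
contain the roots of `y ^ d = c`. -/
theorem exists_card_le_of_not_dvd_spec_zero {d : ℕ} (hd : 2 ≤ d) (n A κ : ℕ) {ε : ℝ} (hε : 0 < ε) :
    ∃ (C₀ : ℝ) (N₀ : ℕ), ∀ N : ℕ, N₀ ≤ N → ∀ c : ℤ, c.natAbs ≤ N ^ κ →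
      Irreducible (X ^ d - C c : ℤ[X]) → ∀ h : ℤ[X][X], Irreducible h → h.natDegree ≠ 0 →
      BidegLE n h → ht₁ (spec 0 h) ≤ N ^ A → ¬ (X ^ d - C c : ℤ[X]) ∣ spec 0 h →
      ∃ W : Finset (ℤ × ℤ), (W.card : ℝ) ≤ C₀ * (N : ℝ) ^ ε ∧
        ∀ u y z : ℤ, u ≠ 0 → (z + u) ^ d - z ^ d + y ^ d = c → (spec u h).eval y = 0 →
          (u, y) ∈ W := by
  let E := (κ + A + 1) * (d + n) + 1
  have hE : (0 : ℝ) < E := by positivity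
  obtain ⟨C₁, hC₁, hdiv⟩ := exists_card_divisors_le (ε := ε / E) (by positivity)
  refine ⟨2 * C₁ * n, 1 + 1 + (d + n).factorial, ?_⟩
  intro N hN c hc hirr h hh hdeg hbi hht hnd
  have hN1 : 1 ≤ N := by omega
  have hd0 : d ≠ 0 := by omega
  set f : ℤ[X] := X ^ d - C c with hf
  have hfd : f.natDegree = d := natDegree_X_pow_sub_C
  set g := spec 0 h with hg
  have hgn : g.natDegree ≤ n := (spec_natDegree_le _ _).trans hbi.1
  set r := resultant f g with hr
  have hr0 : r ≠ 0 := resultant_ne_zero_of_not_dvd hirr (by rw [hfd]; exact hd0) hnd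
  have hfht : ht₁ f ≤ N ^ (κ + A + 1) := by
    have h1 : ht₁ f ≤ 1 + N ^ κ := by
      refine (isHeight_ht₁.sub _ _).trans (add_le_add ?_ ?_)
      · exact (isHeight_ht₁.pow _ _).trans
          ((Nat.pow_le_pow_left (polyHeight_X_le isHeight_natAbs) d).trans (one_pow d).le)
      · rw [ht₁, polyHeight_C isHeight_natAbs]; exact hc
    have h2 : 1 ≤ N ^ κ := Nat.one_le_pow _ _ hN1
    calc ht₁ f ≤ 1 + N ^ κ := h1
      _ ≤ N ^ κ * N := by nlinarith
      _ = N ^ (κ + 1) := (pow_succ _ _).symm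
      _ ≤ _ := Nat.pow_le_pow_right hN1 (by omega)
  have hrle : r.natAbs ≤ N ^ E := by
    have h1 := isHeight_natAbs.resultant f g f.natDegree g.natDegree (N ^ (κ + A + 1))
      (fun i => (coeff_le_polyHeight isHeight_natAbs f i).trans hfht)
      (fun i => (coeff_le_polyHeight isHeight_natAbs g i).trans
        (hht.trans (Nat.pow_le_pow_right hN1 (by omega))))
    refine h1.trans ?_
    rw [← pow_mul]
    have h2 : f.natDegree + g.natDegree ≤ d + n := by omega
    calc _ ≤ (d + n).factorial * N ^ ((κ + A + 1) * (d + n)) :=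
          Nat.mul_le_mul (Nat.factorial_le h2)
            (Nat.pow_le_pow_right hN1 (Nat.mul_le_mul_left _ h2))
      _ ≤ N * N ^ ((κ + A + 1) * (d + n)) := Nat.mul_le_mul_right _ (by omega)
      _ = _ := by rw [pow_succ]; ring
  refine ⟨(intDivisors r).biUnion fun u => (spec u h).roots.toFinset.image fun y => (u, y), ?_, ?_⟩
  · have h1 : ((intDivisors r).biUnion fun u =>
        (spec u h).roots.toFinset.image fun y => (u, y)).card ≤ 2 * r.natAbs.divisors.card * n := by
      refine (Finset.card_biUnion_le_card_mul _ _ n ?_).trans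
        (Nat.mul_le_mul_right _ (card_intDivisors_le r))
      intro u _
      refine Finset.card_image_le.trans ((Multiset.toFinset_card_le _).trans ?_)
      exact (card_roots' _).trans ((spec_natDegree_le _ _).trans hbi.1)
    have h2 : (r.natAbs.divisors.card : ℝ) ≤ C₁ * (N : ℝ) ^ ε := by
      refine (hdiv _ (Int.natAbs_ne_zero.2 hr0)).trans ?_
      have h3 : (r.natAbs : ℝ) ≤ (N : ℝ) ^ E := by exact_mod_cast hrle
      have h4 : (r.natAbs : ℝ) ^ (ε / E) ≤ (N : ℝ) ^ ε := by
        calc _ ≤ ((N : ℝ) ^ E) ^ (ε / E) := Real.rpow_le_rpow (by positivity) h3 (by positivity)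
          _ = (N : ℝ) ^ ε := by
            rw [← Real.rpow_natCast, ← Real.rpow_mul (by positivity), mul_div_cancel₀ _ hE.ne']
      gcongr
    calc (_ : ℝ) ≤ ((2 * r.natAbs.divisors.card * n : ℕ) : ℝ) := by exact_mod_cast h1
      _ = 2 * (r.natAbs.divisors.card : ℝ) * n := by push_cast; ring
      _ ≤ 2 * (C₁ * (N : ℝ) ^ ε) * n := by gcongr
      _ = _ := by ring
  · intro u y z hu heq hy
    refine Finset.mem_biUnion.2 ⟨u, mem_intDivisors hr0 ?_, Finset.mem_image.2 ⟨y, ?_, rfl⟩⟩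
    · obtain ⟨p, s, -, -, hps⟩ := exists_mul_add_mul_eq_C_resultant f g le_rfl le_rfl
        (Or.inl (by rw [hfd]; exact hd0))
      have h1 := congrArg (eval y) hps
      rw [eval_C, eval_add, eval_mul, eval_mul] at h1
      rw [hr, ← h1]
      refine dvd_add (Dvd.dvd.mul_right ?_ _) (Dvd.dvd.mul_right ?_ _)
      · have h2 : u ∣ (z + u) ^ d - z ^ d := by
          have := sub_dvd_pow_sub_pow (z + u) z d
          rwa [add_sub_cancel_left] at this
        have h3 : f.eval y = -((z + u) ^ d - z ^ d) := by
          rw [hf, eval_sub, eval_pow, eval_X, eval_C]; linarith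
        rw [h3]
        exact (dvd_neg).2 h2
      · have h2 := sub_dvd_eval_spec_sub u 0 y h
        rw [hy, sub_zero, zero_sub] at h2
        exact (dvd_neg).1 h2
    · rw [Multiset.mem_toFinset, mem_roots (spec_ne_zero hh hdeg u)]
      exact hy

theorem exists_card_vertical_le {d : ℕ} (hd : 2 ≤ d) (n : ℕ) {θ : ℝ} (hθ : 1 < θ * d) :
    ∃ B N₀ : ℕ, ∀ N q : ℕ, N₀ ≤ N → (N : ℝ) ^ θ ≤ q → ∀ (c : ℤ) (S : Set (ℤ × ℤ × ℤ)),
      SurfaceClass d N q c S → (∀ P ∈ S, P.1 ≠ 0) → ∀ H : ℤ[X][X], H ≠ 0 → BidegLE n H →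
      ∃ Z : Finset (ℤ × ℤ × ℤ), Z.card ≤ n * B ∧ ∀ P ∈ S, spec P.1 H = 0 → P ∈ Z := by
  obtain ⟨B, N₀, hcurve⟩ := exists_card_curve_le (d := d) (by omega) d hθ
  refine ⟨B, N₀, fun N q hN hq c S hS hS0 H hH hHn => ?_⟩
  have h1 : ∀ a : ℤ, ∃ Z : Finset (ℤ × ℤ), Z.card ≤ B ∧
      (a ≠ 0 → ∀ y z, (a, y, z) ∈ S → (z, y) ∈ Z) := by
    intro a
    by_cases ha : a = 0
    · exact ⟨∅, by simp, fun h => absurd ha h⟩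
    obtain ⟨Z, hZ1, hZ2⟩ := hcurve N q hN hq (verticalCurve d c a)
      (irreducible_verticalCurve hd c ha) (bidegLE_verticalCurve hd c ha)
      (natDegree_verticalCurve c a).ge {w | (a, w.2, w.1) ∈ S}
      (fun w hw => ⟨(hS.bound _ hw).2.2, (hS.bound _ hw).2.1⟩)
      (fun v hv w hw => ⟨(hS.congr _ hv _ hw).2.2, (hS.congr _ hv _ hw).2.1⟩)
      (fun w hw => by
        have := hS.eqn _ hw
        rw [spec_verticalCurve, eval_sub, eval_pow, eval_X, eval_C]
        simp only at this
        linarith)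
      (fun w hw => by
        have := hS.coprime _ hw
        rw [spec_verticalCurve, derivative_sub, derivative_C, sub_zero, derivative_X_pow]
        simpa using this)
    exact ⟨Z, hZ1, fun _ y z h => hZ2 (z, y) h⟩
  choose Zf hZ1 hZ2 using h1
  refine ⟨H.leadingCoeff.roots.toFinset.biUnion fun a => (Zf a).image fun w => (a, w.2, w.1),
    ?_, ?_⟩
  · refine (Finset.card_biUnion_le_card_mul _ _ B fun a _ =>
      Finset.card_image_le.trans (hZ1 a)).trans (Nat.mul_le_mul_right _ ?_)
    exact (Multiset.toFinset_card_le _).trans ((card_roots' _).trans (hHn.2 _))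
  · rintro ⟨u, y, z⟩ hP h0
    refine Finset.mem_biUnion.2 ⟨u, ?_, Finset.mem_image.2 ⟨(z, y), ?_, rfl⟩⟩
    · rw [Multiset.mem_toFinset, mem_roots (leadingCoeff_ne_zero.2 hH), IsRoot.def]
      have := congrArg (fun p => coeff p H.natDegree) h0
      simpa [spec] using this
    · exact hZ2 u (hS0 _ hP) y z hP

theorem exists_irreducible_factors {n : ℕ} {H : ℤ[X][X]} (hH : H ≠ 0) (hn : BidegLE n H) :
    ∃ Φ : Finset ℤ[X][X], Φ.card ≤ n ∧
      (∀ h ∈ Φ, Irreducible h ∧ h.natDegree ≠ 0 ∧ BidegLE n h ∧ h ∣ H) ∧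
      ∀ u y : ℤ, (spec u H).eval y = 0 → spec u H ≠ 0 → ∃ h ∈ Φ, (spec u h).eval y = 0 := by
  classical
  set F := UniqueFactorizationMonoid.factors H with hF
  have hprod : Associated F.prod H := UniqueFactorizationMonoid.factors_prod hH
  refine ⟨(F.filter fun h => h.natDegree ≠ 0).toFinset, ?_, ?_, ?_⟩
  · refine (Multiset.toFinset_card_le _).trans ?_
    set F' := F.filter fun h => h.natDegree ≠ 0 with hF'
    have h1 : F'.prod ∣ H :=
      (Multiset.prod_dvd_prod_of_le (Multiset.filter_le _ _)).trans hprod.dvd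
    have h2 := (natDegree_le_of_dvd h1 hH).trans hn.1
    rw [natDegree_multiset_prod _ (fun h0 => ?_)] at h2
    · refine le_trans ?_ h2
      rw [← Multiset.card_map natDegree F']
      have h3 := Multiset.card_nsmul_le_sum (s := F'.map natDegree) (a := 1) (fun x hx => ?_)
      · simpa using h3
      · obtain ⟨p, hp, rfl⟩ := Multiset.mem_map.1 hx
        exact Nat.one_le_iff_ne_zero.2 (Multiset.mem_filter.1 hp).2
    · exact hH (zero_dvd_iff.1 ((Multiset.dvd_prod h0).trans h1))
  · intro h hh
    obtain ⟨h1, h2⟩ := Multiset.mem_filter.1 (Multiset.mem_toFinset.1 hh)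
    have h3 : h ∣ H := UniqueFactorizationMonoid.dvd_of_mem_factors h1
    exact ⟨UniqueFactorizationMonoid.irreducible_of_factor h h1, h2, hn.of_dvd hH h3, h3⟩
  · intro u y hy hu
    obtain ⟨e, he⟩ := hprod
    let φ : ℤ[X][X] →+* ℤ := (evalRingHom y).comp (mapRingHom (evalRingHom u))
    have hφ : ∀ p, φ p = (spec u p).eval y := fun p => rfl
    have h1 : φ F.prod = 0 := by
      have h2 : φ (F.prod * e) = 0 := by rw [he, hφ, hy]
      rw [map_mul] at h2
      exact (mul_eq_zero.1 h2).resolve_right (e.isUnit.map φ).ne_zero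
    rw [map_multiset_prod, Multiset.prod_eq_zero_iff, Multiset.mem_map] at h1
    obtain ⟨h, hh, h0⟩ := h1
    refine ⟨h, ?_, h0⟩
    rw [Multiset.mem_toFinset, Multiset.mem_filter]
    refine ⟨hh, fun hdeg => hu ?_⟩
    have h3 : spec u h = 0 := by
      rw [eq_C_of_natDegree_eq_zero hdeg] at h0 ⊢
      simp only [hφ, spec, map_C, eval_C] at h0 ⊢
      rw [h0, C_0]
    have h4 := spec_dvd u (UniqueFactorizationMonoid.dvd_of_mem_factors hh)
    rw [h3] at h4
    exact zero_dvd_iff.1 h4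

/-- A congruence class of points of the surface is the union of a small set and of finitely many
curves, at whose points some partial derivative is small, nonzero and not coprime to the modulus. -/
theorem exists_class_decomposition {d : ℕ} (hd : 2 ≤ d) {θ ε : ℝ} (hθ0 : 0 < θ)
    (hθ : 1 < θ * Real.sqrt d) (hε : 0 < ε) (κ : ℕ) :
    ∃ (n A N₀ : ℕ) (C₀ : ℝ), ∀ N q : ℕ, N₀ ≤ N → (N : ℝ) ^ θ ≤ q → q ≤ N ^ κ → ∀ c : ℤ,
      c.natAbs ≤ N ^ κ → Irreducible (X ^ d - C c : ℤ[X]) → ∀ S : Set (ℤ × ℤ × ℤ),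
      SurfaceClass d N q c S → (∀ P ∈ S, P.1 ≠ 0) →
      ∃ (Z : Finset (ℤ × ℤ × ℤ)) (Φ : Finset ℤ[X][X]), (Z.card : ℝ) ≤ C₀ * (N : ℝ) ^ ε ∧
        Φ.card ≤ n ∧ (∀ h ∈ Φ, Irreducible h ∧ h.natDegree ≠ 0 ∧ BidegLE n h) ∧
        ∀ P ∈ S, P ∈ Z ∨ ∃ h ∈ Φ, (spec P.1 h).eval P.2.1 = 0 ∧
          (derivative (spec P.1 h)).eval P.2.1 ≠ 0 ∧
          ((derivative (spec P.1 h)).eval P.2.1).natAbs ≤ N ^ A ∧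
          ¬ IsCoprime ((derivative (spec P.1 h)).eval P.2.1) (q : ℤ) := by
  classical
  have hθd : 1 < θ * d := by
    refine hθ.trans_le ?_
    have h1 : (1 : ℝ) ≤ d := by exact_mod_cast (by omega : 1 ≤ d)
    have : Real.sqrt d ≤ d := by
      rw [Real.sqrt_le_left (by positivity)]
      nlinarith
    gcongr
  obtain ⟨n, A, N₁, hplane⟩ := exists_plane_curve hd hθ0 hθ κ
  obtain ⟨B₁, N₂, hvert⟩ := exists_card_vertical_le hd n hθd
  obtain ⟨B₂, N₃, hcurve⟩ := exists_card_curve_le (d := d) (by omega) n hθd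
  obtain ⟨C₁, N₄, hzero⟩ := exists_card_le_of_not_dvd_spec_zero hd n (A + 1) κ hε
  refine ⟨n, 1 + (A + n) + n, 1 + N₁ + N₂ + N₃ + N₄ + (n + 1) * (n + 1) * 2 ^ n,
    n * B₁ + n * ((|C₁| + 2 * n * n * n + B₂) * d), ?_⟩
  intro N q hN hq hqκ c hc hirr S hS hS0
  have hN1 : 1 ≤ N := by omega
  have hN1' : (1 : ℝ) ≤ N := by exact_mod_cast hN1
  have hNε : (1 : ℝ) ≤ (N : ℝ) ^ ε := Real.one_le_rpow hN1' hε.le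
  obtain ⟨H, hHn, hHht, hH0, hHS⟩ := hplane N q (by omega) hq hqκ c hc hirr S hS hS0
  have hH : H ≠ 0 := by
    rintro rfl
    exact hH0 (by simp [spec])
  obtain ⟨Zv, hZv1, hZv2⟩ := hvert N q (by omega) hq c S hS hS0 H hH hHn
  obtain ⟨Φ, hΦ1, hΦ2, hΦ3⟩ := exists_irreducible_factors hH hHn
  have hconst : (n + 1) * 2 ^ n ≤ N := by nlinarith [Nat.one_le_two_pow (n := n)]
  have hfac : ∀ h ∈ Φ, ∃ W : Finset (ℤ × ℤ),
      (W.card : ℝ) ≤ (|C₁| + 2 * n * n * n + B₂) * (N : ℝ) ^ ε ∧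
      ∀ P ∈ S, (spec P.1 h).eval P.2.1 = 0 → ((derivative (spec P.1 h)).eval P.2.1 = 0 ∨
        IsCoprime ((derivative (spec P.1 h)).eval P.2.1) (q : ℤ)) → (P.1, P.2.1) ∈ W := by
    intro h hh
    obtain ⟨hirr', hdeg, hhn, hdvd⟩ := hΦ2 h hh
    have hC₁ : |C₁| * (N : ℝ) ^ ε ≤ (|C₁| + 2 * n * n * n + B₂) * (N : ℝ) ^ ε := by
      gcongr
      have : (0 : ℝ) ≤ 2 * n * n * n + B₂ := by positivity
      linarith
    by_cases hf : (X ^ d - C c : ℤ[X]) ∣ spec 0 h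
    · have h0 : spec 0 h ≠ 0 := fun h0 => hH0 (by
        have := spec_dvd 0 hdvd
        rw [h0] at this
        exact zero_dvd_iff.1 this)
      have hdh : d ≤ h.natDegree := by
        have := natDegree_le_of_dvd hf h0
        rw [natDegree_X_pow_sub_C] at this
        exact this.trans (spec_natDegree_le _ _)
      obtain ⟨W₁, hW₁, hW₁'⟩ := exists_finset_common_zeros hirr' hdeg (not_dvd_derivative hdeg)
        hhn hhn.derivative
      obtain ⟨W₂, hW₂, hW₂'⟩ := hcurve N q (by omega) hq h hirr' hhn hdh
        {w | (spec w.1 h).eval w.2 = 0 ∧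
          IsCoprime ((derivative (spec w.1 h)).eval w.2) (q : ℤ) ∧ ∃ z, (w.1, w.2, z) ∈ S}
        (fun w ⟨_, _, z, hz⟩ => ⟨(hS.bound _ hz).1, (hS.bound _ hz).2.1⟩)
        (fun v ⟨_, _, z, hz⟩ w ⟨_, _, z', hz'⟩ =>
          ⟨(hS.congr _ hz _ hz').1, (hS.congr _ hz _ hz').2.1⟩)
        (fun w hw => hw.1) (fun w hw => hw.2.1)
      refine ⟨W₁ ∪ W₂, ?_, ?_⟩
      · have h1 : (W₁ ∪ W₂).card ≤ 2 * n * n * n + B₂ :=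
          (Finset.card_union_le _ _).trans (add_le_add hW₁ hW₂)
        calc ((W₁ ∪ W₂).card : ℝ) ≤ ((2 * n * n * n + B₂ : ℕ) : ℝ) := by exact_mod_cast h1
          _ = (2 * n * n * n + B₂ : ℝ) * 1 := by push_cast; ring
          _ ≤ _ := by
            gcongr
            linarith [abs_nonneg C₁]
      · rintro ⟨u, y, z⟩ hP hz hor
        rw [Finset.mem_union]
        rcases hor with h1 | h1
        · left
          exact hW₁' u y hz (by rw [spec_derivative]; exact h1)
        · right
          exact hW₂' (u, y) ⟨hz, h1, z, hP⟩
    · have hht : ht₁ (spec 0 h) ≤ N ^ (A + 1) := by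
        have h1 := ht₁_le_of_dvd hH0 (spec_dvd 0 hdvd) ((spec_natDegree_le 0 H).trans hHn.1)
        have h2 := ht₁_spec_le H hHn.2 (a := 0) (B := 1) le_rfl (by simp)
        rw [one_pow, mul_one] at h2
        calc _ ≤ _ := h1
          _ ≤ N * N ^ A := Nat.mul_le_mul hconst (h2.trans hHht)
          _ = _ := by rw [pow_succ, mul_comm]
      obtain ⟨W, hW, hW'⟩ := hzero N (by omega) c hc hirr h hirr' hdeg hhn hht hf
      refine ⟨W, (hW.trans ?_).trans hC₁, ?_⟩
      · gcongr
        exact le_abs_self _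
      · rintro ⟨u, y, z⟩ hP hz -
        exact hW' u y z (hS0 _ hP) (hS.eqn _ hP) hz
  choose! Wf hW1 hW2 using hfac
  refine ⟨Zv ∪ Φ.biUnion fun h => fibre d c (Wf h), Φ, ?_, hΦ1,
    fun h hh => ⟨(hΦ2 h hh).1, (hΦ2 h hh).2.1, (hΦ2 h hh).2.2.1⟩, ?_⟩
  · have h1 : ((Φ.biUnion fun h => fibre d c (Wf h)).card : ℝ) ≤
        n * ((|C₁| + 2 * n * n * n + B₂) * d) * (N : ℝ) ^ ε := by
      calc ((Φ.biUnion fun h => fibre d c (Wf h)).card : ℝ)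
          ≤ ((∑ h ∈ Φ, (fibre d c (Wf h)).card : ℕ) : ℝ) := by
            exact_mod_cast Finset.card_biUnion_le
        _ = ∑ h ∈ Φ, ((fibre d c (Wf h)).card : ℝ) := Nat.cast_sum _ _
        _ ≤ ∑ h ∈ Φ, (|C₁| + 2 * n * n * n + B₂) * (N : ℝ) ^ ε * d := by
            refine Finset.sum_le_sum fun h hh => ?_
            calc ((fibre d c (Wf h)).card : ℝ) ≤ (Wf h).card * d := by
                  exact_mod_cast card_fibre_le hd c (Wf h)
              _ ≤ _ := by gcongr; exact hW1 h hh
        _ = Φ.card * ((|C₁| + 2 * n * n * n + B₂) * (N : ℝ) ^ ε * d) := by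
            rw [Finset.sum_const, nsmul_eq_mul]
        _ ≤ n * ((|C₁| + 2 * n * n * n + B₂) * (N : ℝ) ^ ε * d) := by gcongr
        _ = _ := by ring
    have h2 : (Zv.card : ℝ) ≤ n * B₁ * (N : ℝ) ^ ε := by
      calc (Zv.card : ℝ) ≤ n * B₁ * 1 := by rw [mul_one]; exact_mod_cast hZv1
        _ ≤ _ := by gcongr
    calc _ ≤ (Zv.card : ℝ) + ((Φ.biUnion fun h => fibre d c (Wf h)).card : ℝ) := by
          exact_mod_cast Finset.card_union_le _ _
      _ ≤ n * B₁ * (N : ℝ) ^ ε + n * ((|C₁| + 2 * n * n * n + B₂) * d) * (N : ℝ) ^ ε :=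
          add_le_add h2 h1
      _ = _ := by ring
  · rintro ⟨u, y, z⟩ hP
    by_cases hv : spec u H = 0
    · exact Or.inl (Finset.mem_union_left _ (hZv2 _ hP hv))
    obtain ⟨h, hh, hz⟩ := hΦ3 u y (hHS _ hP) hv
    obtain ⟨hirr', hdeg, hhn, hdvd⟩ := hΦ2 h hh
    by_cases hcase : (derivative (spec u h)).eval y = 0 ∨
        IsCoprime ((derivative (spec u h)).eval y) (q : ℤ)
    · left
      refine Finset.mem_union_right _ (Finset.mem_biUnion.2 ⟨h, hh, ?_⟩)
      exact mem_fibre hd (hS0 _ hP) (hS.eqn _ hP) (hW2 h hh _ hP hz hcase)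
    · right
      rw [not_or] at hcase
      refine ⟨h, hh, hz, hcase.1, ?_, hcase.2⟩
      have h1 := ht₁_le_of_dvd hv (spec_dvd u hdvd) ((spec_natDegree_le u H).trans hHn.1)
      have h2 := ht₁_spec_le H hHn.2 hN1 (hS.bound _ hP).1
      have h3 : (spec u h).natDegree ≤ n := (spec_natDegree_le u h).trans hhn.1
      have h4 := ht₁_derivative_le (spec u h) h3
      have h5 := natAbs_eval_le (derivative (spec u h))
        ((natDegree_derivative_le _).trans ((Nat.sub_le _ _).trans h3)) hN1 (hS.bound _ hP).2.1
      simp only at h2 h5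
      have hconst' : n * ((n + 1) * 2 ^ n) ≤ N := by nlinarith [Nat.one_le_two_pow (n := n)]
      calc _ ≤ _ := h5
        _ ≤ n * ((n + 1) * 2 ^ n * (N ^ A * N ^ n)) * N ^ n := by
            gcongr
            exact h4.trans (Nat.mul_le_mul_left _ (h1.trans (Nat.mul_le_mul_left _
              (h2.trans (Nat.mul_le_mul_right _ hHht)))))
        _ = n * ((n + 1) * 2 ^ n) * (N ^ A * N ^ n * N ^ n) := by ring
        _ ≤ N * (N ^ A * N ^ n * N ^ n) := Nat.mul_le_mul_right _ hconst'
        _ = _ := by rw [← pow_add, ← pow_add, pow_add, pow_add, pow_add]; ring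

theorem exists_primes_between (L m : ℕ) (hm : m ≠ 0) :
    ∃ Q : Finset ℕ, Q.card = L ∧ ∀ p ∈ Q, p.Prime ∧ m < p ∧ p ≤ 2 ^ L * m := by
  induction L with
  | zero => exact ⟨∅, rfl, by simp⟩
  | succ L ih =>
    obtain ⟨Q, hQ, hQ'⟩ := ih
    obtain ⟨p, hp, hp1, hp2⟩ := Nat.exists_prime_lt_and_le_two_mul (2 ^ L * m) (by positivity)
    have h1 : m ≤ 2 ^ L * m := Nat.le_mul_of_pos_left m (by positivity)
    refine ⟨insert p Q, ?_, ?_⟩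
    · rw [Finset.card_insert_of_notMem, hQ]
      intro h
      have := (hQ' p h).2.2
      omega
    · intro r hr
      rw [Finset.mem_insert] at hr
      rw [pow_succ', mul_assoc]
      rcases hr with rfl | hr
      · exact ⟨hp, by omega, hp2⟩
      · obtain ⟨h2, h3, h4⟩ := hQ' r hr
        exact ⟨h2, h3, by omega⟩

theorem exists_primes_near_rpow (d L : ℕ) {η : ℝ} (hη : 0 < η) (hη1 : η < 1) :
    ∃ N₀ : ℕ, ∀ N : ℕ, N₀ ≤ N → ∃ Q : Finset ℕ, Q.card = L ∧ ∀ p ∈ Q, p.Prime ∧ d < p ∧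
      (N : ℝ) ^ η ≤ p ∧ (p : ℝ) ≤ 2 ^ (L + 1) * (N : ℝ) ^ η ∧ p ≤ N := by
  have h1 := (tendsto_rpow_atTop hη).comp tendsto_natCast_atTop_atTop
  have h2 := (tendsto_rpow_atTop (sub_pos.2 hη1)).comp tendsto_natCast_atTop_atTop
  have h3 := (h1.eventually_ge_atTop ((d : ℝ) + 1)).and (h2.eventually_ge_atTop (2 ^ (L + 1)))
  obtain ⟨N₀, hN₀⟩ := Filter.eventually_atTop.1 h3
  refine ⟨N₀ + 1, fun N hN => ?_⟩
  obtain ⟨h4, h5⟩ := hN₀ N (by omega)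
  simp only [Function.comp_apply] at h4 h5
  have hN0 : (0 : ℝ) < N := by exact_mod_cast (by omega : 0 < N)
  set x := (N : ℝ) ^ η with hx
  have hd0 : (0 : ℝ) ≤ d := Nat.cast_nonneg d
  have hx0 : 0 ≤ x := by linarith
  have hm1 : x ≤ (⌈x⌉₊ : ℝ) := Nat.le_ceil x
  have hm2 : (⌈x⌉₊ : ℝ) < x + 1 := Nat.ceil_lt_add_one hx0
  obtain ⟨Q, hQ, hQ'⟩ := exists_primes_between L ⌈x⌉₊ (by
    have : (0 : ℝ) < (⌈x⌉₊ : ℝ) := by linarith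
    exact_mod_cast this.ne')
  refine ⟨Q, hQ, fun p hp => ?_⟩
  obtain ⟨h6, h7, h8⟩ := hQ' p hp
  have h7' : (⌈x⌉₊ : ℝ) < p := by exact_mod_cast h7
  have h8' : (p : ℝ) ≤ 2 ^ L * ⌈x⌉₊ := by exact_mod_cast h8
  have h9 : (p : ℝ) ≤ 2 ^ (L + 1) * x := by
    calc (p : ℝ) ≤ 2 ^ L * ⌈x⌉₊ := h8'
      _ ≤ 2 ^ L * (2 * x) := by gcongr; linarith
      _ = _ := by ring
  refine ⟨h6, ?_, by linarith, h9, ?_⟩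
  · have : (d : ℝ) < p := by linarith
    exact_mod_cast this
  · have h10 : (p : ℝ) ≤ N := by
      calc (p : ℝ) ≤ 2 ^ (L + 1) * x := h9
        _ ≤ (N : ℝ) ^ (1 - η) * (N : ℝ) ^ η := by gcongr
        _ = N := by rw [← Real.rpow_add hN0, sub_add_cancel, Real.rpow_one]
    exact_mod_cast h10

theorem card_filter_dvd_mul_le {Q : Finset ℕ} {N A : ℕ} {η : ℝ} (hN : 2 ≤ N)
    (hQ : ∀ p ∈ Q, p.Prime ∧ (N : ℝ) ^ η ≤ p) {w : ℤ} (hw : w ≠ 0) (hwA : w.natAbs ≤ N ^ A) :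
    ((Q.filter fun p : ℕ => (p : ℤ) ∣ w).card : ℝ) * η ≤ A := by
  set R := Q.filter fun p : ℕ => (p : ℤ) ∣ w with hR
  have h1 : ∏ p ∈ R, p ∣ w.natAbs := by
    refine Finset.prod_primes_dvd _ (fun p hp => ?_) (fun p hp => ?_)
    · exact (hQ p (Finset.mem_filter.1 hp).1).1.prime
    · exact Int.natCast_dvd.1 (Finset.mem_filter.1 hp).2
  have h2 : ∏ p ∈ R, p ≤ N ^ A := (Nat.le_of_dvd (Int.natAbs_pos.2 hw) h1).trans hwA
  have hN0 : (0 : ℝ) < N := by exact_mod_cast (by omega : 0 < N)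
  have h3 : ((N : ℝ) ^ η) ^ R.card ≤ (N : ℝ) ^ A := by
    calc ((N : ℝ) ^ η) ^ R.card = ∏ p ∈ R, (N : ℝ) ^ η := by rw [Finset.prod_const]
      _ ≤ ∏ p ∈ R, (p : ℝ) := Finset.prod_le_prod (fun _ _ => by positivity)
          fun p hp => (hQ p (Finset.mem_filter.1 hp).1).2
      _ = ((∏ p ∈ R, p : ℕ) : ℝ) := (Nat.cast_prod _ _).symm
      _ ≤ ((N ^ A : ℕ) : ℝ) := by exact_mod_cast h2
      _ = _ := Nat.cast_pow _ _
  rw [← Real.rpow_natCast, ← Real.rpow_natCast, ← Real.rpow_mul hN0.le,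
    Real.rpow_le_rpow_left_iff (by exact_mod_cast (by omega : 1 < N))] at h3
  linarith

theorem dvd_of_forall_adjacent {α β : Type*} [DecidableEq α] [Monoid β] (L : Finset α) (K : ℕ)
    (h : Finset α → β)
    (hadj : ∀ I I', I ⊆ L → I' ⊆ L → I.card = K → I'.card = K → (I ∪ I').card = K + 1 →
      h I ∣ h I') :
    ∀ (m : ℕ) (I I' : Finset α), (I \ I').card = m → I ⊆ L → I' ⊆ L → I.card = K → I'.card = K →
      h I ∣ h I' := by
  intro m
  induction m with
  | zero =>
    intro I I' h0 _ _ hI hI'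
    have h1 : I ⊆ I' := Finset.sdiff_eq_empty_iff_subset.1 (Finset.card_eq_zero.1 h0)
    rw [Finset.eq_of_subset_of_card_le h1 (by omega)]
  | succ m ih =>
    intro I I' h0 hIL hIL' hI hI'
    obtain ⟨a, ha⟩ := Finset.card_pos.1 (by omega : 0 < (I \ I').card)
    obtain ⟨b, hb⟩ := Finset.card_pos.1
      (by rw [Finset.card_sdiff_comm (by omega)]; omega : 0 < (I' \ I).card)
    rw [Finset.mem_sdiff] at ha hb
    have hb' : b ∉ I.erase a := fun h => hb.2 (Finset.mem_of_mem_erase h)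
    have hcard : (insert b (I.erase a)).card = K := by
      rw [Finset.card_insert_of_notMem hb', Finset.card_erase_of_mem ha.1, hI]
      have : 0 < I.card := Finset.card_pos.2 ⟨a, ha.1⟩
      omega
    have hsub : insert b (I.erase a) ⊆ L :=
      Finset.insert_subset (hIL' hb.1) ((Finset.erase_subset _ _).trans hIL)
    refine (hadj I (insert b (I.erase a)) hIL hsub hI hcard ?_).trans
      (ih _ I' ?_ hsub hIL' hcard hI')
    · rw [Finset.union_insert, Finset.union_eq_left.2 (Finset.erase_subset _ _),
        Finset.card_insert_of_notMem hb.2, hI]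
    · rw [Finset.insert_sdiff_of_mem _ hb.1, Finset.erase_sdiff_comm,
        Finset.card_erase_of_mem (Finset.mem_sdiff.2 ha), h0, Nat.add_sub_cancel]

theorem derivative_spec_eval_dvd {h g : ℤ[X][X]} (hd : h ∣ g) {u y : ℤ}
    (h0 : (spec u h).eval y = 0) :
    (derivative (spec u h)).eval y ∣ (derivative (spec u g)).eval y := by
  obtain ⟨e, he⟩ := spec_dvd u hd
  rw [he, derivative_mul, eval_add, eval_mul, eval_mul, h0, zero_mul, add_zero]
  exact dvd_mul_right _ _

/-- It is impossible that all products of `K` primes fail to be coprime to the derivatives at a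
given point of polynomials attached to these products, when adjacent polynomials divide each
other. -/
theorem false_of_forall_not_isCoprime {L : Finset ℕ} {K m A N : ℕ} {u y : ℤ}
    (hprime : ∀ p ∈ L, p.Prime) (hL : K + m ≤ L.card)
    (hm : ∀ w : ℤ, w ≠ 0 → w.natAbs ≤ N ^ A → (L.filter fun p : ℕ => (p : ℤ) ∣ w).card ≤ m)
    (h : Finset ℕ → ℤ[X][X])
    (hh : ∀ I ⊆ L, I.card = K → (spec u (h I)).eval y = 0 ∧
      (derivative (spec u (h I))).eval y ≠ 0 ∧
      ((derivative (spec u (h I))).eval y).natAbs ≤ N ^ A ∧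
      ¬ IsCoprime ((derivative (spec u (h I))).eval y) ((∏ p ∈ I, p : ℕ) : ℤ))
    (hadj : ∀ I I', I ⊆ L → I' ⊆ L → I.card = K → I'.card = K → (I ∪ I').card = K + 1 →
      h I ∣ h I') : False := by
  obtain ⟨I₀, hI₀, hI₀'⟩ := Finset.exists_subset_card_eq (by omega : K ≤ L.card)
  obtain ⟨-, h1, h2, -⟩ := hh I₀ hI₀ hI₀'
  set w := (derivative (spec u (h I₀))).eval y with hw
  have h3 := hm w h1 h2
  have h4 := Finset.card_filter_add_card_filter_not (s := L) (fun p : ℕ => (p : ℤ) ∣ w)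
  obtain ⟨I, hI, hI'⟩ := Finset.exists_subset_card_eq
    (by omega : K ≤ (L.filter fun p : ℕ => ¬ (p : ℤ) ∣ w).card)
  have hIL : I ⊆ L := hI.trans (Finset.filter_subset _ _)
  obtain ⟨h5, -, -, h6⟩ := hh I hIL hI'
  apply h6
  have h7 := dvd_of_forall_adjacent L K h hadj _ I I₀ rfl hIL hI₀ hI' hI₀'
  refine IsCoprime.of_isCoprime_of_dvd_left ?_ (derivative_spec_eval_dvd h7 h5)
  rw [Nat.cast_prod]
  refine IsCoprime.prod_right fun p hp => ?_
  have h8 := hprime p (hIL hp)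
  exact ((Nat.prime_iff_prime_int.1 h8).coprime_iff_not_dvd.2
    (Finset.mem_filter.1 (hI hp)).2).symm

theorem card_residues_le {d p : ℕ} (hd : 0 < d) (hp : p.Prime) (c : ℤ) :
    (((Finset.Ico (0 : ℤ) p) ×ˢ (Finset.Ico (0 : ℤ) p) ×ˢ (Finset.Ico (0 : ℤ) p)).filter
      fun P => (p : ℤ) ∣ (P.2.2 + P.1) ^ d - P.2.2 ^ d + P.2.1 ^ d - c).card ≤ d * p ^ 2 := by
  classical
  have := Fact.mk hp
  refine (Finset.card_le_mul_card_image (f := fun P : ℤ × ℤ × ℤ => (P.1, P.2.2)) _ d ?_).trans ?_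
  · rintro ⟨a, z⟩ -
    refine le_trans ?_ (card_nthRoots d ((c - ((z + a) ^ d - z ^ d) : ℤ) : ZMod p))
    refine le_trans ?_ (Multiset.toFinset_card_le _)
    refine Finset.card_le_card_of_injOn (fun P => (P.2.1 : ZMod p)) ?_ ?_
    · rintro ⟨a', y, z'⟩ hP
      simp only [Finset.coe_filter, Set.mem_ofPred_eq, Finset.mem_filter, Prod.mk.injEq] at hP
      obtain ⟨⟨-, h1⟩, rfl, rfl⟩ := hP
      simp only [Finset.mem_coe, Multiset.mem_toFinset]
      rw [mem_nthRoots hd]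
      rw [← Int.cast_pow, ZMod.intCast_eq_intCast_iff_dvd_sub]
      have h2 : c - ((z' + a') ^ d - z' ^ d) - y ^ d =
          -((z' + a') ^ d - z' ^ d + y ^ d - c) := by ring
      rw [h2]
      exact (dvd_neg).2 h1
    · rintro ⟨a', y, z'⟩ hP ⟨a'', y', z''⟩ hP' heq
      simp only [Finset.coe_filter, Set.mem_ofPred_eq, Finset.mem_filter, Prod.mk.injEq,
        Finset.mem_product, Finset.mem_Ico] at hP hP'
      obtain ⟨⟨h1, -⟩, rfl, rfl⟩ := hP
      obtain ⟨⟨h2, -⟩, rfl, rfl⟩ := hP'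
      simp only at heq
      rw [ZMod.intCast_eq_intCast_iff_dvd_sub] at heq
      have h3 : y = y' := by
        have h4 : y % p = y' % p := Int.modEq_iff_dvd.2 heq
        rwa [Int.emod_eq_of_lt h1.2.1.1 h1.2.1.2, Int.emod_eq_of_lt h2.2.1.1 h2.2.1.2] at h4
      rw [h3]
  · refine Nat.mul_le_mul_left _ ?_
    refine (Finset.card_le_card (t := Finset.Ico (0 : ℤ) p ×ˢ Finset.Ico (0 : ℤ) p) ?_).trans ?_
    · intro x hx
      simp only [Finset.mem_image, Finset.mem_filter, Finset.mem_product] at hx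
      obtain ⟨P, ⟨⟨h1, -, h2⟩, -⟩, rfl⟩ := hx
      exact Finset.mem_product.2 ⟨h1, h2⟩
    · simp [sq]

/-- The residues of a point modulo the members of a finite set. -/
def residues (I : Finset ℕ) (P : ℤ × ℤ × ℤ) : ℕ → ℤ × ℤ × ℤ :=
  fun p => if p ∈ I then (P.1 % p, P.2.1 % p, P.2.2 % p) else 0

/-- The restriction of a family of residues. -/
def restrictResidues (I : Finset ℕ) (k : ℕ → ℤ × ℤ × ℤ) : ℕ → ℤ × ℤ × ℤ :=
  fun p => if p ∈ I then k p else 0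

theorem restrictResidues_residues {I J : Finset ℕ} (h : I ⊆ J) (P : ℤ × ℤ × ℤ) :
    restrictResidues I (residues J P) = residues I P := by
  ext1 p
  by_cases hp : p ∈ I
  · simp [restrictResidues, residues, hp, h hp]
  · simp [restrictResidues, residues, hp]

theorem card_image_residues_le [DecidableEq (ℕ → ℤ × ℤ × ℤ)] {d : ℕ} (hd : 0 < d) {c : ℤ}
    {T : Finset (ℤ × ℤ × ℤ)}
    (hT : ∀ P ∈ T, (P.2.2 + P.1) ^ d - P.2.2 ^ d + P.2.1 ^ d = c) {I : Finset ℕ}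
    (hI : ∀ p ∈ I, p.Prime) : (T.image (residues I)).card ≤ ∏ p ∈ I, d * p ^ 2 := by
  classical
  let R : ℕ → Finset (ℤ × ℤ × ℤ) := fun p =>
    ((Finset.Ico (0 : ℤ) p) ×ˢ (Finset.Ico (0 : ℤ) p) ×ˢ (Finset.Ico (0 : ℤ) p)).filter
      fun P => (p : ℤ) ∣ (P.2.2 + P.1) ^ d - P.2.2 ^ d + P.2.1 ^ d - c
  have h1 : (T.image (residues I)).card ≤ (I.pi R).card := by
    refine Finset.card_le_card_of_injOn (fun k p _ => k p) ?_ ?_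
    · intro k hk
      obtain ⟨P, hP, rfl⟩ := Finset.mem_image.1 hk
      simp only [Finset.mem_coe, Finset.mem_pi]
      intro p hp
      have hp0 : (0 : ℤ) < p := by exact_mod_cast (hI p hp).pos
      have hm : ∀ x : ℤ, x % p ∈ Finset.Ico (0 : ℤ) p := fun x =>
        Finset.mem_Ico.2 ⟨Int.emod_nonneg _ hp0.ne', Int.emod_lt_of_pos _ hp0⟩
      simp only [residues, if_pos hp, R, Finset.mem_filter, Finset.mem_product]
      refine ⟨⟨hm _, hm _, hm _⟩, ?_⟩
      rw [← hT P hP]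
      apply Int.ModEq.dvd
      symm
      have h2 : ∀ x : ℤ, x % p ≡ x [ZMOD p] := fun x => Int.mod_modEq x p
      exact ((((h2 _).add (h2 _)).pow d).sub ((h2 _).pow d)).add ((h2 _).pow d)
    · intro k hk k' hk' heq
      obtain ⟨P, hP, rfl⟩ := Finset.mem_image.1 hk
      obtain ⟨P', hP', rfl⟩ := Finset.mem_image.1 hk'
      ext1 p
      by_cases hp : p ∈ I
      · exact congrFun (congrFun heq p) hp
      · simp [residues, hp]
  refine h1.trans ?_
  rw [Finset.card_pi]
  exact Finset.prod_le_prod' fun p hp => card_residues_le hd (hI p hp) c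

/-- The points with given residues. -/
def residueClass (T : Finset (ℤ × ℤ × ℤ)) (I : Finset ℕ) (k : ℕ → ℤ × ℤ × ℤ) :
    Set (ℤ × ℤ × ℤ) :=
  {P | P ∈ T ∧ (∀ p ∈ I, ¬ (p : ℤ) ∣ P.2.1) ∧ residues I P = k}

theorem surfaceClass_residueClass {d N : ℕ} (hd : 0 < d) {c : ℤ} {T : Finset (ℤ × ℤ × ℤ)}
    (hb : ∀ P ∈ T, P.1.natAbs ≤ N ∧ P.2.1.natAbs ≤ N ∧ P.2.2.natAbs ≤ N)
    (hT : ∀ P ∈ T, (P.2.2 + P.1) ^ d - P.2.2 ^ d + P.2.1 ^ d = c) {I : Finset ℕ}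
    (hI : ∀ p ∈ I, p.Prime ∧ d < p) (k : ℕ → ℤ × ℤ × ℤ) :
    SurfaceClass d N (∏ p ∈ I, p) c (residueClass T I k) where
  bound P hP := hb P hP.1
  eqn P hP := hT P hP.1
  congr P hP Q hQ := by
    have h1 : ∀ a b : ℤ, (∀ p ∈ I, a % (p : ℕ) = b % (p : ℕ)) →
        ((∏ p ∈ I, p : ℕ) : ℤ) ∣ a - b := by
      intro a b hab
      refine Int.natCast_dvd.2 (Finset.prod_primes_dvd _ (fun p hp => (hI p hp).1.prime)
        fun p hp => Int.natCast_dvd.1 ?_)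
      exact Int.ModEq.dvd (hab p hp).symm
    have h2 : ∀ p ∈ I, (P.1 % (p : ℤ), P.2.1 % (p : ℤ), P.2.2 % (p : ℤ)) =
        (Q.1 % (p : ℤ), Q.2.1 % (p : ℤ), Q.2.2 % (p : ℤ)) := by
      intro p hp
      have := congrFun (hP.2.2.trans hQ.2.2.symm) p
      simpa only [residues, if_pos hp] using this
    simp only [Prod.mk.injEq] at h2
    exact ⟨h1 _ _ fun p hp => (h2 p hp).1, h1 _ _ fun p hp => (h2 p hp).2.1,
      h1 _ _ fun p hp => (h2 p hp).2.2⟩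
  coprime P hP := by
    rw [Nat.cast_prod]
    refine IsCoprime.prod_right fun p hp => ?_
    have hpp := Nat.prime_iff_prime_int.1 (hI p hp).1
    refine IsCoprime.mul_left ?_ (IsCoprime.pow_left ?_)
    · refine (hpp.coprime_iff_not_dvd.2 fun h => ?_).symm
      have h1 := Nat.le_of_dvd hd (Int.natCast_dvd_natCast.1 h)
      have h2 := (hI p hp).2
      omega
    · exact (hpp.coprime_iff_not_dvd.2 (hP.2.1 p hp)).symm

theorem card_biUnion_le_mul {α β : Type*} [DecidableEq β] {s : Finset α} {f : α → Finset β}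
    {a b : ℝ} (hs : (s.card : ℝ) ≤ a) (hb : 0 ≤ b) (hf : ∀ x ∈ s, ((f x).card : ℝ) ≤ b) :
    ((s.biUnion f).card : ℝ) ≤ a * b := by
  calc ((s.biUnion f).card : ℝ) ≤ ((∑ x ∈ s, (f x).card : ℕ) : ℝ) := by
        exact_mod_cast Finset.card_biUnion_le
    _ = ∑ x ∈ s, ((f x).card : ℝ) := Nat.cast_sum _ _
    _ ≤ s.card * b := by
        rw [← nsmul_eq_mul]; exact Finset.sum_le_card_nsmul _ _ _ hf
    _ ≤ a * b := by gcongr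

theorem card_image_residues_le_pow [DecidableEq (ℕ → ℤ × ℤ × ℤ)] {d : ℕ} (hd : 0 < d) {c : ℤ}
    {T : Finset (ℤ × ℤ × ℤ)}
    (hT : ∀ P ∈ T, (P.2.2 + P.1) ^ d - P.2.2 ^ d + P.2.1 ^ d = c) {I : Finset ℕ} {x : ℝ}
    (hI : ∀ p ∈ I, p.Prime ∧ (p : ℝ) ≤ x) (hx : 1 ≤ x) {K : ℕ} (hK : I.card ≤ K) :
    ((T.image (residues I)).card : ℝ) ≤ ((d : ℝ) * x ^ 2) ^ K := by
  have h1 : (1 : ℝ) ≤ d := by exact_mod_cast hd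
  calc ((T.image (residues I)).card : ℝ) ≤ ((∏ p ∈ I, d * p ^ 2 : ℕ) : ℝ) := by
        exact_mod_cast card_image_residues_le hd hT fun p hp => (hI p hp).1
    _ = ∏ p ∈ I, ((d : ℝ) * (p : ℝ) ^ 2) := by push_cast; rfl
    _ ≤ ∏ p ∈ I, ((d : ℝ) * x ^ 2) := by
        refine Finset.prod_le_prod (fun _ _ => by positivity) fun p hp => ?_
        have := (hI p hp).2
        gcongr
    _ = ((d : ℝ) * x ^ 2) ^ I.card := Finset.prod_const _
    _ ≤ _ := pow_le_pow_right₀ (one_le_mul_of_one_le_of_one_le h1 (one_le_pow₀ hx)) hK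

/-- The number of points on the surface `(z + u) ^ d - z ^ d + y ^ d = c`. -/
theorem exists_card_surface_le {d : ℕ} (hd : 2 ≤ d) {ε : ℝ} (hε : 0 < ε) :
    ∃ (C₀ : ℝ) (N₀ : ℕ), ∀ N : ℕ, N₀ ≤ N → ∀ c : ℤ, c.natAbs ≤ N ^ (d + 1) →
      Irreducible (X ^ d - C c : ℤ[X]) → ∀ T : Finset (ℤ × ℤ × ℤ),
      (∀ P ∈ T, P.1.natAbs ≤ N ∧ P.2.1.natAbs ≤ N ∧ P.2.2.natAbs ≤ N) →
      (∀ P ∈ T, P.1 ≠ 0 ∧ P.2.1 ≠ 0) →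
      (∀ P ∈ T, (P.2.2 + P.1) ^ d - P.2.2 ^ d + P.2.1 ^ d = c) →
      (T.card : ℝ) ≤ C₀ * (N : ℝ) ^ (2 / Real.sqrt d + ε) := by
  classical
  have hd0 : 0 < d := by omega
  have hsd : 0 < Real.sqrt d := Real.sqrt_pos.2 (by exact_mod_cast hd0)
  set θ : ℝ := 1 / Real.sqrt d + ε / 8 with hθdef
  have hθ0 : 0 < θ := by positivity
  have hθ : 1 < θ * Real.sqrt d := by
    rw [hθdef, add_mul, one_div_mul_cancel hsd.ne']
    have : 0 < ε / 8 * Real.sqrt d := by positivity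
    linarith
  obtain ⟨K, hK⟩ := exists_nat_gt (max θ (8 * θ / ε))
  have hK1 : θ < K := (le_max_left _ _).trans_lt hK
  have hK2 : 8 * θ / ε < K := (le_max_right _ _).trans_lt hK
  have hK0 : (0 : ℝ) < K := hθ0.trans hK1
  set η : ℝ := θ / K with hηdef
  have hη0 : 0 < η := by positivity
  have hη1 : η < 1 := (div_lt_one hK0).2 hK1
  have hηK : η * K = θ := div_mul_cancel₀ _ hK0.ne'
  have hηε : η ≤ ε / 8 := by
    rw [hηdef, div_le_iff₀ hK0]
    rw [div_lt_iff₀ hε] at hK2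
    linarith
  obtain ⟨n, A, N₁, C₁, hdec⟩ := exists_class_decomposition hd hθ0 hθ
    (show 0 < ε / 4 by positivity) (K + d + 1)
  obtain ⟨m, hm⟩ := exists_nat_ge ((A : ℝ) / η)
  obtain ⟨m', hm'⟩ := exists_nat_ge (1 / η)
  set L := K + m + m' with hL
  obtain ⟨N₂, hprimes⟩ := exists_primes_near_rpow d L hη0 hη1
  set B : ℝ := (2 ^ (K + 1) * 2 ^ (K + 1)) * ((n * n) * ((2 * n * n * n : ℕ) * d)) with hB
  set D : ℝ := ((d : ℝ) * (2 ^ (L + 1)) ^ 2) ^ (K + 1) with hD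
  refine ⟨2 ^ L * D * (|C₁| + B), 2 + N₁ + N₂, ?_⟩
  intro N hN c hc hirr T hTb hT0 hT
  have hN2 : 2 ≤ N := by omega
  have hN0 : (0 : ℝ) < N := by exact_mod_cast (by omega : 0 < N)
  have hN1 : (1 : ℝ) ≤ N := by exact_mod_cast (by omega : 1 ≤ N)
  obtain ⟨Q, hQL, hQ⟩ := hprimes N (by omega)
  have hclass : ∀ I k, I ⊆ Q → I.card = K →
      ∃ (Z : Finset (ℤ × ℤ × ℤ)) (Φ : Finset ℤ[X][X]),
        (Z.card : ℝ) ≤ C₁ * (N : ℝ) ^ (ε / 4) ∧ Φ.card ≤ n ∧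
        (∀ h ∈ Φ, Irreducible h ∧ h.natDegree ≠ 0 ∧ BidegLE n h) ∧
        ∀ P ∈ residueClass T I k, P ∈ Z ∨ ∃ h ∈ Φ, (spec P.1 h).eval P.2.1 = 0 ∧
          (derivative (spec P.1 h)).eval P.2.1 ≠ 0 ∧
          ((derivative (spec P.1 h)).eval P.2.1).natAbs ≤ N ^ A ∧
          ¬ IsCoprime ((derivative (spec P.1 h)).eval P.2.1) ((∏ p ∈ I, p : ℕ) : ℤ) := by
    intro I k hIQ hIK
    refine hdec N (∏ p ∈ I, p) (by omega) ?_ ?_ c ?_ hirr _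
      (surfaceClass_residueClass hd0 hTb hT (fun p hp => ⟨(hQ p (hIQ hp)).1, (hQ p (hIQ hp)).2.1⟩)
        k) (fun P hP => (hT0 P hP.1).1)
    · rw [Nat.cast_prod]
      calc (N : ℝ) ^ θ = ∏ p ∈ I, (N : ℝ) ^ η := by
            rw [Finset.prod_const, hIK, ← Real.rpow_natCast, ← Real.rpow_mul hN0.le, hηK]
        _ ≤ ∏ p ∈ I, (p : ℝ) := Finset.prod_le_prod (fun _ _ => by positivity)
            fun p hp => (hQ p (hIQ hp)).2.2.1
    · calc ∏ p ∈ I, p ≤ ∏ p ∈ I, N := Finset.prod_le_prod' fun p hp => (hQ p (hIQ hp)).2.2.2.2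
        _ = N ^ K := by rw [Finset.prod_const, hIK]
        _ ≤ _ := Nat.pow_le_pow_right (by omega) (by omega)
    · exact hc.trans (Nat.pow_le_pow_right (by omega) (by omega))
  choose! Z Φ hZ hΦn hΦ hcover using hclass
  have hzeros : ∀ h g : ℤ[X][X], ∃ W : Finset (ℤ × ℤ), W.card ≤ 2 * n * n * n ∧
      (Irreducible h → h.natDegree ≠ 0 → ¬ h ∣ g → BidegLE n h → BidegLE n g →
        ∀ u y : ℤ, (spec u h).eval y = 0 → (spec u g).eval y = 0 → (u, y) ∈ W) := by
    intro h g
    by_cases hcond : Irreducible h ∧ h.natDegree ≠ 0 ∧ ¬ h ∣ g ∧ BidegLE n h ∧ BidegLE n g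
    · obtain ⟨h1, h2, h3, h4, h5⟩ := hcond
      obtain ⟨W, hW, hW'⟩ := exists_finset_common_zeros h1 h2 h3 h4 h5
      exact ⟨W, hW, fun _ _ _ _ _ => hW'⟩
    · exact ⟨∅, by simp, fun h1 h2 h3 h4 h5 => absurd ⟨h1, h2, h3, h4, h5⟩ hcond⟩
  choose W hW hWmem using hzeros
  let Z' : Finset ℕ → (ℕ → ℤ × ℤ × ℤ) → Finset (ℤ × ℤ × ℤ) := fun J k =>
    (J.powersetCard K ×ˢ J.powersetCard K).biUnion fun I =>
      (Φ I.1 (restrictResidues I.1 k) ×ˢ Φ I.2 (restrictResidues I.2 k)).biUnion fun h =>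
        fibre d c (W h.1 h.2)
  have hsubset : T ⊆ ((Q.powersetCard K).biUnion fun I => (T.image (residues I)).biUnion (Z I)) ∪
      ((Q.powersetCard (K + 1)).biUnion fun J => (T.image (residues J)).biUnion (Z' J)) := by
    intro P hP
    by_contra hnot
    rw [Finset.mem_union, not_or] at hnot
    obtain ⟨hnot1, hnot2⟩ := hnot
    set R := Q.filter fun p : ℕ => ¬ (p : ℤ) ∣ P.2.1 with hR
    have hRQ : R ⊆ Q := Finset.filter_subset _ _
    have hcard : ∀ (w : ℤ) (a b : ℕ), w ≠ 0 → w.natAbs ≤ N ^ a → (a : ℝ) / η ≤ b →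
        (Q.filter fun p : ℕ => (p : ℤ) ∣ w).card ≤ b := by
      intro w a b hw hwa hab
      have h1 := card_filter_dvd_mul_le hN2 (fun p hp => ⟨(hQ p hp).1, (hQ p hp).2.2.1⟩) hw hwa
      rw [← le_div_iff₀ hη0] at h1
      exact_mod_cast h1.trans hab
    have hRcard : K + m ≤ R.card := by
      have h1 := hcard P.2.1 1 m' (hT0 P hP).2 (by rw [pow_one]; exact (hTb P hP).2.1)
        (by rw [Nat.cast_one]; exact hm')
      have h2 := Finset.card_filter_add_card_filter_not (s := Q) (fun p : ℕ => (p : ℤ) ∣ P.2.1)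
      rw [← hR] at h2
      omega
    have hmem : ∀ I ⊆ R, P ∈ residueClass T I (residues I P) := fun I hI =>
      ⟨hP, fun p hp => (Finset.mem_filter.1 (hI hp)).2, rfl⟩
    have hex : ∀ I, I ⊆ R → I.card = K → ∃ h ∈ Φ I (residues I P), (spec P.1 h).eval P.2.1 = 0 ∧
          (derivative (spec P.1 h)).eval P.2.1 ≠ 0 ∧
          ((derivative (spec P.1 h)).eval P.2.1).natAbs ≤ N ^ A ∧
          ¬ IsCoprime ((derivative (spec P.1 h)).eval P.2.1) ((∏ p ∈ I, p : ℕ) : ℤ) := by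
      intro I hI hIK
      refine (hcover I (residues I P) (hI.trans hRQ) hIK P (hmem I hI)).resolve_left fun hZP => ?_
      exact hnot1 (Finset.mem_biUnion.2 ⟨I, Finset.mem_powersetCard.2 ⟨hI.trans hRQ, hIK⟩,
        Finset.mem_biUnion.2 ⟨_, Finset.mem_image_of_mem _ hP, hZP⟩⟩)
    choose! h hh1 hh2 using hex
    refine false_of_forall_not_isCoprime (L := R) (K := K) (m := m) (A := A) (N := N)
      (fun p hp => (hQ p (hRQ hp)).1) hRcard ?_ h hh2 ?_
    · intro w hw hwA
      exact (Finset.card_le_card (Finset.filter_subset_filter _ hRQ)).trans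
        (hcard w A m hw hwA hm)
    · intro I I' hI hI' hIK hIK' hII
      by_contra hndvd
      refine hnot2 (Finset.mem_biUnion.2 ⟨I ∪ I', Finset.mem_powersetCard.2
        ⟨(Finset.union_subset hI hI').trans hRQ, hII⟩,
        Finset.mem_biUnion.2 ⟨_, Finset.mem_image_of_mem _ hP, ?_⟩⟩)
      refine Finset.mem_biUnion.2 ⟨(I, I'), Finset.mem_product.2
        ⟨Finset.mem_powersetCard.2 ⟨Finset.subset_union_left, hIK⟩,
          Finset.mem_powersetCard.2 ⟨Finset.subset_union_right, hIK'⟩⟩, ?_⟩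
      refine Finset.mem_biUnion.2 ⟨(h I, h I'), ?_, ?_⟩
      · rw [restrictResidues_residues Finset.subset_union_left,
          restrictResidues_residues Finset.subset_union_right]
        exact Finset.mem_product.2 ⟨hh1 I hI hIK, hh1 I' hI' hIK'⟩
      · obtain ⟨h1, h2, h3⟩ := hΦ I (residues I P) (hI.trans hRQ) hIK _ (hh1 I hI hIK)
        obtain ⟨-, -, h4⟩ := hΦ I' (residues I' P) (hI'.trans hRQ) hIK' _ (hh1 I' hI' hIK')
        exact mem_fibre hd (hT0 P hP).1 (hT P hP)
          (hWmem _ _ h1 h2 hndvd h3 h4 _ _ (hh2 I hI hIK).1 (hh2 I' hI' hIK').1)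
  have hx1 : (1 : ℝ) ≤ 2 ^ (L + 1) * (N : ℝ) ^ η :=
    one_le_mul_of_one_le_of_one_le (one_le_pow₀ one_le_two) (Real.one_le_rpow hN1 hη0.le)
  set M : ℝ := ((d : ℝ) * (2 ^ (L + 1) * (N : ℝ) ^ η) ^ 2) ^ (K + 1) with hM
  have hM0 : 0 ≤ M := by positivity
  have himage : ∀ I ⊆ Q, I.card ≤ K + 1 → ((T.image (residues I)).card : ℝ) ≤ M :=
    fun I hI hIK => card_image_residues_le_pow hd0 hT
      (fun p hp => ⟨(hQ p (hI hp)).1, (hQ p (hI hp)).2.2.2.1⟩) hx1 hIK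
  have hpow : ∀ (J : Finset ℕ) (a b : ℕ), J.card ≤ a →
      ((J.powersetCard b).card : ℝ) ≤ 2 ^ a := by
    intro J a b hJ
    have : (J.powersetCard b).card ≤ 2 ^ a := by
      rw [Finset.card_powersetCard]
      exact (Nat.choose_le_two_pow _ _).trans (Nat.pow_le_pow_right two_pos hJ)
    exact_mod_cast this
  have hB0 : 0 ≤ B := by positivity
  have hbound1 : (((Q.powersetCard K).biUnion fun I =>
      (T.image (residues I)).biUnion (Z I)).card : ℝ) ≤
      2 ^ L * (M * (|C₁| * (N : ℝ) ^ (ε / 4))) := by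
    refine card_biUnion_le_mul (hpow Q L K hQL.le) (by positivity) fun I hI => ?_
    obtain ⟨hI1, hI2⟩ := Finset.mem_powersetCard.1 hI
    refine card_biUnion_le_mul (himage I hI1 (by omega)) (by positivity) fun k _ => ?_
    refine (hZ I k hI1 hI2).trans ?_
    gcongr
    exact le_abs_self _
  have hbound2 : (((Q.powersetCard (K + 1)).biUnion fun J =>
      (T.image (residues J)).biUnion (Z' J)).card : ℝ) ≤ 2 ^ L * (M * B) := by
    refine card_biUnion_le_mul (hpow Q L (K + 1) hQL.le) (by positivity) fun J hJ => ?_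
    obtain ⟨hJ1, hJ2⟩ := Finset.mem_powersetCard.1 hJ
    refine card_biUnion_le_mul (himage J hJ1 hJ2.le) hB0 fun k _ => ?_
    refine card_biUnion_le_mul ?_ (by positivity) fun I hI => ?_
    · rw [Finset.card_product, Nat.cast_mul]
      exact mul_le_mul (hpow J _ K hJ2.le) (hpow J _ K hJ2.le) (by positivity) (by positivity)
    · obtain ⟨hI1, hI2⟩ := Finset.mem_product.1 hI
      obtain ⟨hI3, hI4⟩ := Finset.mem_powersetCard.1 hI1
      obtain ⟨hI5, hI6⟩ := Finset.mem_powersetCard.1 hI2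
      refine card_biUnion_le_mul ?_ (by positivity) fun h _ => ?_
      · rw [Finset.card_product]
        exact_mod_cast Nat.mul_le_mul (hΦn I.1 _ (hI3.trans hJ1) hI4)
          (hΦn I.2 _ (hI5.trans hJ1) hI6)
      · have := (card_fibre_le hd c (W h.1 h.2)).trans (Nat.mul_le_mul_right d (hW h.1 h.2))
        exact_mod_cast this
  have hMval : M = D * (N : ℝ) ^ (2 * η * (K + 1)) := by
    have h1 : ((N : ℝ) ^ η) ^ (2 * (K + 1)) = (N : ℝ) ^ (2 * η * (K + 1)) := by
      rw [← Real.rpow_natCast, ← Real.rpow_mul hN0.le]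
      congr 1
      push_cast
      ring
    rw [hM, hD, ← h1]
    ring
  have hexp : 2 * η * (K + 1) + ε / 4 ≤ 2 / Real.sqrt d + ε := by
    have h1 : 2 * η * (K + 1) = 2 * θ + 2 * η := by rw [← hηK]; ring
    rw [h1, hθdef]
    have h2 : 2 * (1 / Real.sqrt d + ε / 8) = 2 / Real.sqrt d + ε / 4 := by ring
    rw [h2]
    linarith
  have hNε : (1 : ℝ) ≤ (N : ℝ) ^ (ε / 4) := Real.one_le_rpow hN1 (by positivity)
  have hD0 : 0 ≤ D := by positivity
  have hTcard := (Finset.card_le_card hsubset).trans (Finset.card_union_le _ _)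
  rw [← Nat.cast_le (α := ℝ), Nat.cast_add] at hTcard
  calc (T.card : ℝ) ≤ 2 ^ L * (M * (|C₁| * (N : ℝ) ^ (ε / 4))) + 2 ^ L * (M * B) :=
        hTcard.trans (add_le_add hbound1 hbound2)
    _ ≤ 2 ^ L * (M * (|C₁| * (N : ℝ) ^ (ε / 4))) + 2 ^ L * (M * (B * (N : ℝ) ^ (ε / 4))) := by
        gcongr
        exact le_mul_of_one_le_right hB0 hNε
    _ = 2 ^ L * D * (|C₁| + B) * ((N : ℝ) ^ (2 * η * (K + 1)) * (N : ℝ) ^ (ε / 4)) := by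
        rw [hMval]; ring
    _ = 2 ^ L * D * (|C₁| + B) * (N : ℝ) ^ (2 * η * (K + 1) + ε / 4) := by
        rw [← Real.rpow_add hN0]
    _ ≤ _ := by
        gcongr

theorem exists_card_surface_le_of_pos {d : ℕ} (hd : 2 ≤ d) (A : ℕ) {ε : ℝ} (hε : 0 < ε) :
    ∃ C₀ : ℝ, ∀ N : ℕ, 0 < N → ∀ c : ℤ, c.natAbs ≤ A * N ^ d → ∀ T : Finset (ℤ × ℤ × ℤ),
      (∀ P ∈ T, 0 < P.2.2 + P.1 ∧ (0 < P.2.1 ∧ P.2.1 ≤ N) ∧ 0 < P.2.2 ∧ P.2.2 ≤ N) →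
      (∀ P ∈ T, (P.2.2 + P.1) ^ d - P.2.2 ^ d + P.2.1 ^ d = c) →
      (T.card : ℝ) ≤ C₀ * (N : ℝ) ^ (1 + ε) := by
  have hd0 : d ≠ 0 := by omega
  have hdR : (0 : ℝ) < d := by exact_mod_cast (by omega : 0 < d)
  obtain ⟨C₁, hC₁, hdiv⟩ := exists_card_divisors_le (show 0 < ε / d by positivity)
  set B : ℝ := C₁ * ((A + 1 : ℕ) : ℝ) ^ (ε / d) with hB
  have hB0 : 0 ≤ B := by positivity
  refine ⟨1 + 2 * B * d, ?_⟩
  intro N hN c hc T hTb hT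
  have hN0 : (0 : ℝ) < N := by exact_mod_cast hN
  have hN1 : (1 : ℝ) ≤ N := by exact_mod_cast hN
  let D : ℤ → Finset (ℤ × ℤ) := fun y => (intDivisors (c - y ^ d)).image fun u => (u, y)
  let W : Finset (ℤ × ℤ) := (Finset.Icc (1 : ℤ) N).biUnion D
  have hD : ∀ y ∈ Finset.Icc (1 : ℤ) N, ((D y).card : ℝ) ≤ 2 * B * (N : ℝ) ^ ε := by
    intro y hy
    rw [Finset.mem_Icc] at hy
    have h1 : (D y).card ≤ 2 * (c - y ^ d).natAbs.divisors.card :=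
      Finset.card_image_le.trans (card_intDivisors_le _)
    have h2 : ((D y).card : ℝ) ≤ 2 * ((c - y ^ d).natAbs.divisors.card : ℝ) := by
      exact_mod_cast h1
    refine h2.trans ?_
    rw [mul_assoc]
    refine mul_le_mul_of_nonneg_left ?_ zero_le_two
    by_cases h0 : (c - y ^ d).natAbs = 0
    · rw [h0, Nat.divisors_zero, Finset.card_empty, Nat.cast_zero]; positivity
    refine (hdiv _ h0).trans ?_
    have h3 : (c - y ^ d).natAbs ≤ (A + 1) * N ^ d := by
      have h4 : y.natAbs ^ d ≤ N ^ d := Nat.pow_le_pow_left (by omega) d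
      have h5 := Int.natAbs_sub_le c (y ^ d)
      rw [Int.natAbs_pow] at h5
      linarith
    have h6 : ((c - y ^ d).natAbs : ℝ) ≤ ((A + 1 : ℕ) : ℝ) * (N : ℝ) ^ d := by exact_mod_cast h3
    calc C₁ * ((c - y ^ d).natAbs : ℝ) ^ (ε / d)
        ≤ C₁ * (((A + 1 : ℕ) : ℝ) * (N : ℝ) ^ d) ^ (ε / d) := by gcongr
      _ = B * (N : ℝ) ^ ε := by
        rw [Real.mul_rpow (by positivity) (by positivity), ← Real.rpow_natCast (N : ℝ) d,
          ← Real.rpow_mul hN0.le, mul_div_cancel₀ _ hdR.ne', hB, mul_assoc]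
  have hW : (W.card : ℝ) ≤ N * (2 * B * (N : ℝ) ^ ε) :=
    card_biUnion_le_mul (by simp) (by positivity) hD
  have h0 : (T.filter fun P => P.1 = 0).card ≤ N := by
    have h1 : (T.filter fun P => P.1 = 0).card ≤ (Finset.Icc (1 : ℤ) N).card := by
      refine Finset.card_le_card_of_injOn (fun P => P.2.2) ?_ ?_
      · intro P hP
        have := hTb P (Finset.mem_filter.1 hP).1
        simp only [Finset.coe_Icc, Set.mem_Icc]
        omega
      · rintro ⟨u, y, z⟩ hP ⟨u', y', z'⟩ hP' h
        obtain ⟨hP1, hP2⟩ := Finset.mem_filter.1 hP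
        obtain ⟨hP1', hP2'⟩ := Finset.mem_filter.1 hP'
        have e1 := hT _ hP1
        have e2 := hT _ hP1'
        have b1 := hTb _ hP1
        have b2 := hTb _ hP1'
        simp only at hP2 hP2' h e1 e2 b1 b2
        subst hP2 hP2' h
        have h3 : y ^ d = y' ^ d := by linarith
        rw [(pow_left_inj₀ b1.2.1.1.le b2.2.1.1.le hd0).1 h3]
    simpa using h1
  have h1 : (T.filter fun P => ¬ P.1 = 0) ⊆ fibre d c W := by
    rintro ⟨u, y, z⟩ hP
    obtain ⟨hP1, hP2⟩ := Finset.mem_filter.1 hP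
    have e1 := hT _ hP1
    have b1 := hTb _ hP1
    simp only at hP2 e1 b1
    refine mem_fibre hd hP2 e1 (Finset.mem_biUnion.2 ⟨y, Finset.mem_Icc.2 (by omega),
      Finset.mem_image.2 ⟨u, ?_, rfl⟩⟩)
    have h2 : c - y ^ d = (z + u) ^ d - z ^ d := by linarith
    rw [h2]
    refine mem_intDivisors (fun h3 => hP2 ?_) ?_
    · have h4 := (pow_left_inj₀ b1.1.le b1.2.2.1.le hd0).1 (sub_eq_zero.1 h3)
      omega
    · simpa using sub_dvd_pow_sub_pow (z + u) z d
  have h2 := (Finset.card_le_card h1).trans (card_fibre_le hd c W)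
  have h3 := Finset.card_filter_add_card_filter_not (s := T) (fun P => P.1 = 0)
  have h4 : (T.card : ℝ) ≤ N + W.card * d := by
    have : T.card ≤ N + W.card * d := by omega
    exact_mod_cast this
  have hNε : (1 : ℝ) ≤ (N : ℝ) ^ ε := Real.one_le_rpow hN1 hε.le
  calc (T.card : ℝ) ≤ N + W.card * d := h4
    _ ≤ N * (N : ℝ) ^ ε + N * (2 * B * (N : ℝ) ^ ε) * d := by
        gcongr
        exact le_mul_of_one_le_right hN0.le hNε
    _ = (1 + 2 * B * d) * (N : ℝ) ^ (1 + ε) := by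
        rw [Real.rpow_add hN0, Real.rpow_one]; ring

theorem pow_ne_of_irreducible {d : ℕ} (hd : 2 ≤ d) {c : ℤ}
    (hirr : Irreducible (X ^ d - C c : ℤ[X])) (y : ℤ) : y ^ d ≠ c := by
  intro hy
  have h1 : (X ^ d - C c : ℤ[X]).natDegree = d := natDegree_X_pow_sub_C
  have h2 : (X ^ d - C c : ℤ[X]).IsRoot y := by simp [hy]
  obtain ⟨g, hg⟩ := dvd_iff_isRoot.2 h2
  have h3 : g ≠ 0 := fun h => hirr.ne_zero (by rw [hg, h, mul_zero])
  have h4 := natDegree_mul (X_sub_C_ne_zero y) h3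
  rw [← hg, h1, natDegree_X_sub_C] at h4
  rcases hirr.isUnit_or_isUnit hg with h5 | h5
  · exact not_isUnit_X_sub_C _ h5
  · have := natDegree_eq_zero_of_isUnit h5
    omega

end

theorem stmt10 (d : ℕ) (hd : 2 ≤ d) (k : ℤ) (hk : k ≠ 0) :
    ∀ ε > (0:ℝ), ∃ C : ℝ, 0 < C ∧ ∀ N : ℕ, 0 < N →
      ((((Finset.Icc 1 N ×ˢ Finset.Icc 1 N) ×ˢ (Finset.Icc 1 N ×ˢ Finset.Icc 1 N)).filter
        (fun q : (ℕ × ℕ) × ℕ × ℕ =>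
          (q.1.1 : ℤ) ^ d + (q.1.2 : ℤ) ^ d - (q.2.1 : ℤ) ^ d - (q.2.2 : ℤ) ^ d = k)).card : ℝ) ≤
        C * (N : ℝ) ^ (1 + 2 / Real.sqrt d + ε) := by
  intro ε hε
  have hs0 : 0 ≤ 2 / Real.sqrt d := by positivity
  obtain ⟨C₁, N₁, hsurf⟩ := exists_card_surface_le hd hε
  obtain ⟨C₂, hpos⟩ := exists_card_surface_le_of_pos hd (k.natAbs + 1) hε
  set N₀ := N₁ + k.natAbs + 2 with hN₀
  refine ⟨(N₀ : ℝ) ^ 4 + |C₁| + k.natAbs * |C₂|, by positivity, ?_⟩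
  intro N hN
  set S := ((Finset.Icc 1 N ×ˢ Finset.Icc 1 N) ×ˢ (Finset.Icc 1 N ×ˢ Finset.Icc 1 N)).filter
    (fun q : (ℕ × ℕ) × ℕ × ℕ =>
      (q.1.1 : ℤ) ^ d + (q.1.2 : ℤ) ^ d - (q.2.1 : ℤ) ^ d - (q.2.2 : ℤ) ^ d = k) with hS
  have hN0 : (0 : ℝ) < N := by exact_mod_cast hN
  have hN1 : (1 : ℝ) ≤ N := by exact_mod_cast hN
  have hNs : (1 : ℝ) ≤ (N : ℝ) ^ (1 + 2 / Real.sqrt d + ε) :=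
    Real.one_le_rpow hN1 (by positivity)
  have hS4 : S.card ≤ N ^ 4 := by
    refine (Finset.card_filter_le _ _).trans (le_of_eq ?_)
    simp only [Finset.card_product, Nat.card_Icc, Nat.add_sub_cancel]
    ring
  rcases lt_or_ge N N₀ with hlt | hge
  · have h1 : (S.card : ℝ) ≤ (N₀ : ℝ) ^ 4 := by
      exact_mod_cast hS4.trans (Nat.pow_le_pow_left hlt.le 4)
    calc (S.card : ℝ) ≤ (N₀ : ℝ) ^ 4 + |C₁| + k.natAbs * |C₂| := by
          have : 0 ≤ |C₁| + k.natAbs * |C₂| := by positivity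
          linarith
      _ ≤ _ := le_mul_of_one_le_right (by positivity) hNs
  let f : (ℕ × ℕ) × ℕ × ℕ → ℤ × ℤ × ℤ := fun q => (q.1.1 - q.2.1, q.1.2, q.2.1)
  let T : ℕ → Finset (ℤ × ℤ × ℤ) := fun w => (S.filter fun q => q.2.2 = w).image f
  have hTS : ∀ w, (S.filter fun q => q.2.2 = w).card = (T w).card := by
    intro w
    refine (Finset.card_image_of_injOn ?_).symm
    rintro ⟨⟨x, y⟩, z, v⟩ hq ⟨⟨x', y'⟩, z', v'⟩ hq' h
    have hv := (Finset.mem_filter.1 hq).2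
    have hv' := (Finset.mem_filter.1 hq').2
    simp only [f, Prod.mk.injEq] at h hv hv' ⊢
    omega
  have hTb : ∀ w, ∀ P ∈ T w, (0 < P.2.2 + P.1 ∧ P.2.2 + P.1 ≤ N) ∧
      (0 < P.2.1 ∧ P.2.1 ≤ N) ∧ 0 < P.2.2 ∧ P.2.2 ≤ N := by
    intro w P hP
    obtain ⟨q, hq, rfl⟩ := Finset.mem_image.1 hP
    have h1 := (Finset.mem_filter.1 (Finset.mem_filter.1 hq).1).1
    simp only [Finset.mem_product, Finset.mem_Icc] at h1
    simp only [f]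
    omega
  have hTe : ∀ w, ∀ P ∈ T w, (P.2.2 + P.1) ^ d - P.2.2 ^ d + P.2.1 ^ d = k + (w : ℤ) ^ d := by
    intro w P hP
    obtain ⟨q, hq, rfl⟩ := Finset.mem_image.1 hP
    obtain ⟨h1, h2⟩ := Finset.mem_filter.1 hq
    have h3 := (Finset.mem_filter.1 h1).2
    simp only [f, add_sub_cancel]
    rw [← h3, h2]
    ring
  have hc : ∀ w ≤ N, (k + (w : ℤ) ^ d).natAbs ≤ k.natAbs + N ^ d := by
    intro w hw
    refine (Int.natAbs_add_le _ _).trans ?_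
    rw [Int.natAbs_pow, Int.natAbs_natCast]
    have := Nat.pow_le_pow_left hw d
    omega
  have hNd : 1 ≤ N ^ d := Nat.one_le_pow _ _ hN
  have hbig : ∀ w, k.natAbs < w → w ≤ N →
      ((T w).card : ℝ) ≤ |C₁| * (N : ℝ) ^ (2 / Real.sqrt d + ε) := by
    intro w hkw hw
    have hirr := irreducible_X_pow_sub_C_add_pow (by omega : 0 < d) hk hkw
    refine (hsurf N (by omega) (k + (w : ℤ) ^ d) ?_ hirr (T w) ?_ ?_ (hTe w)).trans ?_
    · refine (hc w hw).trans ?_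
      rw [pow_succ]
      nlinarith [Nat.mul_le_mul hNd (show k.natAbs + 2 ≤ N by omega)]
    · intro P hP
      have := hTb w P hP
      omega
    · intro P hP
      have h1 := hTb w P hP
      refine ⟨fun h0 => ?_, by omega⟩
      have h2 := hTe w P hP
      rw [h0, add_zero, sub_self, zero_add] at h2
      exact pow_ne_of_irreducible hd hirr _ h2
    · gcongr
      exact le_abs_self _
  have hsmall : ∀ w ≤ N, ((T w).card : ℝ) ≤ |C₂| * (N : ℝ) ^ (1 + ε) := by
    intro w hw
    refine (hpos N hN (k + (w : ℤ) ^ d) ?_ (T w) (fun P hP => ?_) (hTe w)).trans ?_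
    · refine (hc w hw).trans ?_
      nlinarith [Nat.mul_le_mul_left k.natAbs hNd]
    · exact ⟨(hTb w P hP).1.1, (hTb w P hP).2⟩
    · gcongr
      exact le_abs_self _
  have hSsum : (S.card : ℝ) = ∑ w ∈ Finset.Icc 1 N, ((T w).card : ℝ) := by
    rw [Finset.card_eq_sum_card_fiberwise (f := fun q => q.2.2) (t := Finset.Icc 1 N)]
    · push_cast
      exact Finset.sum_congr rfl fun w _ => by rw [hTS]
    · intro q hq
      have h1 := (Finset.mem_filter.1 hq).1
      simp only [Finset.mem_product] at h1
      exact h1.2.2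
  have hsplit : ∀ w ∈ Finset.Icc 1 N, ((T w).card : ℝ) ≤
      |C₁| * (N : ℝ) ^ (2 / Real.sqrt d + ε) +
        if w ≤ k.natAbs then |C₂| * (N : ℝ) ^ (1 + ε) else 0 := by
    intro w hw
    have hw2 := (Finset.mem_Icc.1 hw).2
    split_ifs with h
    · exact (hsmall w hw2).trans (le_add_of_nonneg_left (by positivity))
    · rw [add_zero]
      exact hbig w (by omega) hw2
  have hcount : (((Finset.Icc 1 N).filter fun w => w ≤ k.natAbs).card : ℝ) ≤ k.natAbs := by
    have : ((Finset.Icc 1 N).filter fun w => w ≤ k.natAbs).card ≤ (Finset.Icc 1 k.natAbs).card :=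
      Finset.card_le_card fun w hw => by
        simp only [Finset.mem_filter, Finset.mem_Icc] at hw ⊢
        omega
    rw [Nat.card_Icc, Nat.add_sub_cancel] at this
    exact_mod_cast this
  have hexp : (N : ℝ) ^ (1 + ε) ≤ (N : ℝ) ^ (1 + 2 / Real.sqrt d + ε) :=
    Real.rpow_le_rpow_of_exponent_le hN1 (by linarith)
  calc (S.card : ℝ) ≤ ∑ w ∈ Finset.Icc 1 N, (|C₁| * (N : ℝ) ^ (2 / Real.sqrt d + ε) +
        if w ≤ k.natAbs then |C₂| * (N : ℝ) ^ (1 + ε) else 0) :=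
        hSsum.trans_le (Finset.sum_le_sum hsplit)
    _ = |C₁| * (N : ℝ) ^ (1 + 2 / Real.sqrt d + ε) +
        ((Finset.Icc 1 N).filter fun w => w ≤ k.natAbs).card * (|C₂| * (N : ℝ) ^ (1 + ε)) := by
        rw [Finset.sum_add_distrib, ← Finset.sum_filter, Finset.sum_const, Finset.sum_const,
          nsmul_eq_mul, nsmul_eq_mul, Nat.card_Icc, Nat.add_sub_cancel, add_assoc 1,
          Real.rpow_add hN0 1 (2 / Real.sqrt d + ε), Real.rpow_one]
        ring
    _ ≤ |C₁| * (N : ℝ) ^ (1 + 2 / Real.sqrt d + ε) +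
        k.natAbs * (|C₂| * (N : ℝ) ^ (1 + 2 / Real.sqrt d + ε)) := by gcongr
    _ ≤ ((N₀ : ℝ) ^ 4 + |C₁| + k.natAbs * |C₂|) * (N : ℝ) ^ (1 + 2 / Real.sqrt d + ε) := by
        have : 0 ≤ (N₀ : ℝ) ^ 4 * (N : ℝ) ^ (1 + 2 / Real.sqrt d + ε) := by positivity
        linarith
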